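/- Let (L,d,λ) be a weak Lie 3-algebra over a commutative ring k and (p,i,h) a deformation retract of (L,d) onto (L′,d′). Then the transferred structure maps (λ2′, λ3′, λ4′, λ21′, λ211′, λ31′, λ32′) define a weak Lie 3-algebra structure on (L′,d′): they satisfy equations (L1)–(L4) and (W1)–(W11). -/

import Mathlib

namespace WL3

open Finset

/-! ## Graded multilinear maps -/

/-- Cast along an equality of degrees. -/
def gcast {M : ℤ → Type} {i j : ℤ} (h : i = j) (x : M i) : M j := h ▸ x

/-- A degree-`r`, arity-`m` map between ℤ-graded types, given by its components on
homogeneous tuples: its component at degrees `d` maps `L (d 1) ⊗ ⋯ ⊗ L (d m)` to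
`M (r + d 1 + ⋯ + d m)`. -/
abbrev MMap (L M : ℤ → Type) (m : ℕ) (r : ℤ) : Type :=
  ∀ d : Fin m → ℤ, (∀ j, L (d j)) → M (r + ∑ j, d j)

variable {L M N : ℤ → Type}

/-- Cast an `MMap` along equalities of arities and degrees. -/
def mcast {m m' : ℕ} {r r' : ℤ} (hm : m = m') (hr : r = r') (μ : MMap L M m r) :
    MMap L M m' r' := by subst hm; subst hr; exact μ

/-- Koszul sign of the permutation `σ` acting on a tuple of homogeneous elements of
degrees `d`: `∏_{i<j, σ i > σ j} (-1)^(d i · d j)`. -/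
def koszulSign {m : ℕ} (d : Fin m → ℤ) (σ : Equiv.Perm (Fin m)) : ℤ :=
  ∏ p ∈ Finset.univ.filter (fun p : Fin m × Fin m => p.1 < p.2 ∧ σ p.2 < σ p.1),
    (-1 : ℤ) ^ (d p.1 * d p.2).natAbs

/-- The action `μ ↦ μ^σ`, `μ^σ(x₁,…,x_m) = ε(σ;x)·μ(x_{σ⁻¹1},…,x_{σ⁻¹m})`. -/
def pa [∀ i, AddCommGroup (M i)] {m : ℕ} {r : ℤ} (σ : Equiv.Perm (Fin m)) (μ : MMap L M m r) :
    MMap L M m r := fun d x =>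
  koszulSign d σ •
    gcast (by rw [Equiv.sum_comp σ.symm d])
      (μ (fun j => d (σ.symm j)) (fun j => x (σ.symm j)))

/-- Degrees of the outer map in a partial composition. -/
def outDeg (m₁ m₂ n : ℕ) (s : ℤ) (d : Fin (m₁ + n + m₂) → ℤ) : Fin (m₁ + 1 + m₂) → ℤ :=
  Fin.append
    (Fin.append (fun j : Fin m₁ => d (Fin.castAdd m₂ (Fin.castAdd n j)))
      (fun _ : Fin 1 => s + ∑ j : Fin n, d (Fin.castAdd m₂ (Fin.natAdd m₁ j))))
    (fun j : Fin m₂ => d (Fin.natAdd (m₁ + n) j))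

theorem outDeg_left (m₁ m₂ n : ℕ) (s : ℤ) (d : Fin (m₁ + n + m₂) → ℤ) (j : Fin m₁) :
    outDeg m₁ m₂ n s d (Fin.castAdd m₂ (Fin.castAdd 1 j))
      = d (Fin.castAdd m₂ (Fin.castAdd n j)) := by
  simp [outDeg, Fin.append_left]

theorem outDeg_mid (m₁ m₂ n : ℕ) (s : ℤ) (d : Fin (m₁ + n + m₂) → ℤ) (j : Fin 1) :
    outDeg m₁ m₂ n s d (Fin.castAdd m₂ (Fin.natAdd m₁ j))
      = s + ∑ j : Fin n, d (Fin.castAdd m₂ (Fin.natAdd m₁ j)) := by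
  simp [outDeg, Fin.append_left, Fin.append_right]

theorem outDeg_right (m₁ m₂ n : ℕ) (s : ℤ) (d : Fin (m₁ + n + m₂) → ℤ) (j : Fin m₂) :
    outDeg m₁ m₂ n s d (Fin.natAdd (m₁ + 1) j) = d (Fin.natAdd (m₁ + n) j) := by
  simp [outDeg, Fin.append_right]

theorem outDeg_sum (m₁ m₂ n : ℕ) (r s : ℤ) (d : Fin (m₁ + n + m₂) → ℤ) :
    r + ∑ j, outDeg m₁ m₂ n s d j = (r + s) + ∑ j, d j := by
  simp [outDeg, Fin.sum_univ_add, Fin.append_left, Fin.append_right]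
  ring

/-- Partial (operadic) composition `μ ∘_{m₁+1} ν` of `μ` (of arity `m₁ + 1 + m₂`) with `ν`
inserted in the slot `m₁ + 1`, with the Koszul sign `(-1)^(|ν|·(d 1 + ⋯ + d m₁))`. -/
def pcomp [∀ i, AddCommGroup (L i)] [∀ i, AddCommGroup (M i)] (m₁ m₂ : ℕ) {n : ℕ} {r s : ℤ}
    (μ : MMap L M (m₁ + 1 + m₂) r) (ν : MMap L L n s) : MMap L M (m₁ + n + m₂) (r + s) :=
  fun d x =>
    ((-1 : ℤ) ^ (s * ∑ j : Fin m₁, d (Fin.castAdd m₂ (Fin.castAdd n j))).natAbs) •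
    gcast (outDeg_sum m₁ m₂ n r s d)
      (μ (outDeg m₁ m₂ n s d)
        (fun j => Fin.addCases (motive := fun t => L (outDeg m₁ m₂ n s d t))
          (fun j' => Fin.addCases (motive := fun t => L (outDeg m₁ m₂ n s d (Fin.castAdd m₂ t)))
            (fun j1 => gcast (outDeg_left m₁ m₂ n s d j1).symm
              (x (Fin.castAdd m₂ (Fin.castAdd n j1))))
            (fun j0 => gcast (outDeg_mid m₁ m₂ n s d j0).symm
              (ν (fun j2 => d (Fin.castAdd m₂ (Fin.natAdd m₁ j2)))
                 (fun j2 => x (Fin.castAdd m₂ (Fin.natAdd m₁ j2)))))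
            j')
          (fun j3 => gcast (outDeg_right m₁ m₂ n s d j3).symm (x (Fin.natAdd (m₁ + n) j3)))
          j))

/-- Composition `μ ∘ g` of an arity-1 map with an arity-`a` map. -/
def comp₁ {a : ℕ} {r s : ℤ} (μ : MMap M N 1 r) (g : MMap L M a s) : MMap L N a (r + s) :=
  fun d x =>
    gcast (by rw [Fin.sum_univ_one]; ring)
      (μ (fun _ : Fin 1 => s + ∑ j, d j) (fun _ => g d x))

theorem sum2 (a b : ℕ) (r s₁ s₂ : ℤ) (d : Fin (a + b) → ℤ) :
    r + ∑ t : Fin 2, ![s₁ + ∑ j : Fin a, d (Fin.castAdd b j),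
                       s₂ + ∑ j : Fin b, d (Fin.natAdd a j)] t
      = (r + (s₁ + s₂)) + ∑ j, d j := by
  simp [Fin.sum_univ_two, Fin.sum_univ_add]
  ring

/-- Full composition `μ ∘ (g₁, g₂)` with Koszul signs. -/
def comp₂ [∀ i, AddCommGroup (N i)] {a b : ℕ} {r s₁ s₂ : ℤ}
    (μ : MMap M N 2 r) (g₁ : MMap L M a s₁) (g₂ : MMap L M b s₂) :
    MMap L N (a + b) (r + (s₁ + s₂)) :=
  fun d x =>
    ((-1 : ℤ) ^ (s₂ * ∑ j : Fin a, d (Fin.castAdd b j)).natAbs) •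
    gcast (sum2 a b r s₁ s₂ d)
      (μ ![s₁ + ∑ j : Fin a, d (Fin.castAdd b j), s₂ + ∑ j : Fin b, d (Fin.natAdd a j)]
        (Fin.cons (gcast (by simp) (g₁ (fun j => d (Fin.castAdd b j)) (fun j => x (Fin.castAdd b j))))
          (fun _ : Fin 1 => gcast (by simp) (g₂ (fun j => d (Fin.natAdd a j)) (fun j => x (Fin.natAdd a j))))))

theorem sum3 (a b c : ℕ) (r s₁ s₂ s₃ : ℤ) (d : Fin (a + b + c) → ℤ) :
    r + ∑ t : Fin 3, ![s₁ + ∑ j : Fin a, d (Fin.castAdd c (Fin.castAdd b j)),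
                       s₂ + ∑ j : Fin b, d (Fin.castAdd c (Fin.natAdd a j)),
                       s₃ + ∑ j : Fin c, d (Fin.natAdd (a + b) j)] t
      = (r + (s₁ + s₂ + s₃)) + ∑ j, d j := by
  simp [Fin.sum_univ_three, Fin.sum_univ_add]
  ring

/-- Full composition `μ ∘ (g₁, g₂, g₃)` with Koszul signs. -/
def comp₃ [∀ i, AddCommGroup (N i)] {a b c : ℕ} {r s₁ s₂ s₃ : ℤ}
    (μ : MMap M N 3 r) (g₁ : MMap L M a s₁) (g₂ : MMap L M b s₂) (g₃ : MMap L M c s₃) :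
    MMap L N (a + b + c) (r + (s₁ + s₂ + s₃)) :=
  fun d x =>
    ((-1 : ℤ) ^ (s₂ * (∑ j : Fin a, d (Fin.castAdd c (Fin.castAdd b j)))
        + s₃ * ((∑ j : Fin a, d (Fin.castAdd c (Fin.castAdd b j)))
          + ∑ j : Fin b, d (Fin.castAdd c (Fin.natAdd a j)))).natAbs) •
    gcast (sum3 a b c r s₁ s₂ s₃ d)
      (μ ![s₁ + ∑ j : Fin a, d (Fin.castAdd c (Fin.castAdd b j)),
           s₂ + ∑ j : Fin b, d (Fin.castAdd c (Fin.natAdd a j)),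
           s₃ + ∑ j : Fin c, d (Fin.natAdd (a + b) j)]
        (Fin.cons (gcast (by simp)
            (g₁ (fun j => d (Fin.castAdd c (Fin.castAdd b j)))
                (fun j => x (Fin.castAdd c (Fin.castAdd b j)))))
          (Fin.cons (gcast (by simp)
              (g₂ (fun j => d (Fin.castAdd c (Fin.natAdd a j)))
                  (fun j => x (Fin.castAdd c (Fin.natAdd a j)))))
            (fun _ : Fin 1 => gcast (by simp)
              (g₃ (fun j => d (Fin.natAdd (a + b) j))
                  (fun j => x (Fin.natAdd (a + b) j)))))))

theorem sum4 (a b c e : ℕ) (r s₁ s₂ s₃ s₄ : ℤ) (d : Fin (a + b + c + e) → ℤ) :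
    r + ∑ t : Fin 4, ![s₁ + ∑ j : Fin a, d (Fin.castAdd e (Fin.castAdd c (Fin.castAdd b j))),
                       s₂ + ∑ j : Fin b, d (Fin.castAdd e (Fin.castAdd c (Fin.natAdd a j))),
                       s₃ + ∑ j : Fin c, d (Fin.castAdd e (Fin.natAdd (a + b) j)),
                       s₄ + ∑ j : Fin e, d (Fin.natAdd (a + b + c) j)] t
      = (r + (s₁ + s₂ + s₃ + s₄)) + ∑ j, d j := by
  simp [Fin.sum_univ_four, Fin.sum_univ_add]
  ring

/-- Full composition `μ ∘ (g₁, g₂, g₃, g₄)` with Koszul signs. -/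
def comp₄ [∀ i, AddCommGroup (N i)] {a b c e : ℕ} {r s₁ s₂ s₃ s₄ : ℤ}
    (μ : MMap M N 4 r) (g₁ : MMap L M a s₁) (g₂ : MMap L M b s₂) (g₃ : MMap L M c s₃)
    (g₄ : MMap L M e s₄) :
    MMap L N (a + b + c + e) (r + (s₁ + s₂ + s₃ + s₄)) :=
  fun d x =>
    ((-1 : ℤ) ^ (s₂ * (∑ j : Fin a, d (Fin.castAdd e (Fin.castAdd c (Fin.castAdd b j))))
        + s₃ * ((∑ j : Fin a, d (Fin.castAdd e (Fin.castAdd c (Fin.castAdd b j))))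
          + ∑ j : Fin b, d (Fin.castAdd e (Fin.castAdd c (Fin.natAdd a j))))
        + s₄ * ((∑ j : Fin a, d (Fin.castAdd e (Fin.castAdd c (Fin.castAdd b j))))
          + (∑ j : Fin b, d (Fin.castAdd e (Fin.castAdd c (Fin.natAdd a j))))
          + ∑ j : Fin c, d (Fin.castAdd e (Fin.natAdd (a + b) j)))).natAbs) •
    gcast (sum4 a b c e r s₁ s₂ s₃ s₄ d)
      (μ ![s₁ + ∑ j : Fin a, d (Fin.castAdd e (Fin.castAdd c (Fin.castAdd b j))),
           s₂ + ∑ j : Fin b, d (Fin.castAdd e (Fin.castAdd c (Fin.natAdd a j))),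
           s₃ + ∑ j : Fin c, d (Fin.castAdd e (Fin.natAdd (a + b) j)),
           s₄ + ∑ j : Fin e, d (Fin.natAdd (a + b + c) j)]
        (Fin.cons (gcast (by simp)
            (g₁ (fun j => d (Fin.castAdd e (Fin.castAdd c (Fin.castAdd b j))))
                (fun j => x (Fin.castAdd e (Fin.castAdd c (Fin.castAdd b j))))))
          (Fin.cons (gcast (by simp)
              (g₂ (fun j => d (Fin.castAdd e (Fin.castAdd c (Fin.natAdd a j))))
                  (fun j => x (Fin.castAdd e (Fin.castAdd c (Fin.natAdd a j))))))
            (Fin.cons (gcast (by simp)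
                (g₃ (fun j => d (Fin.castAdd e (Fin.natAdd (a + b) j)))
                    (fun j => x (Fin.castAdd e (Fin.natAdd (a + b) j)))))
              (fun _ : Fin 1 => gcast (by simp)
                (g₄ (fun j => d (Fin.natAdd (a + b + c) j))
                    (fun j => x (Fin.natAdd (a + b + c) j))))))))

/-- The differential `∂(μ) = D' ∘ μ - (-1)^{|μ|} ∑ᵢ μ ∘ᵢ D`. -/
def bdry [∀ i, AddCommGroup (L i)] [∀ i, AddCommGroup (M i)] {m : ℕ} {r : ℤ}
    (D' : MMap M M 1 (-1)) (D : MMap L L 1 (-1)) (μ : MMap L M m r) : MMap L M m (-1 + r) :=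
  comp₁ D' μ - ((-1 : ℤ) ^ r.natAbs) •
    ∑ p : Fin m, mcast (by have := p.isLt; omega) (by ring)
      (pcomp p.val (m - 1 - p.val) (mcast (by have := p.isLt; omega) rfl μ) D)

/-- The identity, as an `MMap`. -/
def idm : MMap L L 1 0 := fun d x => gcast (by rw [Fin.sum_univ_one, zero_add]) (x 0)

/-- `μ ∘_{m₁+1} ν`, recast to a specified target degree `R`. -/
def pc [∀ i, AddCommGroup (L i)] [∀ i, AddCommGroup (M i)] (R : ℤ) (m₁ m₂ : ℕ) {n : ℕ}
    {r s : ℤ} (μ : MMap L M (m₁ + 1 + m₂) r) (ν : MMap L L n s)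
    (h : r + s = R := by norm_num) : MMap L M (m₁ + n + m₂) R :=
  mcast rfl h (pcomp m₁ m₂ μ ν)

/-- `μ ∘ g`, recast to a specified target degree `R`. -/
def fc1 (R : ℤ) {a : ℕ} {r s : ℤ} (μ : MMap M N 1 r) (g : MMap L M a s)
    (h : r + s = R := by norm_num) : MMap L N a R :=
  mcast rfl h (comp₁ μ g)

/-- `μ ∘ (g₁, g₂)`, recast to a specified target degree `R`. -/
def fc2 [∀ i, AddCommGroup (N i)] (R : ℤ) {a b : ℕ} {r s₁ s₂ : ℤ}
    (μ : MMap M N 2 r) (g₁ : MMap L M a s₁) (g₂ : MMap L M b s₂)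
    (h : r + (s₁ + s₂) = R := by norm_num) : MMap L N (a + b) R :=
  mcast rfl h (comp₂ μ g₁ g₂)

/-- `μ ∘ (g₁, g₂, g₃)`, recast to a specified target degree `R`. -/
def fc3 [∀ i, AddCommGroup (N i)] (R : ℤ) {a b c : ℕ} {r s₁ s₂ s₃ : ℤ}
    (μ : MMap M N 3 r) (g₁ : MMap L M a s₁) (g₂ : MMap L M b s₂) (g₃ : MMap L M c s₃)
    (h : r + (s₁ + s₂ + s₃) = R := by norm_num) : MMap L N (a + b + c) R :=
  mcast rfl h (comp₃ μ g₁ g₂ g₃)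

/-- `μ ∘ (g₁, g₂, g₃, g₄)`, recast to a specified target degree `R`. -/
def fc4 [∀ i, AddCommGroup (N i)] (R : ℤ) {a b c e : ℕ} {r s₁ s₂ s₃ s₄ : ℤ}
    (μ : MMap M N 4 r) (g₁ : MMap L M a s₁) (g₂ : MMap L M b s₂) (g₃ : MMap L M c s₃)
    (g₄ : MMap L M e s₄) (h : r + (s₁ + s₂ + s₃ + s₄) = R := by norm_num) :
    MMap L N (a + b + c + e) R :=
  mcast rfl h (comp₄ μ g₁ g₂ g₃ g₄)

/-- `∂(μ)`, recast to a specified target degree `R`. -/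
def bd [∀ i, AddCommGroup (L i)] [∀ i, AddCommGroup (M i)] (R : ℤ) {m : ℕ} {r : ℤ}
    (D' : MMap M M 1 (-1)) (D : MMap L L 1 (-1)) (μ : MMap L M m r)
    (h : -1 + r = R := by norm_num) : MMap L M m R :=
  mcast rfl h (bdry D' D μ)

/-- Multilinearity over `k` of the components of an `MMap`. -/
def IsMultilinear (k : Type) [CommRing k] {L M : ℤ → Type} [∀ i, AddCommGroup (L i)]
    [∀ i, AddCommGroup (M i)] [∀ i, Module k (L i)] [∀ i, Module k (M i)] {m : ℕ} {r : ℤ}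
    (μ : MMap L M m r) : Prop :=
  ∀ (d : Fin m → ℤ) (x : ∀ j, L (d j)) (j : Fin m),
    (∀ a b : L (d j), μ d (Function.update x j (a + b))
        = μ d (Function.update x j a) + μ d (Function.update x j b)) ∧
    (∀ (c : k) (a : L (d j)), μ d (Function.update x j (c • a)) = c • μ d (Function.update x j a))

/-! ## Permutations (0-indexed; a cycle `(a b c)` is `swap a b * swap b c`) -/

def P12 (m : ℕ) [NeZero m] : Equiv.Perm (Fin m) := Equiv.swap 0 1
def P13 (m : ℕ) [NeZero m] : Equiv.Perm (Fin m) := Equiv.swap 0 2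
def P23 (m : ℕ) [NeZero m] : Equiv.Perm (Fin m) := Equiv.swap 1 2
def P34 (m : ℕ) [NeZero m] : Equiv.Perm (Fin m) := Equiv.swap 2 3
def P123 (m : ℕ) [NeZero m] : Equiv.Perm (Fin m) := Equiv.swap 0 1 * Equiv.swap 1 2
def P132 (m : ℕ) [NeZero m] : Equiv.Perm (Fin m) := Equiv.swap 0 2 * Equiv.swap 2 1
def P234 (m : ℕ) [NeZero m] : Equiv.Perm (Fin m) := Equiv.swap 1 2 * Equiv.swap 2 3
def P243 (m : ℕ) [NeZero m] : Equiv.Perm (Fin m) := Equiv.swap 1 3 * Equiv.swap 3 2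
def P1234 (m : ℕ) [NeZero m] : Equiv.Perm (Fin m) :=
  Equiv.swap 0 1 * Equiv.swap 1 2 * Equiv.swap 2 3
def P1432 (m : ℕ) [NeZero m] : Equiv.Perm (Fin m) :=
  Equiv.swap 0 3 * Equiv.swap 3 2 * Equiv.swap 2 1
def P1342 (m : ℕ) [NeZero m] : Equiv.Perm (Fin m) :=
  Equiv.swap 0 2 * Equiv.swap 2 3 * Equiv.swap 3 1
def P13P24 (m : ℕ) [NeZero m] : Equiv.Perm (Fin m) := Equiv.swap 0 2 * Equiv.swap 1 3

end WL3
namespace WL3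

open Finset

variable (k : Type) [CommRing k]

/-- A Leibniz 3-algebra structure: maps `l2, l3, l4` on a complex with differential `D`
satisfying the generalized Jacobi identities (L1)–(L4). -/
structure IsLeibniz3 {L : ℤ → Type} [∀ i, AddCommGroup (L i)] [∀ i, Module k (L i)]
    (D : MMap L L 1 (-1)) (l2 : MMap L L 2 0) (l3 : MMap L L 3 1) (l4 : MMap L L 4 2) :
    Prop where
  lin2 : IsMultilinear k l2
  lin3 : IsMultilinear k l3
  lin4 : IsMultilinear k l4
  eqL1 : bd (-1) D D l2 = 0
  eqL2 : bd 0 D D l3 =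
    pc 0 1 0 l2 l2 - pc 0 0 1 l2 l2 - pa (P12 3) (pc 0 1 0 l2 l2)
  eqL3 : bd 1 D D l4 =
    pc 1 0 1 l2 l3 + pc 1 1 0 l2 l3 - pa (P12 4) (pc 1 1 0 l2 l3)
      + pa (P123 4) (pc 1 1 0 l2 l3) - pc 1 0 2 l3 l2
      + pc 1 1 1 l3 l2 - pa (P12 4) (pc 1 1 1 l3 l2)
      - pc 1 2 0 l3 l2 + pa (P23 4) (pc 1 2 0 l3 l2) - pa (P132 4) (pc 1 2 0 l3 l2)
  eqL4 : (0 : MMap L L 5 2) =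
    pc 2 0 1 l2 l4 - pc 2 1 0 l2 l4 + pa (P12 5) (pc 2 1 0 l2 l4)
      - pa (P123 5) (pc 2 1 0 l2 l4) + pa (P1234 5) (pc 2 1 0 l2 l4)
      + pc 2 0 2 l3 l3 + pc 2 1 1 l3 l3 - pa (P12 5) (pc 2 1 1 l3 l3)
      + pa (P123 5) (pc 2 1 1 l3 l3) + pc 2 2 0 l3 l3
      - pa (P23 5) (pc 2 2 0 l3 l3) + pa (P132 5) (pc 2 2 0 l3 l3)
      + pa (P234 5) (pc 2 2 0 l3 l3) - pa (P1342 5) (pc 2 2 0 l3 l3)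
      + pa (P13P24 5) (pc 2 2 0 l3 l3)
      + pc 2 0 3 l4 l2 - pc 2 1 2 l4 l2 + pa (P12 5) (pc 2 1 2 l4 l2)
      + pc 2 2 1 l4 l2 - pa (P23 5) (pc 2 2 1 l4 l2) + pa (P132 5) (pc 2 2 1 l4 l2)
      - pc 2 3 0 l4 l2 + pa (P34 5) (pc 2 3 0 l4 l2) - pa (P243 5) (pc 2 3 0 l4 l2)
      + pa (P1432 5) (pc 2 3 0 l4 l2)

/-- A weak Lie 3-algebra: a 3-term chain complex equipped with structure maps
`l2, l3, l4, l21, l211, l31, l32` satisfying (L1)–(L4) and (W1)–(W11). -/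
structure WeakLie3 (L : ℤ → Type) [∀ i, AddCommGroup (L i)] [∀ i, Module k (L i)] where
  D : MMap L L 1 (-1)
  linD : IsMultilinear k D
  dd : fc1 (-2) D D = 0
  bound : ∀ i : ℤ, (i < 0 ∨ 2 < i) → ∀ x : L i, x = 0
  l2 : MMap L L 2 0
  l3 : MMap L L 3 1
  l4 : MMap L L 4 2
  l21 : MMap L L 2 1
  l211 : MMap L L 2 2
  l31 : MMap L L 3 2
  l32 : MMap L L 3 2
  leib : IsLeibniz3 k D l2 l3 l4
  lin21 : IsMultilinear k l21
  lin211 : IsMultilinear k l211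
  lin31 : IsMultilinear k l31
  lin32 : IsMultilinear k l32
  w1 : bd 0 D D l21 = l2 + pa (P12 2) l2
  w2 : bd 1 D D l211 = l21 - pa (P12 2) l21
  w3 : bd 1 D D l31 = l3 + pa (P12 3) l3 + pc 1 0 1 l2 l21
  w4 : bd 1 D D l32 = l3 + pa (P23 3) l3 - pc 1 1 0 l2 l21 + pc 1 0 1 l21 l2
        + pa (P12 3) (pc 1 1 0 l21 l2)
  w5 : l211 + pa (P12 2) l211 = 0
  w6 : l31 - pa (P12 3) l31 = pc 2 0 1 l2 l211
  w7 : l31 - pa (P12 3) l32 + pa (P132 3) l31 - l32 + pa (P23 3) l31 - pa (P123 3) l32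
        = pc 2 1 0 l21 l21 + pc 2 0 1 l21 l21 + pa (P12 3) (pc 2 1 0 l21 l21)
          + pa (P132 3) (pc 2 1 0 l211 l2)
  w8 : l32 - pa (P23 3) l32 = - pc 2 1 0 l2 l211 + pc 2 0 1 l211 l2
        + pa (P12 3) (pc 2 1 0 l211 l2)
  w9 : l4 + pa (P12 4) l4 = pc 2 0 1 l2 l31 - pc 2 2 0 l31 l2
        + pa (P123 4) (pc 2 1 0 l2 l31) + pc 2 0 2 l3 l21
  w10 : l4 + pa (P23 4) l4 = pc 2 0 1 l2 l32 - pc 2 1 1 l3 l21 + pc 2 1 0 l2 l31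
        - pc 2 0 2 l31 l2 - pa (P12 4) (pc 2 1 1 l31 l2) - pa (P132 4) (pc 2 2 0 l31 l2)
  w11 : l4 + pa (P34 4) l4 = pc 2 0 1 l21 l3 - pc 2 0 2 l32 l2 + pc 2 1 1 l32 l2
        - pa (P12 4) (pc 2 1 1 l32 l2) + pc 2 2 0 l3 l21 + pa (P23 4) (pc 2 2 0 l32 l2)
        - pa (P132 4) (pc 2 2 0 l32 l2) + pc 2 1 0 l2 l32 - pa (P12 4) (pc 2 1 0 l2 l32)
        + pa (P123 4) (pc 2 1 0 l21 l3)

end WL3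
namespace WL3

open Finset

variable (k : Type) [CommRing k]

/-- A weak morphism of weak Lie 3-algebras `(f1,f2,f21,f3) : A → B`, i.e. a solution of
equations (M1)–(M8). -/
structure IsWeakMorphism {L M : ℤ → Type} [∀ i, AddCommGroup (L i)] [∀ i, Module k (L i)]
    [∀ i, AddCommGroup (M i)] [∀ i, Module k (M i)]
    (A : WeakLie3 k L) (B : WeakLie3 k M)
    (f1 : MMap L M 1 0) (f2 : MMap L M 2 1) (f21 : MMap L M 2 2) (f3 : MMap L M 3 2) :
    Prop where
  lin1 : IsMultilinear k f1
  lin2 : IsMultilinear k f2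
  lin21 : IsMultilinear k f21
  lin3 : IsMultilinear k f3
  m1 : bd (-1) B.D A.D f1 = 0
  m2 : bd 0 B.D A.D f2 = fc1 0 f1 A.l2 - fc2 0 B.l2 f1 f1
  m3 : bd 1 B.D A.D f3 = fc1 1 f1 A.l3 - pc 1 1 0 f2 A.l2 + pc 1 0 1 f2 A.l2
        + pa (P12 3) (pc 1 1 0 f2 A.l2) - fc3 1 B.l3 f1 f1 f1 - fc2 1 B.l2 f1 f2
        + fc2 1 B.l2 f2 f1 + pa (P12 3) (fc2 1 B.l2 f1 f2)
  m4 : fc1 2 f1 A.l4 - fc4 2 B.l4 f1 f1 f1 f1 =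
        pc 2 0 1 f2 A.l3 + pc 2 1 0 f2 A.l3 - pa (P12 4) (pc 2 1 0 f2 A.l3)
        + pa (P123 4) (pc 2 1 0 f2 A.l3) - pc 2 0 2 f3 A.l2 + pc 2 1 1 f3 A.l2
        - pa (P12 4) (pc 2 1 1 f3 A.l2) - pc 2 2 0 f3 A.l2 + pa (P23 4) (pc 2 2 0 f3 A.l2)
        - pa (P132 4) (pc 2 2 0 f3 A.l2) + fc2 2 B.l2 f3 f1 + fc2 2 B.l2 f1 f3
        - pa (P12 4) (fc2 2 B.l2 f1 f3) + pa (P123 4) (fc2 2 B.l2 f1 f3)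
        - fc2 2 B.l2 f2 f2 + pa (P23 4) (fc2 2 B.l2 f2 f2) - pa (P132 4) (fc2 2 B.l2 f2 f2)
        + fc3 2 B.l3 f2 f1 f1 - fc3 2 B.l3 f1 f2 f1 + pa (P12 4) (fc3 2 B.l3 f1 f2 f1)
        + fc3 2 B.l3 f1 f1 f2 - pa (P23 4) (fc3 2 B.l3 f1 f1 f2)
        + pa (P132 4) (fc3 2 B.l3 f1 f1 f2)
  m5 : bd 1 B.D A.D f21 = - f2 - pa (P12 2) f2 + fc1 1 f1 A.l21 - fc2 1 B.l21 f1 f1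
  m6 : fc1 2 f1 A.l211 - fc2 2 B.l211 f1 f1 = f21 - pa (P12 2) f21
  m7 : fc1 2 f1 A.l31 - fc3 2 B.l31 f1 f1 f1 =
        f3 + pa (P12 3) f3 + pc 2 0 1 f2 A.l21 + fc2 2 B.l2 f21 f1
  m8 : fc1 2 f1 A.l32 - fc3 2 B.l32 f1 f1 f1 =
        f3 + pa (P23 3) f3 - pc 2 1 0 f2 A.l21 + pc 2 0 1 f21 A.l2
        + pa (P12 3) (pc 2 1 0 f21 A.l2) - fc2 2 B.l2 f1 f21 - fc2 2 B.l21 f2 f1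
        - pa (P12 3) (fc2 2 B.l21 f1 f2)

/-- A morphism of (semi-strict) Lie 3-algebras / Leibniz 3-algebras: equations (M1)–(M4)
for structure maps `(a2,a3,a4)` on the source and `(b2,b3,b4)` on the target. -/
structure IsLeibMorphism {L M : ℤ → Type} [∀ i, AddCommGroup (L i)] [∀ i, Module k (L i)]
    [∀ i, AddCommGroup (M i)] [∀ i, Module k (M i)]
    (DL : MMap L L 1 (-1)) (DM : MMap M M 1 (-1))
    (a2 : MMap L L 2 0) (a3 : MMap L L 3 1) (a4 : MMap L L 4 2)
    (b2 : MMap M M 2 0) (b3 : MMap M M 3 1) (b4 : MMap M M 4 2)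
    (f1 : MMap L M 1 0) (f2 : MMap L M 2 1) (f3 : MMap L M 3 2) : Prop where
  lin1 : IsMultilinear k f1
  lin2 : IsMultilinear k f2
  lin3 : IsMultilinear k f3
  m1 : bd (-1) DM DL f1 = 0
  m2 : bd 0 DM DL f2 = fc1 0 f1 a2 - fc2 0 b2 f1 f1
  m3 : bd 1 DM DL f3 = fc1 1 f1 a3 - pc 1 1 0 f2 a2 + pc 1 0 1 f2 a2
        + pa (P12 3) (pc 1 1 0 f2 a2) - fc3 1 b3 f1 f1 f1 - fc2 1 b2 f1 f2
        + fc2 1 b2 f2 f1 + pa (P12 3) (fc2 1 b2 f1 f2)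
  m4 : fc1 2 f1 a4 - fc4 2 b4 f1 f1 f1 f1 =
        pc 2 0 1 f2 a3 + pc 2 1 0 f2 a3 - pa (P12 4) (pc 2 1 0 f2 a3)
        + pa (P123 4) (pc 2 1 0 f2 a3) - pc 2 0 2 f3 a2 + pc 2 1 1 f3 a2
        - pa (P12 4) (pc 2 1 1 f3 a2) - pc 2 2 0 f3 a2 + pa (P23 4) (pc 2 2 0 f3 a2)
        - pa (P132 4) (pc 2 2 0 f3 a2) + fc2 2 b2 f3 f1 + fc2 2 b2 f1 f3
        - pa (P12 4) (fc2 2 b2 f1 f3) + pa (P123 4) (fc2 2 b2 f1 f3)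
        - fc2 2 b2 f2 f2 + pa (P23 4) (fc2 2 b2 f2 f2) - pa (P132 4) (fc2 2 b2 f2 f2)
        + fc3 2 b3 f2 f1 f1 - fc3 2 b3 f1 f2 f1 + pa (P12 4) (fc3 2 b3 f1 f2 f1)
        + fc3 2 b3 f1 f1 f2 - pa (P23 4) (fc3 2 b3 f1 f1 f2)
        + pa (P132 4) (fc3 2 b3 f1 f1 f2)

/-- A deformation retract `(p, i, h)` of `(L, D)` onto `(L', D')`:
`p`, `i` are chain maps, `id - i∘p = D∘h + h∘D` and `p∘i = id`. -/
structure IsDefRetract {L L' : ℤ → Type} [∀ i, AddCommGroup (L i)] [∀ i, Module k (L i)]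
    [∀ i, AddCommGroup (L' i)] [∀ i, Module k (L' i)]
    (D : MMap L L 1 (-1)) (D' : MMap L' L' 1 (-1))
    (p : MMap L L' 1 0) (i : MMap L' L 1 0) (h : MMap L L 1 1) : Prop where
  linp : IsMultilinear k p
  lini : IsMultilinear k i
  linh : IsMultilinear k h
  chainp : bd (-1) D' D p = 0
  chaini : bd (-1) D D' i = 0
  homotopy : idm - fc1 0 i p = fc1 0 D h + fc1 0 h D
  retract : fc1 0 p i = idm

/-- A weak Lie 2-algebra in the sense of Roytenberg (a 2-term truncation of a weak
Lie 3-algebra). -/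
structure WeakLie2 (L : ℤ → Type) [∀ i, AddCommGroup (L i)] [∀ i, Module k (L i)] where
  D : MMap L L 1 (-1)
  linD : IsMultilinear k D
  dd : fc1 (-2) D D = 0
  bound : ∀ i : ℤ, (i < 0 ∨ 1 < i) → ∀ x : L i, x = 0
  l2 : MMap L L 2 0
  l3 : MMap L L 3 1
  l21 : MMap L L 2 1
  lin2 : IsMultilinear k l2
  lin3 : IsMultilinear k l3
  lin21 : IsMultilinear k l21
  e1 : bd (-1) D D l2 = 0
  e2 : bd 0 D D l3 = pc 0 1 0 l2 l2 - pc 0 0 1 l2 l2 - pa (P12 3) (pc 0 1 0 l2 l2)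
  e3 : (0 : MMap L L 4 1) =
    pc 1 0 1 l2 l3 + pc 1 1 0 l2 l3 - pa (P12 4) (pc 1 1 0 l2 l3)
      + pa (P123 4) (pc 1 1 0 l2 l3) - pc 1 0 2 l3 l2
      + pc 1 1 1 l3 l2 - pa (P12 4) (pc 1 1 1 l3 l2)
      - pc 1 2 0 l3 l2 + pa (P23 4) (pc 1 2 0 l3 l2) - pa (P132 4) (pc 1 2 0 l3 l2)
  e4 : bd 0 D D l21 = l2 + pa (P12 2) l2
  e5 : (0 : MMap L L 2 1) = l21 - pa (P12 2) l21
  e6 : (0 : MMap L L 3 1) = l3 + pa (P12 3) l3 + pc 1 0 1 l2 l21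
  e7 : (0 : MMap L L 3 1) = l3 + pa (P23 3) l3 - pc 1 1 0 l2 l21 + pc 1 0 1 l21 l2
        + pa (P12 3) (pc 1 1 0 l21 l2)

end WL3
namespace WL3

open Finset

section Transfer

variable {k : Type} [CommRing k] {L L' : ℤ → Type}
  [∀ i, AddCommGroup (L i)] [∀ i, Module k (L i)]
  [∀ i, AddCommGroup (L' i)] [∀ i, Module k (L' i)]
variable (A : WeakLie3 k L) (p : MMap L L' 1 0) (i : MMap L' L 1 0) (h : MMap L L 1 1)

/-- `h ∘ λ2` -/
def hl2 : MMap L L 2 1 := fc1 1 h A.l2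
/-- `h ∘ λ3` -/
def hl3 : MMap L L 3 2 := fc1 2 h A.l3
/-- `h ∘ λ21` -/
def hl21 : MMap L L 2 2 := fc1 2 h A.l21

/-- Transferred `λ2' = p ∘ λ2 ∘ (i,i)`. -/
def tl2 : MMap L' L' 2 0 := fc1 0 p (fc2 0 A.l2 i i)

/-- Transferred `λ3'`. -/
def tl3 : MMap L' L' 3 1 :=
  fc1 1 p (fc3 1 A.l3 i i i)
  + fc1 1 p (fc3 1 (pc 1 0 1 A.l2 (hl2 A h)
      - (pc 1 1 0 A.l2 (hl2 A h) - pa (P12 3) (pc 1 1 0 A.l2 (hl2 A h)))) i i i)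

/-- Transferred `λ4'`. -/
def tl4 : MMap L' L' 4 2 :=
  fc1 2 p (fc4 2 A.l4 i i i i)
  - fc1 2 p (fc4 2
      (pc 2 0 1 A.l2 (hl3 A h)
        + (pc 2 1 0 A.l2 (hl3 A h) - pa (P12 4) (pc 2 1 0 A.l2 (hl3 A h))
            + pa (P123 4) (pc 2 1 0 A.l2 (hl3 A h)))
        + pc 2 0 2 A.l3 (hl2 A h)
        - (pc 2 1 1 A.l3 (hl2 A h) - pa (P12 4) (pc 2 1 1 A.l3 (hl2 A h)))
        + (pc 2 2 0 A.l3 (hl2 A h) - pa (P23 4) (pc 2 2 0 A.l3 (hl2 A h))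
            + pa (P132 4) (pc 2 2 0 A.l3 (hl2 A h)))) i i i i)
  - fc1 2 p (fc4 2
      (pc 2 0 2 (pc 1 0 1 A.l2 (hl2 A h)) (hl2 A h)
        - (pc 2 1 1 (pc 1 0 1 A.l2 (hl2 A h)) (hl2 A h)
            - pa (P12 4) (pc 2 1 1 (pc 1 0 1 A.l2 (hl2 A h)) (hl2 A h)))
        + (fc2 2 A.l2 (hl2 A h) (hl2 A h) - pa (P23 4) (fc2 2 A.l2 (hl2 A h) (hl2 A h))
            + pa (P132 4) (fc2 2 A.l2 (hl2 A h) (hl2 A h)))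
        + (pc 2 1 1 (pc 1 1 0 A.l2 (hl2 A h)) (hl2 A h)
            - pa (P12 4) (pc 2 1 1 (pc 1 1 0 A.l2 (hl2 A h)) (hl2 A h))
            + pa (P123 4) (pc 2 1 1 (pc 1 1 0 A.l2 (hl2 A h)) (hl2 A h)))
        - (pc 2 2 0 (pc 1 1 0 A.l2 (hl2 A h)) (hl2 A h)
            - pa (P12 4) (pc 2 2 0 (pc 1 1 0 A.l2 (hl2 A h)) (hl2 A h))
            + pa (P123 4) (pc 2 2 0 (pc 1 1 0 A.l2 (hl2 A h)) (hl2 A h))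
            - pa (P23 4) (pc 2 2 0 (pc 1 1 0 A.l2 (hl2 A h)) (hl2 A h))
            + pa (P132 4) (pc 2 2 0 (pc 1 1 0 A.l2 (hl2 A h)) (hl2 A h))
            - pa (P13 4) (pc 2 2 0 (pc 1 1 0 A.l2 (hl2 A h)) (hl2 A h)))) i i i i)

/-- Transferred `λ21' = p ∘ λ21 ∘ (i,i)`. -/
def tl21 : MMap L' L' 2 1 := fc1 1 p (fc2 1 A.l21 i i)

/-- Transferred `λ211' = p ∘ λ211 ∘ (i,i)`. -/
def tl211 : MMap L' L' 2 2 := fc1 2 p (fc2 2 A.l211 i i)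

/-- Transferred `λ31'`. -/
def tl31 : MMap L' L' 3 2 :=
  fc1 2 p (fc3 2 A.l31 i i i) - fc1 2 p (fc3 2 (pc 2 0 1 A.l2 (hl21 A h)) i i i)

/-- Transferred `λ32'`. -/
def tl32 : MMap L' L' 3 2 :=
  fc1 2 p (fc3 2 A.l32 i i i)
  + fc1 2 p (fc3 2 (pc 2 0 1 A.l21 (hl2 A h) + pc 2 1 0 A.l2 (hl21 A h)
      + pa (P12 3) (pc 2 1 0 A.l21 (hl2 A h))) i i i)

/-- Extension of `i`: `i₂ = -h ∘ λ2 ∘ (i,i)`. -/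
def ti2 : MMap L' L 2 1 := - fc1 1 h (fc2 0 A.l2 i i)

/-- Extension of `i`: `i₂₁ = -h ∘ λ21 ∘ (i,i)`. -/
def ti21 : MMap L' L 2 2 := - fc1 2 h (fc2 1 A.l21 i i)

/-- Extension of `i`: `i₃`. -/
def ti3 : MMap L' L 3 2 :=
  - fc1 2 h (fc3 1 A.l3 i i i)
  - fc1 2 h (fc3 1 (pc 1 0 1 A.l2 (hl2 A h)
      - (pc 1 1 0 A.l2 (hl2 A h) - pa (P12 3) (pc 1 1 0 A.l2 (hl2 A h)))) i i i)

end Transfer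

section Skew

variable (k : Type) [CommRing k] [Invertible (2 : k)] [Invertible (3 : k)]
variable {L M : ℤ → Type} [∀ i, AddCommGroup (L i)] [∀ i, Module k (L i)]
  [∀ i, AddCommGroup (M i)] [∀ i, Module k (M i)]

/-- Skew-symmetrization `λ̄2` of a weak Lie 3-algebra. -/
def skew2 (A : WeakLie3 k L) : MMap L L 2 0 :=
  (⅟ (2 : k)) • ∑ σ : Equiv.Perm (Fin 2), (Equiv.Perm.sign σ : ℤ) • pa σ A.l2

/-- Skew-symmetrization `λ̄3` of a weak Lie 3-algebra. -/
def skew3 (A : WeakLie3 k L) : MMap L L 3 1 :=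
  (⅟ (2 : k) * ⅟ (3 : k)) • ∑ σ : Equiv.Perm (Fin 3), (Equiv.Perm.sign σ : ℤ) • pa σ A.l3
  - (⅟ (2 : k) * ⅟ (2 : k) * ⅟ (2 : k) * ⅟ (3 : k)) •
      ∑ σ : Equiv.Perm (Fin 3), (Equiv.Perm.sign σ : ℤ) •
        pa σ (pc 1 0 1 A.l21 A.l2 + pc 1 1 0 A.l21 A.l2)

/-- Skew-symmetrization `λ̄4` of a weak Lie 3-algebra. -/
def skew4 (A : WeakLie3 k L) : MMap L L 4 2 :=
  (⅟ (2 : k) * ⅟ (2 : k) * ⅟ (2 : k) * ⅟ (3 : k)) •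
      ∑ σ : Equiv.Perm (Fin 4), (Equiv.Perm.sign σ : ℤ) • pa σ A.l4
  + (⅟ (2 : k) * ⅟ (2 : k) * ⅟ (2 : k) * ⅟ (2 : k) * ⅟ (3 : k)) •
      ∑ σ : Equiv.Perm (Fin 4), (Equiv.Perm.sign σ : ℤ) •
        pa σ (pc 2 0 1 A.l21 A.l3 - pc 2 0 2 A.l31 A.l2 + pc 2 1 1 A.l32 A.l2
          - pc 2 1 0 A.l21 A.l3 - pc 2 1 1 A.l31 A.l2 + pc 2 2 0 A.l32 A.l2)

/-- Skew-symmetrization `f̄2` of the second component of a weak morphism. -/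
def skewMor2 (f2 : MMap L M 2 1) : MMap L M 2 1 :=
  (⅟ (2 : k)) • ∑ σ : Equiv.Perm (Fin 2), (Equiv.Perm.sign σ : ℤ) • pa σ f2

/-- Skew-symmetrization `f̄3` of the third component of a weak morphism `A → B`. -/
def skewMor3 (A : WeakLie3 k L) (B : WeakLie3 k M) (f1 : MMap L M 1 0) (f2 : MMap L M 2 1)
    (f21 : MMap L M 2 2) (f3 : MMap L M 3 2) : MMap L M 3 2 :=
  (⅟ (2 : k) * ⅟ (3 : k)) • ∑ σ : Equiv.Perm (Fin 3), (Equiv.Perm.sign σ : ℤ) • pa σ f3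
  - (⅟ (2 : k) * ⅟ (2 : k) * ⅟ (2 : k) * ⅟ (3 : k)) •
      ∑ σ : Equiv.Perm (Fin 3), (Equiv.Perm.sign σ : ℤ) •
        pa σ (pc 2 0 1 f21 A.l2 + pc 2 1 0 f21 A.l2
          - fc2 2 B.l21 f2 f1 - fc2 2 B.l21 f1 f2)

end Skew

section Comp

variable {k : Type} [CommRing k] {L M N : ℤ → Type}
  [∀ i, AddCommGroup (L i)] [∀ i, Module k (L i)]
  [∀ i, AddCommGroup (M i)] [∀ i, Module k (M i)]
  [∀ i, AddCommGroup (N i)] [∀ i, Module k (N i)]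

/-- First component of the composition of weak morphisms. -/
def cmp1 (f1' : MMap M N 1 0) (f1 : MMap L M 1 0) : MMap L N 1 0 := fc1 0 f1' f1

/-- Second component of the composition of weak morphisms. -/
def cmp2 (f1' : MMap M N 1 0) (f2' : MMap M N 2 1) (f1 : MMap L M 1 0) (f2 : MMap L M 2 1) :
    MMap L N 2 1 := fc2 1 f2' f1 f1 + fc1 1 f1' f2

/-- `(f'∘f)21` component of the composition of weak morphisms. -/
def cmp21 (f1' : MMap M N 1 0) (f21' : MMap M N 2 2) (f1 : MMap L M 1 0)
    (f21 : MMap L M 2 2) : MMap L N 2 2 := fc2 2 f21' f1 f1 + fc1 2 f1' f21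

/-- Third component of the composition of weak morphisms. -/
def cmp3 (f1' : MMap M N 1 0) (f2' : MMap M N 2 1) (f3' : MMap M N 3 2)
    (f1 : MMap L M 1 0) (f2 : MMap L M 2 1) (f3 : MMap L M 3 2) : MMap L N 3 2 :=
  fc3 2 f3' f1 f1 f1 - fc2 2 f2' f2 f1 + fc2 2 f2' f1 f2 - pa (P12 3) (fc2 2 f2' f1 f2)
    + fc1 2 f1' f3

end Comp

end WL3
namespace WL3

section Evaluation

/-- The inclusion of the degree-`i` part of a graded group into the product of all parts. -/
def incl {L : ℤ → Type} [∀ i, AddCommGroup (L i)] (i : ℤ) : L i →+ ∀ i, L i :=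
  AddMonoidHom.single L i

/-- The component of `μ` in degrees `d`, regarded as a map on the product of all degrees. -/
def ev {L M : ℤ → Type} [∀ i, AddCommGroup (M i)] {m : ℕ} {r : ℤ} (μ : MMap L M m r)
    (d : Fin m → ℤ) (X : Fin m → ∀ i, L i) : ∀ i, M i :=
  incl (r + ∑ j, d j) (μ d fun j => X j (d j))

variable {L M N : ℤ → Type}

theorem gcast_apply {i j : ℤ} (h : i = j) (X : ∀ i, L i) : gcast h (X i) = X j := by
  subst h; rfl

variable [∀ i, AddCommGroup (M i)]

theorem incl_injective (i : ℤ) : Function.Injective (incl (L := M) i) :=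
  Pi.single_injective i

@[simp] theorem incl_apply_self (i : ℤ) (x : M i) : incl i x i = x := Pi.single_eq_same i x

theorem incl_apply_eq_gcast {i j : ℤ} (h : i = j) (x : M i) : incl i x j = gcast h x := by
  subst h; exact incl_apply_self i x

theorem incl_gcast {i j : ℤ} (h : i = j) (x : M i) : incl j (gcast h x) = incl i x := by
  subst h; rfl

theorem incl_gcast_map {m : ℕ} {r R : ℤ} (μ : MMap L M m r) (d : Fin m → ℤ)
    (h : r + ∑ j, d j = R) {x : ∀ j, L (d j)} {X : Fin m → ∀ i, L i}
    (hx : ∀ j, x j = X j (d j)) : incl R (gcast h (μ d x)) = ev μ d X := by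
  rw [incl_gcast, ev]
  congr 2
  exact funext hx

section Linear

variable {m : ℕ} {r : ℤ} (μ ν : MMap L M m r) (d : Fin m → ℤ) (X : Fin m → ∀ i, L i)

@[simp] theorem ev_add : ev (μ + ν) d X = ev μ d X + ev ν d X := map_add _ _ _
@[simp] theorem ev_sub : ev (μ - ν) d X = ev μ d X - ev ν d X := map_sub _ _ _
@[simp] theorem ev_neg : ev (-μ) d X = -ev μ d X := map_neg _ _
@[simp] theorem ev_zero : ev (0 : MMap L M m r) d X = 0 := map_zero _
@[simp] theorem ev_zsmul (c : ℤ) : ev (c • μ) d X = c • ev μ d X := map_zsmul _ _ _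

theorem ev_pa (σ : Equiv.Perm (Fin m)) : ev (pa σ μ) d X
    = koszulSign d σ • ev μ (fun j => d (σ.symm j)) (fun j => X (σ.symm j)) := by
  rw [ev, pa, map_zsmul]
  exact congrArg _ (incl_gcast_map μ _ _ fun _ => rfl)

end Linear

@[simp] theorem ev_mcast {m : ℕ} {r r' : ℤ} (hr : r = r') (μ : MMap L M m r) :
    ev (mcast rfl hr μ) = ev μ := by
  subst hr; rfl

variable [∀ i, AddCommGroup (N i)]

theorem ev_fc1 {R : ℤ} {a : ℕ} {r s : ℤ} (μ : MMap M N 1 r) (g : MMap L M a s)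
    (h : r + s = R) (d : Fin a → ℤ) (X : Fin a → ∀ i, L i) :
    ev (fc1 R μ g h) d X = ev μ ![s + ∑ j, d j] ![ev g d X] := by
  rw [fc1, ev_mcast, ev, comp₁]
  have hd : (fun _ : Fin 1 => s + ∑ j, d j) = ![s + ∑ j, d j] := by
    ext j; fin_cases j; rfl
  refine (incl_gcast_map (X := ![ev g d X]) μ _ _ fun j => ?_).trans (by rw [hd])
  fin_cases j
  exact (incl_apply_self _ _).symm

theorem ev_fc2 {R : ℤ} {a b : ℕ} {r s₁ s₂ : ℤ} (μ : MMap M N 2 r) (g₁ : MMap L M a s₁)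
    (g₂ : MMap L M b s₂) (h : r + (s₁ + s₂) = R) (d : Fin (a + b) → ℤ)
    (X : Fin (a + b) → ∀ i, L i) :
    ev (fc2 R μ g₁ g₂ h) d X = (-1 : ℤ) ^ (s₂ * ∑ j : Fin a, d (Fin.castAdd b j)).natAbs •
      ev μ ![s₁ + ∑ j : Fin a, d (Fin.castAdd b j), s₂ + ∑ j : Fin b, d (Fin.natAdd a j)]
        ![ev g₁ (fun j => d (Fin.castAdd b j)) (fun j => X (Fin.castAdd b j)),
          ev g₂ (fun j => d (Fin.natAdd a j)) (fun j => X (Fin.natAdd a j))] := by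
  rw [fc2, ev_mcast, ev, comp₂, map_zsmul]
  congr 1
  refine incl_gcast_map μ _ _ fun j => ?_
  fin_cases j <;> exact (incl_apply_self _ _).symm

theorem ev_fc3 {R : ℤ} {a b c : ℕ} {r s₁ s₂ s₃ : ℤ} (μ : MMap M N 3 r) (g₁ : MMap L M a s₁)
    (g₂ : MMap L M b s₂) (g₃ : MMap L M c s₃) (h : r + (s₁ + s₂ + s₃) = R)
    (d : Fin (a + b + c) → ℤ) (X : Fin (a + b + c) → ∀ i, L i) :
    ev (fc3 R μ g₁ g₂ g₃ h) d X =
      (-1 : ℤ) ^ (s₂ * (∑ j : Fin a, d (Fin.castAdd c (Fin.castAdd b j)))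
        + s₃ * ((∑ j : Fin a, d (Fin.castAdd c (Fin.castAdd b j)))
          + ∑ j : Fin b, d (Fin.castAdd c (Fin.natAdd a j)))).natAbs •
      ev μ ![s₁ + ∑ j : Fin a, d (Fin.castAdd c (Fin.castAdd b j)),
          s₂ + ∑ j : Fin b, d (Fin.castAdd c (Fin.natAdd a j)),
          s₃ + ∑ j : Fin c, d (Fin.natAdd (a + b) j)]
        ![ev g₁ (fun j => d (Fin.castAdd c (Fin.castAdd b j)))
            (fun j => X (Fin.castAdd c (Fin.castAdd b j))),
          ev g₂ (fun j => d (Fin.castAdd c (Fin.natAdd a j)))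
            (fun j => X (Fin.castAdd c (Fin.natAdd a j))),
          ev g₃ (fun j => d (Fin.natAdd (a + b) j)) (fun j => X (Fin.natAdd (a + b) j))] := by
  rw [fc3, ev_mcast, ev, comp₃, map_zsmul]
  congr 1
  refine incl_gcast_map μ _ _ fun j => ?_
  fin_cases j <;> exact (incl_apply_self _ _).symm

theorem ev_fc4 {R : ℤ} {a b c e : ℕ} {r s₁ s₂ s₃ s₄ : ℤ} (μ : MMap M N 4 r)
    (g₁ : MMap L M a s₁) (g₂ : MMap L M b s₂) (g₃ : MMap L M c s₃) (g₄ : MMap L M e s₄)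
    (h : r + (s₁ + s₂ + s₃ + s₄) = R)
    (d : Fin (a + b + c + e) → ℤ) (X : Fin (a + b + c + e) → ∀ i, L i) :
    ev (fc4 R μ g₁ g₂ g₃ g₄ h) d X =
      (-1 : ℤ) ^ (s₂ * (∑ j : Fin a, d (Fin.castAdd e (Fin.castAdd c (Fin.castAdd b j))))
        + s₃ * ((∑ j : Fin a, d (Fin.castAdd e (Fin.castAdd c (Fin.castAdd b j))))
          + ∑ j : Fin b, d (Fin.castAdd e (Fin.castAdd c (Fin.natAdd a j))))
        + s₄ * ((∑ j : Fin a, d (Fin.castAdd e (Fin.castAdd c (Fin.castAdd b j))))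
          + (∑ j : Fin b, d (Fin.castAdd e (Fin.castAdd c (Fin.natAdd a j))))
          + ∑ j : Fin c, d (Fin.castAdd e (Fin.natAdd (a + b) j)))).natAbs •
      ev μ ![s₁ + ∑ j : Fin a, d (Fin.castAdd e (Fin.castAdd c (Fin.castAdd b j))),
          s₂ + ∑ j : Fin b, d (Fin.castAdd e (Fin.castAdd c (Fin.natAdd a j))),
          s₃ + ∑ j : Fin c, d (Fin.castAdd e (Fin.natAdd (a + b) j)),
          s₄ + ∑ j : Fin e, d (Fin.natAdd (a + b + c) j)]
        ![ev g₁ (fun j => d (Fin.castAdd e (Fin.castAdd c (Fin.castAdd b j))))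
            (fun j => X (Fin.castAdd e (Fin.castAdd c (Fin.castAdd b j)))),
          ev g₂ (fun j => d (Fin.castAdd e (Fin.castAdd c (Fin.natAdd a j))))
            (fun j => X (Fin.castAdd e (Fin.castAdd c (Fin.natAdd a j)))),
          ev g₃ (fun j => d (Fin.castAdd e (Fin.natAdd (a + b) j)))
            (fun j => X (Fin.castAdd e (Fin.natAdd (a + b) j))),
          ev g₄ (fun j => d (Fin.natAdd (a + b + c) j))
            (fun j => X (Fin.natAdd (a + b + c) j))] := by
  rw [fc4, ev_mcast, ev, comp₄, map_zsmul]
  congr 1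
  refine incl_gcast_map μ _ _ fun j => ?_
  fin_cases j <;> exact (incl_apply_self _ _).symm

variable [∀ i, AddCommGroup (L i)]

theorem ev_pcomp (m₁ m₂ : ℕ) {n : ℕ} {r s : ℤ} (μ : MMap L M (m₁ + 1 + m₂) r)
    (ν : MMap L L n s) (d : Fin (m₁ + n + m₂) → ℤ) (X : Fin (m₁ + n + m₂) → ∀ i, L i) :
    ev (pcomp m₁ m₂ μ ν) d X
      = (-1 : ℤ) ^ (s * ∑ j : Fin m₁, d (Fin.castAdd m₂ (Fin.castAdd n j))).natAbs •
        ev μ (outDeg m₁ m₂ n s d)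
          (Fin.append (Fin.append (fun j => X (Fin.castAdd m₂ (Fin.castAdd n j)))
            (fun _ => ev ν (fun j => d (Fin.castAdd m₂ (Fin.natAdd m₁ j)))
              (fun j => X (Fin.castAdd m₂ (Fin.natAdd m₁ j)))))
            (fun j => X (Fin.natAdd (m₁ + n) j))) := by
  rw [ev, pcomp, map_zsmul]
  congr 1
  refine incl_gcast_map μ _ _ fun j => ?_
  induction j using Fin.addCases with
  | left j =>
    induction j using Fin.addCases with
    | left j => simp only [Fin.addCases_left, Fin.append_left]; exact gcast_apply _ _
    | right j =>
      simp only [Fin.addCases_left, Fin.addCases_right, Fin.append_left, Fin.append_right]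
      exact (incl_apply_eq_gcast _ _).symm
  | right j => simp only [Fin.addCases_right, Fin.append_right]; exact gcast_apply _ _

theorem ev_idm (d : Fin 1 → ℤ) (X : Fin 1 → ∀ i, L i) :
    ev (idm : MMap L L 1 0) d X = incl (d 0) (X 0 (d 0)) := by
  rw [ev, idm, incl_gcast]

end Evaluation

/-- Components of the structure maps of a weak Lie 3-algebra on the degrees where they can
be nonzero; the digits in a name are the degrees of the arguments. -/
@[ext]
structure Ops (V₀ V₁ V₂ : Type) [AddCommGroup V₀] [AddCommGroup V₁] [AddCommGroup V₂] where
  d₁ : V₁ →+ V₀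
  d₂ : V₂ →+ V₁
  m00 : V₀ →+ V₀ →+ V₀
  m10 : V₁ →+ V₀ →+ V₁
  m01 : V₀ →+ V₁ →+ V₁
  m20 : V₂ →+ V₀ →+ V₂
  m11 : V₁ →+ V₁ →+ V₂
  m02 : V₀ →+ V₂ →+ V₂
  t000 : V₀ →+ V₀ →+ V₀ →+ V₁
  t100 : V₁ →+ V₀ →+ V₀ →+ V₂
  t010 : V₀ →+ V₁ →+ V₀ →+ V₂
  t001 : V₀ →+ V₀ →+ V₁ →+ V₂
  q : V₀ →+ V₀ →+ V₀ →+ V₀ →+ V₂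
  s00 : V₀ →+ V₀ →+ V₁
  s10 : V₁ →+ V₀ →+ V₂
  s01 : V₀ →+ V₁ →+ V₂
  r : V₀ →+ V₀ →+ V₂
  u : V₀ →+ V₀ →+ V₀ →+ V₂
  v : V₀ →+ V₀ →+ V₀ →+ V₂

/-- The equations of a weak Lie 3-algebra, in components. -/
structure Ops.Eqs {V₀ V₁ V₂ : Type} [AddCommGroup V₀] [AddCommGroup V₁] [AddCommGroup V₂]
    (O : Ops V₀ V₁ V₂) : Prop where
  L1_10 : ∀ x y, O.d₁ (O.m10 x y) = O.m00 (O.d₁ x) y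
  L1_01 : ∀ x y, O.d₁ (O.m01 x y) = O.m00 x (O.d₁ y)
  L1_20 : ∀ x y, O.d₂ (O.m20 x y) = O.m10 (O.d₂ x) y
  L1_11 : ∀ x y, O.d₂ (O.m11 x y) = O.m01 (O.d₁ x) y - O.m10 x (O.d₁ y)
  L1_02 : ∀ x y, O.d₂ (O.m02 x y) = O.m01 x (O.d₂ y)
  L1_21 : ∀ x y, O.m11 (O.d₂ x) y + O.m20 x (O.d₁ y) = 0
  L1_12 : ∀ x y, O.m02 (O.d₁ x) y - O.m11 x (O.d₂ y) = 0
  L2_000 : ∀ x y z, O.d₁ (O.t000 x y z)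
    = O.m00 x (O.m00 y z) - O.m00 (O.m00 x y) z - O.m00 y (O.m00 x z)
  L2_100 : ∀ x y z, O.d₂ (O.t100 x y z) + O.t000 (O.d₁ x) y z
    = O.m10 x (O.m00 y z) - O.m10 (O.m10 x y) z - O.m01 y (O.m10 x z)
  L2_010 : ∀ x y z, O.d₂ (O.t010 x y z) + O.t000 x (O.d₁ y) z
    = O.m01 x (O.m10 y z) - O.m10 (O.m01 x y) z - O.m10 y (O.m00 x z)
  L2_001 : ∀ x y z, O.d₂ (O.t001 x y z) + O.t000 x y (O.d₁ z)
    = O.m01 x (O.m01 y z) - O.m01 (O.m00 x y) z - O.m01 y (O.m01 x z)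
  L2_200 : ∀ x y z, O.t100 (O.d₂ x) y z
    = O.m20 x (O.m00 y z) - O.m20 (O.m20 x y) z - O.m02 y (O.m20 x z)
  L2_020 : ∀ x y z, O.t010 x (O.d₂ y) z
    = O.m02 x (O.m20 y z) - O.m20 (O.m02 x y) z - O.m20 y (O.m00 x z)
  L2_002 : ∀ x y z, O.t001 x y (O.d₂ z)
    = O.m02 x (O.m02 y z) - O.m02 (O.m00 x y) z - O.m02 y (O.m02 x z)
  L2_110 : ∀ x y z, O.t010 (O.d₁ x) y z - O.t100 x (O.d₁ y) z
    = O.m11 x (O.m10 y z) - O.m20 (O.m11 x y) z + O.m11 y (O.m10 x z)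
  L2_101 : ∀ x y z, O.t001 (O.d₁ x) y z - O.t100 x y (O.d₁ z)
    = O.m11 x (O.m01 y z) - O.m11 (O.m10 x y) z - O.m02 y (O.m11 x z)
  L2_011 : ∀ x y z, O.t001 x (O.d₁ y) z - O.t010 x y (O.d₁ z)
    = O.m02 x (O.m11 y z) - O.m11 (O.m01 x y) z - O.m11 y (O.m01 x z)
  L3_0000 : ∀ x y z w, O.d₂ (O.q x y z w)
    = O.m10 (O.t000 x y z) w + O.m01 x (O.t000 y z w) - O.m01 y (O.t000 x z w)
      + O.m01 z (O.t000 x y w) - O.t000 (O.m00 x y) z w + O.t000 x (O.m00 y z) w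
      - O.t000 y (O.m00 x z) w - O.t000 x y (O.m00 z w) + O.t000 x z (O.m00 y w)
      - O.t000 y z (O.m00 x w)
  L3_1000 : ∀ x y z w, - O.q (O.d₁ x) y z w
    = O.m20 (O.t100 x y z) w - O.m11 x (O.t000 y z w) - O.m02 y (O.t100 x z w)
      + O.m02 z (O.t100 x y w) - O.t100 (O.m10 x y) z w + O.t100 x (O.m00 y z) w
      - O.t010 y (O.m10 x z) w - O.t100 x y (O.m00 z w) + O.t100 x z (O.m00 y w)
      - O.t001 y z (O.m10 x w)
  L3_0100 : ∀ x y z w, - O.q x (O.d₁ y) z w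
    = O.m20 (O.t010 x y z) w + O.m02 x (O.t100 y z w) + O.m11 y (O.t000 x z w)
      + O.m02 z (O.t010 x y w) - O.t100 (O.m01 x y) z w + O.t010 x (O.m10 y z) w
      - O.t100 y (O.m00 x z) w - O.t010 x y (O.m00 z w) + O.t001 x z (O.m10 y w)
      - O.t100 y z (O.m00 x w)
  L3_0010 : ∀ x y z w, - O.q x y (O.d₁ z) w
    = O.m20 (O.t001 x y z) w + O.m02 x (O.t010 y z w) - O.m02 y (O.t010 x z w)
      - O.m11 z (O.t000 x y w) - O.t010 (O.m00 x y) z w + O.t010 x (O.m01 y z) w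
      - O.t010 y (O.m01 x z) w - O.t001 x y (O.m10 z w) + O.t010 x z (O.m00 y w)
      - O.t010 y z (O.m00 x w)
  L3_0001 : ∀ x y z w, - O.q x y z (O.d₁ w)
    = O.m11 (O.t000 x y z) w + O.m02 x (O.t001 y z w) - O.m02 y (O.t001 x z w)
      + O.m02 z (O.t001 x y w) - O.t001 (O.m00 x y) z w + O.t001 x (O.m00 y z) w
      - O.t001 y (O.m00 x z) w - O.t001 x y (O.m01 z w) + O.t001 x z (O.m01 y w)
      - O.t001 y z (O.m01 x w)
  L4 : ∀ x y z w e, 0 = O.m20 (O.q x y z w) e - O.m02 x (O.q y z w e)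
      + O.m02 y (O.q x z w e) - O.m02 z (O.q x y w e) + O.m02 w (O.q x y z e)
      + O.t100 (O.t000 x y z) w e + O.t010 x (O.t000 y z w) e - O.t010 y (O.t000 x z w) e
      + O.t010 z (O.t000 x y w) e + O.t001 x y (O.t000 z w e) - O.t001 x z (O.t000 y w e)
      + O.t001 y z (O.t000 x w e) + O.t001 x w (O.t000 y z e) - O.t001 y w (O.t000 x z e)
      + O.t001 z w (O.t000 x y e)
      + O.q (O.m00 x y) z w e - O.q x (O.m00 y z) w e + O.q y (O.m00 x z) w e
      + O.q x y (O.m00 z w) e - O.q x z (O.m00 y w) e + O.q y z (O.m00 x w) e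
      - O.q x y z (O.m00 w e) + O.q x y w (O.m00 z e) - O.q x z w (O.m00 y e)
      + O.q y z w (O.m00 x e)
  W1_00 : ∀ x y, O.d₁ (O.s00 x y) = O.m00 x y + O.m00 y x
  W1_10 : ∀ x y, O.d₂ (O.s10 x y) + O.s00 (O.d₁ x) y = O.m10 x y + O.m01 y x
  W1_01 : ∀ x y, O.d₂ (O.s01 x y) + O.s00 x (O.d₁ y) = O.m01 x y + O.m10 y x
  W1_20 : ∀ x y, O.s10 (O.d₂ x) y = O.m20 x y + O.m02 y x
  W1_11 : ∀ x y, O.s01 (O.d₁ x) y - O.s10 x (O.d₁ y) = O.m11 x y - O.m11 y x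
  W1_02 : ∀ x y, O.s01 x (O.d₂ y) = O.m02 x y + O.m20 y x
  W2_00 : ∀ x y, O.d₂ (O.r x y) = O.s00 x y - O.s00 y x
  W2_10 : ∀ x y, - O.r (O.d₁ x) y = O.s10 x y - O.s01 y x
  W2_01 : ∀ x y, - O.r x (O.d₁ y) = O.s01 x y - O.s10 y x
  W3_000 : ∀ x y z, O.d₂ (O.u x y z)
    = O.t000 x y z + O.t000 y x z + O.m10 (O.s00 x y) z
  W3_100 : ∀ x y z, - O.u (O.d₁ x) y z
    = O.t100 x y z + O.t010 y x z + O.m20 (O.s10 x y) z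
  W3_010 : ∀ x y z, - O.u x (O.d₁ y) z
    = O.t010 x y z + O.t100 y x z + O.m20 (O.s01 x y) z
  W3_001 : ∀ x y z, - O.u x y (O.d₁ z)
    = O.t001 x y z + O.t001 y x z + O.m11 (O.s00 x y) z
  W4_000 : ∀ x y z, O.d₂ (O.v x y z)
    = O.t000 x y z + O.t000 x z y - O.m01 x (O.s00 y z) + O.s00 (O.m00 x y) z
      + O.s00 y (O.m00 x z)
  W4_100 : ∀ x y z, - O.v (O.d₁ x) y z
    = O.t100 x y z + O.t100 x z y + O.m11 x (O.s00 y z) + O.s10 (O.m10 x y) z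
      + O.s01 y (O.m10 x z)
  W4_010 : ∀ x y z, - O.v x (O.d₁ y) z
    = O.t010 x y z + O.t001 x z y - O.m02 x (O.s10 y z) + O.s10 (O.m01 x y) z
      + O.s10 y (O.m00 x z)
  W4_001 : ∀ x y z, - O.v x y (O.d₁ z)
    = O.t001 x y z + O.t010 x z y - O.m02 x (O.s01 y z) + O.s01 (O.m00 x y) z
      + O.s01 y (O.m01 x z)
  W5 : ∀ x y, O.r x y + O.r y x = 0
  W6 : ∀ x y z, O.u x y z - O.u y x z = O.m20 (O.r x y) z
  W7 : ∀ x y z, O.u x y z - O.v y x z + O.u y z x - O.v x y z + O.u x z y - O.v z x y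
    = O.s01 x (O.s00 y z) + O.s10 (O.s00 x y) z + O.s01 y (O.s00 x z) + O.r y (O.m00 z x)
  W8 : ∀ x y z, O.v x y z - O.v x z y
    = - O.m02 x (O.r y z) + O.r (O.m00 x y) z + O.r y (O.m00 x z)
  W9 : ∀ x y z w, O.q x y z w + O.q y x z w
    = O.m20 (O.u x y z) w - O.u x y (O.m00 z w) + O.m02 z (O.u x y w)
      + O.t100 (O.s00 x y) z w
  W10 : ∀ x y z w, O.q x y z w + O.q x z y w
    = O.m20 (O.v x y z) w - O.t010 x (O.s00 y z) w + O.m02 x (O.u y z w)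
      - O.u (O.m00 x y) z w - O.u y (O.m00 x z) w - O.u y z (O.m00 x w)
  W11 : ∀ x y z w, O.q x y z w + O.q x y w z
    = O.s10 (O.t000 x y z) w - O.v (O.m00 x y) z w + O.v x (O.m00 y z) w
      - O.v y (O.m00 x z) w + O.t001 x y (O.s00 z w) + O.v x z (O.m00 y w)
      - O.v y z (O.m00 x w) + O.m02 x (O.v y z w) - O.m02 y (O.v x z w)
      + O.s01 z (O.t000 x y w)
set_option linter.unusedSimpArgs false
section Hom

variable {A B C D F : Type} [AddCommGroup A] [AddCommGroup B] [AddCommGroup C]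
  [AddCommGroup D] [AddCommGroup F]

/-- A biadditive function as a bundled homomorphism. -/
def hom₂ (f : A → B → C) (h₁ : ∀ x x' y, f (x + x') y = f x y + f x' y)
    (h₂ : ∀ x y y', f x (y + y') = f x y + f x y') : A →+ B →+ C :=
  AddMonoidHom.mk' (fun x => AddMonoidHom.mk' (f x) (h₂ x))
    fun x x' => AddMonoidHom.ext (h₁ x x')

/-- A triadditive function as a bundled homomorphism. -/
def hom₃ (f : A → B → C → D) (h₁ : ∀ x x' y z, f (x + x') y z = f x y z + f x' y z)
    (h₂ : ∀ x y y' z, f x (y + y') z = f x y z + f x y' z)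
    (h₃ : ∀ x y z z', f x y (z + z') = f x y z + f x y z') : A →+ B →+ C →+ D :=
  AddMonoidHom.mk' (fun x => hom₂ (f x) (h₂ x) (h₃ x))
    fun x x' => AddMonoidHom.ext fun y => AddMonoidHom.ext (h₁ x x' y)

/-- A 4-additive function as a bundled homomorphism. -/
def hom₄ (f : A → B → C → D → F)
    (h₁ : ∀ x x' y z w, f (x + x') y z w = f x y z w + f x' y z w)
    (h₂ : ∀ x y y' z w, f x (y + y') z w = f x y z w + f x y' z w)
    (h₃ : ∀ x y z z' w, f x y (z + z') w = f x y z w + f x y z' w)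
    (h₄ : ∀ x y z w w', f x y z (w + w') = f x y z w + f x y z w') :
    A →+ B →+ C →+ D →+ F :=
  AddMonoidHom.mk' (fun x => hom₃ (f x) (h₂ x) (h₃ x) (h₄ x))
    fun x x' => AddMonoidHom.ext fun y => AddMonoidHom.ext fun z => AddMonoidHom.ext (h₁ x x' y z)

@[simp] theorem hom₂_apply (f : A → B → C) (h₁ h₂) (x y) : hom₂ f h₁ h₂ x y = f x y := rfl

@[simp] theorem hom₃_apply (f : A → B → C → D) (h₁ h₂ h₃) (x y z) :
    hom₃ f h₁ h₂ h₃ x y z = f x y z := rfl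

@[simp] theorem hom₄_apply (f : A → B → C → D → F) (h₁ h₂ h₃ h₄) (x y z w) :
    hom₄ f h₁ h₂ h₃ h₄ x y z w = f x y z w := rfl

end Hom

namespace Ops

variable {V₀ V₁ V₂ W₀ W₁ W₂ : Type} [AddCommGroup V₀] [AddCommGroup V₁] [AddCommGroup V₂]
  [AddCommGroup W₀] [AddCommGroup W₁] [AddCommGroup W₂]

/-- Homotopy retract data, in components. -/
structure Retract (O : Ops V₀ V₁ V₂) (W₀ W₁ W₂ : Type)
    [AddCommGroup W₀] [AddCommGroup W₁] [AddCommGroup W₂] where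
  e₁ : W₁ →+ W₀
  e₂ : W₂ →+ W₁
  i₀ : W₀ →+ V₀
  i₁ : W₁ →+ V₁
  i₂ : W₂ →+ V₂
  p₀ : V₀ →+ W₀
  p₁ : V₁ →+ W₁
  p₂ : V₂ →+ W₂
  h₀ : V₀ →+ V₁
  h₁ : V₁ →+ V₂
  e_p₁ : ∀ x, e₁ (p₁ x) = p₀ (O.d₁ x)
  e_p₂ : ∀ x, e₂ (p₂ x) = p₁ (O.d₂ x)
  i_e₁ : ∀ x, i₀ (e₁ x) = O.d₁ (i₁ x)
  i_e₂ : ∀ x, i₁ (e₂ x) = O.d₂ (i₂ x)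
  d_h₀ : ∀ x, O.d₁ (h₀ x) = x - i₀ (p₀ x)
  d_h₁ : ∀ x, O.d₂ (h₁ x) = x - i₁ (p₁ x) - h₀ (O.d₁ x)
  i_p₂ : ∀ x, i₂ (p₂ x) = x - h₁ (O.d₂ x)

variable (O : Ops V₀ V₁ V₂) (R : O.Retract W₀ W₁ W₂)

namespace Retract

variable {O}

/-- The composite `h ∘ λ₂` on elements of degree zero. -/
def H2 : V₀ →+ V₀ →+ V₁ :=
  hom₂ (fun x y => R.h₀ (O.m00 x y)) (by intros; simp) (by intros; simp)

/-- The tree sum underlying the transferred ternary bracket in degrees `(0, 0, 0)`. -/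
def T000 : V₀ →+ V₀ →+ V₀ →+ V₁ :=
  hom₃ (fun x y z => O.t000 x y z + O.m10 (R.H2 x y) z - O.m01 x (R.H2 y z)
      + O.m01 y (R.H2 x z))
    (by intros; simp only [map_add, AddMonoidHom.add_apply]; abel)
    (by intros; simp only [map_add, AddMonoidHom.add_apply]; abel)
    (by intros; simp only [map_add, AddMonoidHom.add_apply]; abel)

/-- The tree sum underlying the transferred ternary bracket in degrees `(1, 0, 0)`. -/
def T100 : V₁ →+ V₀ →+ V₀ →+ V₂ :=
  hom₃ (fun x y z => O.t100 x y z + O.m20 (R.h₁ (O.m10 x y)) z + O.m11 x (R.H2 y z)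
      + O.m02 y (R.h₁ (O.m10 x z)))
    (by intros; simp only [map_add, AddMonoidHom.add_apply]; abel)
    (by intros; simp only [map_add, AddMonoidHom.add_apply]; abel)
    (by intros; simp only [map_add, AddMonoidHom.add_apply]; abel)

/-- The tree sum underlying the transferred ternary bracket in degrees `(0, 1, 0)`. -/
def T010 : V₀ →+ V₁ →+ V₀ →+ V₂ :=
  hom₃ (fun x y z => O.t010 x y z + O.m20 (R.h₁ (O.m01 x y)) z - O.m02 x (R.h₁ (O.m10 y z))
      - O.m11 y (R.H2 x z))
    (by intros; simp only [map_add, AddMonoidHom.add_apply]; abel)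
    (by intros; simp only [map_add, AddMonoidHom.add_apply]; abel)
    (by intros; simp only [map_add, AddMonoidHom.add_apply]; abel)

/-- The tree sum underlying the transferred ternary bracket in degrees `(0, 0, 1)`. -/
def T001 : V₀ →+ V₀ →+ V₁ →+ V₂ :=
  hom₃ (fun x y z => O.t001 x y z + O.m11 (R.H2 x y) z - O.m02 x (R.h₁ (O.m01 y z))
      + O.m02 y (R.h₁ (O.m01 x z)))
    (by intros; simp only [map_add, AddMonoidHom.add_apply]; abel)
    (by intros; simp only [map_add, AddMonoidHom.add_apply]; abel)
    (by intros; simp only [map_add, AddMonoidHom.add_apply]; abel)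

/-- The composite of `h` with the ternary tree sum. -/
def H3 : V₀ →+ V₀ →+ V₀ →+ V₂ :=
  hom₃ (fun x y z => R.h₁ (R.T000 x y z)) (by intros; simp) (by intros; simp) (by intros; simp)

/-- The tree sum underlying the transferred quaternary bracket. -/
def T4 : V₀ →+ V₀ →+ V₀ →+ V₀ →+ V₂ :=
  hom₄ (fun x y z w => O.q x y z w
      - (O.m20 (R.H3 x y z) w + O.m02 x (R.H3 y z w) - O.m02 y (R.H3 x z w)
        + O.m02 z (R.H3 x y w))
      - (O.t100 (R.H2 x y) z w - O.t010 x (R.H2 y z) w + O.t010 y (R.H2 x z) w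
        + O.t001 x y (R.H2 z w) - O.t001 x z (R.H2 y w) + O.t001 y z (R.H2 x w))
      - (O.m11 (R.H2 x y) (R.H2 z w) - O.m11 (R.H2 x z) (R.H2 y w)
        + O.m11 (R.H2 y z) (R.H2 x w)))
    (by intros; simp only [map_add, AddMonoidHom.add_apply]; abel)
    (by intros; simp only [map_add, AddMonoidHom.add_apply]; abel)
    (by intros; simp only [map_add, AddMonoidHom.add_apply]; abel)
    (by intros; simp only [map_add, AddMonoidHom.add_apply]; abel)

/-- The tree sum underlying the transferred map `λ₃₁`. -/
def T31 : V₀ →+ V₀ →+ V₀ →+ V₂ :=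
  hom₃ (fun x y z => O.u x y z - O.m20 (R.h₁ (O.s00 x y)) z)
    (by intros; simp only [map_add, AddMonoidHom.add_apply]; abel)
    (by intros; simp only [map_add, AddMonoidHom.add_apply]; abel)
    (by intros; simp only [map_add, AddMonoidHom.add_apply]; abel)

/-- The tree sum underlying the transferred map `λ₃₂`. -/
def T32 : V₀ →+ V₀ →+ V₀ →+ V₂ :=
  hom₃ (fun x y z => O.v x y z + O.s10 (R.H2 x y) z + O.m02 x (R.h₁ (O.s00 y z))
      + O.s01 y (R.H2 x z))
    (by intros; simp only [map_add, AddMonoidHom.add_apply]; abel)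
    (by intros; simp only [map_add, AddMonoidHom.add_apply]; abel)
    (by intros; simp only [map_add, AddMonoidHom.add_apply]; abel)

/-- The transferred structure, in components. -/
def transfer : Ops W₀ W₁ W₂ where
  d₁ := R.e₁
  d₂ := R.e₂
  m00 := hom₂ (fun x y => R.p₀ (O.m00 (R.i₀ x) (R.i₀ y))) (by intros; simp) (by intros; simp)
  m10 := hom₂ (fun x y => R.p₁ (O.m10 (R.i₁ x) (R.i₀ y))) (by intros; simp) (by intros; simp)
  m01 := hom₂ (fun x y => R.p₁ (O.m01 (R.i₀ x) (R.i₁ y))) (by intros; simp) (by intros; simp)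
  m20 := hom₂ (fun x y => R.p₂ (O.m20 (R.i₂ x) (R.i₀ y))) (by intros; simp) (by intros; simp)
  m11 := hom₂ (fun x y => R.p₂ (O.m11 (R.i₁ x) (R.i₁ y))) (by intros; simp) (by intros; simp)
  m02 := hom₂ (fun x y => R.p₂ (O.m02 (R.i₀ x) (R.i₂ y))) (by intros; simp) (by intros; simp)
  t000 := hom₃ (fun x y z => R.p₁ (R.T000 (R.i₀ x) (R.i₀ y) (R.i₀ z)))
    (by intros; simp) (by intros; simp) (by intros; simp)
  t100 := hom₃ (fun x y z => R.p₂ (R.T100 (R.i₁ x) (R.i₀ y) (R.i₀ z)))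
    (by intros; simp) (by intros; simp) (by intros; simp)
  t010 := hom₃ (fun x y z => R.p₂ (R.T010 (R.i₀ x) (R.i₁ y) (R.i₀ z)))
    (by intros; simp) (by intros; simp) (by intros; simp)
  t001 := hom₃ (fun x y z => R.p₂ (R.T001 (R.i₀ x) (R.i₀ y) (R.i₁ z)))
    (by intros; simp) (by intros; simp) (by intros; simp)
  q := hom₄ (fun x y z w => R.p₂ (R.T4 (R.i₀ x) (R.i₀ y) (R.i₀ z) (R.i₀ w)))
    (by intros; simp) (by intros; simp) (by intros; simp) (by intros; simp)
  s00 := hom₂ (fun x y => R.p₁ (O.s00 (R.i₀ x) (R.i₀ y))) (by intros; simp) (by intros; simp)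
  s10 := hom₂ (fun x y => R.p₂ (O.s10 (R.i₁ x) (R.i₀ y))) (by intros; simp) (by intros; simp)
  s01 := hom₂ (fun x y => R.p₂ (O.s01 (R.i₀ x) (R.i₁ y))) (by intros; simp) (by intros; simp)
  r := hom₂ (fun x y => R.p₂ (O.r (R.i₀ x) (R.i₀ y))) (by intros; simp) (by intros; simp)
  u := hom₃ (fun x y z => R.p₂ (R.T31 (R.i₀ x) (R.i₀ y) (R.i₀ z)))
    (by intros; simp) (by intros; simp) (by intros; simp)
  v := hom₃ (fun x y z => R.p₂ (R.T32 (R.i₀ x) (R.i₀ y) (R.i₀ z)))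
    (by intros; simp) (by intros; simp) (by intros; simp)

theorem H2_apply (x y) : R.H2 x y = R.h₀ (O.m00 x y) := rfl

theorem H3_apply (x y z) : R.H3 x y z = R.h₁ (R.T000 x y z) := rfl

theorem T000_apply (x y z) : R.T000 x y z
    = O.t000 x y z + O.m10 (R.H2 x y) z - O.m01 x (R.H2 y z) + O.m01 y (R.H2 x z) := rfl

theorem T100_apply (x y z) : R.T100 x y z
    = O.t100 x y z + O.m20 (R.h₁ (O.m10 x y)) z + O.m11 x (R.H2 y z)
      + O.m02 y (R.h₁ (O.m10 x z)) := rfl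

theorem T010_apply (x y z) : R.T010 x y z
    = O.t010 x y z + O.m20 (R.h₁ (O.m01 x y)) z - O.m02 x (R.h₁ (O.m10 y z))
      - O.m11 y (R.H2 x z) := rfl

theorem T001_apply (x y z) : R.T001 x y z
    = O.t001 x y z + O.m11 (R.H2 x y) z - O.m02 x (R.h₁ (O.m01 y z))
      + O.m02 y (R.h₁ (O.m01 x z)) := rfl

theorem T4_apply (x y z w) : R.T4 x y z w
    = O.q x y z w
      - (O.m20 (R.H3 x y z) w + O.m02 x (R.H3 y z w) - O.m02 y (R.H3 x z w)
        + O.m02 z (R.H3 x y w))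
      - (O.t100 (R.H2 x y) z w - O.t010 x (R.H2 y z) w + O.t010 y (R.H2 x z) w
        + O.t001 x y (R.H2 z w) - O.t001 x z (R.H2 y w) + O.t001 y z (R.H2 x w))
      - (O.m11 (R.H2 x y) (R.H2 z w) - O.m11 (R.H2 x z) (R.H2 y w)
        + O.m11 (R.H2 y z) (R.H2 x w)) := rfl

theorem T31_apply (x y z) : R.T31 x y z = O.u x y z - O.m20 (R.h₁ (O.s00 x y)) z := rfl

theorem T32_apply (x y z) : R.T32 x y z = O.v x y z + O.s10 (R.H2 x y) z
    + O.m02 x (R.h₁ (O.s00 y z)) + O.s01 y (R.H2 x z) := rfl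

theorem d_H2 (x y) : O.d₁ (R.H2 x y) = O.m00 x y - R.i₀ (R.p₀ (O.m00 x y)) :=
  R.d_h₀ _

variable (hO : O.Eqs)
include hO

theorem d_T000 (x y z) : O.d₁ (R.T000 x y z)
    = O.m00 x (R.i₀ (R.p₀ (O.m00 y z))) - O.m00 (R.i₀ (R.p₀ (O.m00 x y))) z
      - O.m00 y (R.i₀ (R.p₀ (O.m00 x z))) := by
  simp only [T000_apply, map_add, map_sub, AddMonoidHom.sub_apply, hO.L1_10, hO.L1_01,
    hO.L2_000, d_H2]
  abel

theorem d_T100 (x y z) : O.d₂ (R.T100 x y z) + R.T000 (O.d₁ x) y z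
    = O.m10 x (R.i₀ (R.p₀ (O.m00 y z))) - O.m10 (R.i₁ (R.p₁ (O.m10 x y))) z
      - O.m01 y (R.i₁ (R.p₁ (O.m10 x z))) := by
  simp only [T000_apply, T100_apply, map_add, map_sub, AddMonoidHom.sub_apply,
    hO.L1_20, hO.L1_11, hO.L1_02, hO.L1_10, R.d_h₁, eq_sub_of_add_eq (hO.L2_100 _ _ _),
    H2_apply, R.d_h₀]
  abel

theorem d_T010 (x y z) : O.d₂ (R.T010 x y z) + R.T000 x (O.d₁ y) z
    = O.m01 x (R.i₁ (R.p₁ (O.m10 y z))) - O.m10 (R.i₁ (R.p₁ (O.m01 x y))) z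
      - O.m10 y (R.i₀ (R.p₀ (O.m00 x z))) := by
  simp only [T000_apply, T010_apply, map_add, map_sub, AddMonoidHom.sub_apply,
    hO.L1_20, hO.L1_11, hO.L1_02, hO.L1_10, hO.L1_01, R.d_h₁, eq_sub_of_add_eq (hO.L2_010 _ _ _),
    H2_apply, R.d_h₀]
  abel

theorem d_T001 (x y z) : O.d₂ (R.T001 x y z) + R.T000 x y (O.d₁ z)
    = O.m01 x (R.i₁ (R.p₁ (O.m01 y z))) - O.m01 (R.i₀ (R.p₀ (O.m00 x y))) z
      - O.m01 y (R.i₁ (R.p₁ (O.m01 x z))) := by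
  simp only [T000_apply, T001_apply, map_add, map_sub, AddMonoidHom.sub_apply,
    hO.L1_20, hO.L1_11, hO.L1_02, hO.L1_01, R.d_h₁, eq_sub_of_add_eq (hO.L2_001 _ _ _),
    H2_apply, R.d_h₀]
  abel

theorem T100_d (x y z) : R.T100 (O.d₂ x) y z
    = O.m20 x (R.i₀ (R.p₀ (O.m00 y z))) - O.m20 (R.i₂ (R.p₂ (O.m20 x y))) z
      - O.m02 y (R.i₂ (R.p₂ (O.m20 x z))) := by
  have h := hO.L1_21 x (R.H2 y z)
  simp only [d_H2, map_sub] at h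
  simp only [T100_apply, R.i_p₂, hO.L1_20, hO.L2_200, map_sub, AddMonoidHom.sub_apply]
  rw [← sub_eq_zero, ← h]
  abel

theorem T010_d (x y z) : R.T010 x (O.d₂ y) z
    = O.m02 x (R.i₂ (R.p₂ (O.m20 y z))) - O.m20 (R.i₂ (R.p₂ (O.m02 x y))) z
      - O.m20 y (R.i₀ (R.p₀ (O.m00 x z))) := by
  have h := hO.L1_21 y (R.H2 x z)
  simp only [d_H2, map_sub] at h
  simp only [T010_apply, R.i_p₂, hO.L1_20, hO.L1_02, hO.L2_020, map_sub,
    AddMonoidHom.sub_apply]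
  rw [← sub_eq_zero, ← neg_eq_zero, ← h]
  abel

theorem T001_d (x y z) : R.T001 x y (O.d₂ z)
    = O.m02 x (R.i₂ (R.p₂ (O.m02 y z))) - O.m02 (R.i₀ (R.p₀ (O.m00 x y))) z
      - O.m02 y (R.i₂ (R.p₂ (O.m02 x z))) := by
  have h := hO.L1_12 (R.H2 x y) z
  simp only [d_H2, map_sub, AddMonoidHom.sub_apply] at h
  simp only [T001_apply, R.i_p₂, hO.L1_02, hO.L2_002, map_sub, AddMonoidHom.sub_apply]
  rw [← sub_eq_zero, ← neg_eq_zero, ← h]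
  abel

theorem T_110 (x y z) : R.T010 (O.d₁ x) y z - R.T100 x (O.d₁ y) z
    = O.m11 x (R.i₁ (R.p₁ (O.m10 y z))) - O.m20 (R.i₂ (R.p₂ (O.m11 x y))) z
      + O.m11 y (R.i₁ (R.p₁ (O.m10 x z))) := by
  linear_combination (norm := skip) hO.L2_110 x y z - hO.L1_12 x (R.h₁ (O.m10 y z))
    - hO.L1_12 y (R.h₁ (O.m10 x z))
  simp only [T010_apply, T100_apply, R.i_p₂, hO.L1_11, hO.L1_10, map_sub,
    AddMonoidHom.sub_apply, R.d_h₁, H2_apply]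
  abel

theorem T_101 (x y z) : R.T001 (O.d₁ x) y z - R.T100 x y (O.d₁ z)
    = O.m11 x (R.i₁ (R.p₁ (O.m01 y z))) - O.m11 (R.i₁ (R.p₁ (O.m10 x y))) z
      - O.m02 y (R.i₂ (R.p₂ (O.m11 x z))) := by
  linear_combination (norm := skip) hO.L2_101 x y z - hO.L1_12 x (R.h₁ (O.m01 y z))
    - hO.L1_21 (R.h₁ (O.m10 x y)) z
  simp only [T001_apply, T100_apply, R.i_p₂, hO.L1_11, hO.L1_10, hO.L1_01, map_sub,
    AddMonoidHom.sub_apply, R.d_h₁, H2_apply]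
  abel

theorem T_011 (x y z) : R.T001 x (O.d₁ y) z - R.T010 x y (O.d₁ z)
    = O.m02 x (R.i₂ (R.p₂ (O.m11 y z))) - O.m11 (R.i₁ (R.p₁ (O.m01 x y))) z
      - O.m11 y (R.i₁ (R.p₁ (O.m01 x z))) := by
  linear_combination (norm := skip) hO.L2_011 x y z + hO.L1_12 y (R.h₁ (O.m01 x z))
    - hO.L1_21 (R.h₁ (O.m01 x y)) z
  simp only [T001_apply, T010_apply, R.i_p₂, hO.L1_11, hO.L1_10, hO.L1_01, map_sub,
    AddMonoidHom.sub_apply, R.d_h₁, H2_apply]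
  abel

theorem d_H3 (x y z) : O.d₂ (R.H3 x y z) = R.T000 x y z - R.i₁ (R.p₁ (R.T000 x y z))
    - (R.H2 x (R.i₀ (R.p₀ (O.m00 y z))) - R.H2 (R.i₀ (R.p₀ (O.m00 x y))) z
      - R.H2 y (R.i₀ (R.p₀ (O.m00 x z)))) := by
  simp only [H3_apply, R.d_h₁, R.d_T000 hO, H2_apply, map_sub]

theorem d_T4 (x y z w) : O.d₂ (R.T4 x y z w)
    = O.m10 (R.i₁ (R.p₁ (R.T000 x y z))) w + O.m01 x (R.i₁ (R.p₁ (R.T000 y z w)))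
      - O.m01 y (R.i₁ (R.p₁ (R.T000 x z w))) + O.m01 z (R.i₁ (R.p₁ (R.T000 x y w)))
      - R.T000 (R.i₀ (R.p₀ (O.m00 x y))) z w + R.T000 x (R.i₀ (R.p₀ (O.m00 y z))) w
      - R.T000 y (R.i₀ (R.p₀ (O.m00 x z))) w - R.T000 x y (R.i₀ (R.p₀ (O.m00 z w)))
      + R.T000 x z (R.i₀ (R.p₀ (O.m00 y w))) - R.T000 y z (R.i₀ (R.p₀ (O.m00 x w))) := by
  simp only [T4_apply, map_add, map_sub, hO.L1_20, hO.L1_11, hO.L1_02, R.d_H3 hO,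
    eq_sub_of_add_eq (hO.L2_001 _ _ _), eq_sub_of_add_eq (hO.L2_010 _ _ _),
    eq_sub_of_add_eq (hO.L2_100 _ _ _), hO.L3_0000, AddMonoidHom.sub_apply, d_H2]
  generalize R.i₁ (R.p₁ (R.T000 x y z)) = a₁, R.i₁ (R.p₁ (R.T000 x y w)) = a₂,
    R.i₁ (R.p₁ (R.T000 x z w)) = a₃, R.i₁ (R.p₁ (R.T000 y z w)) = a₄
  simp only [T000_apply, map_add, map_sub, AddMonoidHom.sub_apply, AddMonoidHom.add_apply]
  abel

/-- In degree two, the homotopy identity expresses `T4` in terms of lower operations. -/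
theorem i_p_T4 (x y z w) : R.i₂ (R.p₂ (R.T4 x y z w)) = R.T4 x y z w
    - R.h₁ (O.m10 (R.i₁ (R.p₁ (R.T000 x y z))) w + O.m01 x (R.i₁ (R.p₁ (R.T000 y z w)))
      - O.m01 y (R.i₁ (R.p₁ (R.T000 x z w))) + O.m01 z (R.i₁ (R.p₁ (R.T000 x y w))))
    + (R.H3 (R.i₀ (R.p₀ (O.m00 x y))) z w - R.H3 x (R.i₀ (R.p₀ (O.m00 y z))) w
      + R.H3 y (R.i₀ (R.p₀ (O.m00 x z))) w + R.H3 x y (R.i₀ (R.p₀ (O.m00 z w)))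
      - R.H3 x z (R.i₀ (R.p₀ (O.m00 y w))) + R.H3 y z (R.i₀ (R.p₀ (O.m00 x w)))) := by
  simp only [R.i_p₂, R.d_T4 hO, H3_apply, map_add, map_sub]
  abel

theorem m11_d (x y) : O.m11 (O.d₂ x) y = - O.m20 x (O.d₁ y) :=
  eq_neg_of_add_eq_zero_left (hO.L1_21 x y)

theorem m11_d' (x y) : O.m11 x (O.d₂ y) = O.m02 (O.d₁ x) y :=
  (sub_eq_zero.mp (hO.L1_12 x y)).symm

theorem H2_d (x y) : R.H2 (O.d₁ x) y
    = O.m10 x y - R.i₁ (R.p₁ (O.m10 x y)) - O.d₂ (R.h₁ (O.m10 x y)) := by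
  rw [H2_apply, ← hO.L1_10, R.d_h₁]; abel

theorem H2_d' (x y) : R.H2 x (O.d₁ y)
    = O.m01 x y - R.i₁ (R.p₁ (O.m01 x y)) - O.d₂ (R.h₁ (O.m01 x y)) := by
  rw [H2_apply, ← hO.L1_01, R.d_h₁]; abel

theorem H3_100 (x y z) : R.H3 (O.d₁ x) y z = R.h₁ (O.m10 x (R.i₀ (R.p₀ (O.m00 y z))))
    - R.h₁ (O.m10 (R.i₁ (R.p₁ (O.m10 x y))) z)
    - R.h₁ (O.m01 y (R.i₁ (R.p₁ (O.m10 x z)))) - R.T100 x y z + R.i₂ (R.p₂ (R.T100 x y z)) := by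
  rw [R.i_p₂, eq_sub_of_add_eq (R.d_T100 hO x y z)]
  simp only [map_sub, H3_apply]
  abel

theorem H3_010 (x y z) : R.H3 x (O.d₁ y) z = R.h₁ (O.m01 x (R.i₁ (R.p₁ (O.m10 y z))))
    - R.h₁ (O.m10 (R.i₁ (R.p₁ (O.m01 x y))) z)
    - R.h₁ (O.m10 y (R.i₀ (R.p₀ (O.m00 x z)))) - R.T010 x y z + R.i₂ (R.p₂ (R.T010 x y z)) := by
  rw [R.i_p₂, eq_sub_of_add_eq (R.d_T010 hO x y z)]
  simp only [map_sub, H3_apply]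
  abel

theorem H3_001 (x y z) : R.H3 x y (O.d₁ z) = R.h₁ (O.m01 x (R.i₁ (R.p₁ (O.m01 y z))))
    - R.h₁ (O.m01 (R.i₀ (R.p₀ (O.m00 x y))) z)
    - R.h₁ (O.m01 y (R.i₁ (R.p₁ (O.m01 x z)))) - R.T001 x y z + R.i₂ (R.p₂ (R.T001 x y z)) := by
  rw [R.i_p₂, eq_sub_of_add_eq (R.d_T001 hO x y z)]
  simp only [map_sub, H3_apply]
  abel

theorem T4_1000 (x y z w) : - R.T4 (O.d₁ x) y z w
    = O.m20 (R.i₂ (R.p₂ (R.T100 x y z))) w - O.m11 x (R.i₁ (R.p₁ (R.T000 y z w)))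
      - O.m02 y (R.i₂ (R.p₂ (R.T100 x z w))) + O.m02 z (R.i₂ (R.p₂ (R.T100 x y w)))
      - R.T100 (R.i₁ (R.p₁ (O.m10 x y))) z w + R.T100 x (R.i₀ (R.p₀ (O.m00 y z))) w
      - R.T010 y (R.i₁ (R.p₁ (O.m10 x z))) w - R.T100 x y (R.i₀ (R.p₀ (O.m00 z w)))
      + R.T100 x z (R.i₀ (R.p₀ (O.m00 y w))) - R.T001 y z (R.i₁ (R.p₁ (O.m10 x w))) := by
  linear_combination (norm := skip) hO.L3_1000 x y z w
    + hO.L1_12 x (R.H3 y z w) - hO.L2_110 x (R.H2 y z) w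
    + hO.L2_101 x y (R.H2 z w) - hO.L2_101 x z (R.H2 y w)
  simp only [T4_apply, T100_apply, T010_apply, T001_apply, R.H2_d hO, R.H2_d' hO, R.H3_100 hO,
    R.d_H3 hO, R.d_H2, m11_d hO, m11_d' hO, hO.L2_200, hO.L2_002, hO.L2_020, map_add,
    map_sub, AddMonoidHom.add_apply, AddMonoidHom.sub_apply]
  generalize R.i₁ (R.p₁ (R.T000 y z w)) = a
  simp only [T000_apply, map_add, map_sub, AddMonoidHom.sub_apply, AddMonoidHom.add_apply]
  abel

theorem T4_0100 (x y z w) : - R.T4 x (O.d₁ y) z w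
    = O.m20 (R.i₂ (R.p₂ (R.T010 x y z))) w + O.m02 x (R.i₂ (R.p₂ (R.T100 y z w)))
      + O.m11 y (R.i₁ (R.p₁ (R.T000 x z w))) + O.m02 z (R.i₂ (R.p₂ (R.T010 x y w)))
      - R.T100 (R.i₁ (R.p₁ (O.m01 x y))) z w + R.T010 x (R.i₁ (R.p₁ (O.m10 y z))) w
      - R.T100 y (R.i₀ (R.p₀ (O.m00 x z))) w - R.T010 x y (R.i₀ (R.p₀ (O.m00 z w)))
      + R.T001 x z (R.i₁ (R.p₁ (O.m10 y w))) - R.T100 y z (R.i₀ (R.p₀ (O.m00 x w))) := by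
  linear_combination (norm := skip) hO.L3_0100 x y z w
    - hO.L1_12 y (R.H3 x z w) + hO.L2_110 y (R.H2 x z) w
    + hO.L2_011 x y (R.H2 z w) + hO.L2_101 y z (R.H2 x w)
  simp only [T4_apply, T100_apply, T010_apply, T001_apply, R.H2_d hO, R.H2_d' hO, R.H3_100 hO,
    R.H3_010 hO, R.H3_001 hO, R.d_H3 hO, R.d_H2, m11_d hO, m11_d' hO, hO.L2_200, hO.L2_002,
    hO.L2_020, map_add, map_sub, AddMonoidHom.add_apply, AddMonoidHom.sub_apply]
  generalize R.i₁ (R.p₁ (R.T000 x z w)) = a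
  simp only [T000_apply, map_add, map_sub, AddMonoidHom.sub_apply, AddMonoidHom.add_apply]
  abel

theorem T4_0010 (x y z w) : - R.T4 x y (O.d₁ z) w
    = O.m20 (R.i₂ (R.p₂ (R.T001 x y z))) w + O.m02 x (R.i₂ (R.p₂ (R.T010 y z w)))
      - O.m02 y (R.i₂ (R.p₂ (R.T010 x z w))) - O.m11 z (R.i₁ (R.p₁ (R.T000 x y w)))
      - R.T010 (R.i₀ (R.p₀ (O.m00 x y))) z w + R.T010 x (R.i₁ (R.p₁ (O.m01 y z))) w
      - R.T010 y (R.i₁ (R.p₁ (O.m01 x z))) w - R.T001 x y (R.i₁ (R.p₁ (O.m10 z w)))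
      + R.T010 x z (R.i₀ (R.p₀ (O.m00 y w))) - R.T010 y z (R.i₀ (R.p₀ (O.m00 x w))) := by
  linear_combination (norm := skip) hO.L3_0010 x y z w
    + hO.L1_12 z (R.H3 x y w) - hO.L2_110 (R.H2 x y) z w
    - hO.L2_011 x z (R.H2 y w) + hO.L2_011 y z (R.H2 x w)
  simp only [T4_apply, T100_apply, T010_apply, T001_apply, R.H2_d hO, R.H2_d' hO, R.H3_100 hO,
    R.H3_010 hO, R.H3_001 hO, R.d_H3 hO, R.d_H2, m11_d hO, m11_d' hO, hO.L2_200, hO.L2_002,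
    hO.L2_020, map_add, map_sub, AddMonoidHom.add_apply, AddMonoidHom.sub_apply]
  generalize R.i₁ (R.p₁ (R.T000 x y w)) = a
  simp only [T000_apply, map_add, map_sub, AddMonoidHom.sub_apply, AddMonoidHom.add_apply]
  abel

theorem T4_0001 (x y z w) : - R.T4 x y z (O.d₁ w)
    = O.m11 (R.i₁ (R.p₁ (R.T000 x y z))) w + O.m02 x (R.i₂ (R.p₂ (R.T001 y z w)))
      - O.m02 y (R.i₂ (R.p₂ (R.T001 x z w))) + O.m02 z (R.i₂ (R.p₂ (R.T001 x y w)))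
      - R.T001 (R.i₀ (R.p₀ (O.m00 x y))) z w + R.T001 x (R.i₀ (R.p₀ (O.m00 y z))) w
      - R.T001 y (R.i₀ (R.p₀ (O.m00 x z))) w - R.T001 x y (R.i₁ (R.p₁ (O.m01 z w)))
      + R.T001 x z (R.i₁ (R.p₁ (O.m01 y w))) - R.T001 y z (R.i₁ (R.p₁ (O.m01 x w))) := by
  linear_combination (norm := skip) hO.L3_0001 x y z w
    + hO.L1_21 (R.H3 x y z) w - hO.L2_101 (R.H2 x y) z w
    + hO.L2_011 x (R.H2 y z) w - hO.L2_011 y (R.H2 x z) w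
  simp only [T4_apply, T100_apply, T010_apply, T001_apply, R.H2_d hO, R.H2_d' hO, R.H3_100 hO,
    R.H3_010 hO, R.H3_001 hO, R.d_H3 hO, R.d_H2, m11_d hO, m11_d' hO, hO.L2_200, hO.L2_002,
    hO.L2_020, map_add, map_sub, AddMonoidHom.add_apply, AddMonoidHom.sub_apply]
  generalize R.i₁ (R.p₁ (R.T000 x y z)) = a
  simp only [T000_apply, map_add, map_sub, AddMonoidHom.sub_apply, AddMonoidHom.add_apply]
  abel

theorem d_T31 (x y z) : O.d₂ (R.T31 x y z)
    = R.T000 x y z + R.T000 y x z + O.m10 (R.i₁ (R.p₁ (O.s00 x y))) z := by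
  simp only [T31_apply, T000_apply, map_sub, hO.W3_000, hO.L1_20, R.d_h₁, hO.W1_00, map_add,
    AddMonoidHom.add_apply, AddMonoidHom.sub_apply, H2_apply]
  abel

theorem T31_100 (x y z) : - R.T31 (O.d₁ x) y z
    = R.T100 x y z + R.T010 y x z + O.m20 (R.i₂ (R.p₂ (O.s10 x y))) z := by
  linear_combination (norm := skip) hO.W3_100 x y z
  simp only [T31_apply, T100_apply, T010_apply, map_sub, R.i_p₂,
    eq_sub_of_add_eq (hO.W1_10 _ _), map_add,
    AddMonoidHom.add_apply, AddMonoidHom.sub_apply, H2_apply]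
  abel

theorem T31_010 (x y z) : - R.T31 x (O.d₁ y) z
    = R.T010 x y z + R.T100 y x z + O.m20 (R.i₂ (R.p₂ (O.s01 x y))) z := by
  linear_combination (norm := skip) hO.W3_010 x y z
  simp only [T31_apply, T100_apply, T010_apply, map_sub, R.i_p₂,
    eq_sub_of_add_eq (hO.W1_01 _ _), map_add,
    AddMonoidHom.add_apply, AddMonoidHom.sub_apply, H2_apply]
  abel

theorem T31_001 (x y z) : - R.T31 x y (O.d₁ z)
    = R.T001 x y z + R.T001 y x z + O.m11 (R.i₁ (R.p₁ (O.s00 x y))) z := by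
  linear_combination (norm := skip) hO.W3_001 x y z + hO.L1_21 (R.h₁ (O.s00 x y)) z
  simp only [T31_apply, T001_apply, map_sub, R.d_h₁, hO.W1_00, map_add,
    AddMonoidHom.add_apply, AddMonoidHom.sub_apply, H2_apply]
  abel

theorem d_T32 (x y z) : O.d₂ (R.T32 x y z)
    = R.T000 x y z + R.T000 x z y - O.m01 x (R.i₁ (R.p₁ (O.s00 y z)))
      + O.s00 (R.i₀ (R.p₀ (O.m00 x y))) z + O.s00 y (R.i₀ (R.p₀ (O.m00 x z))) := by
  simp only [T32_apply, T000_apply, map_sub, hO.W4_000, hO.L1_02, R.d_h₁, hO.W1_00, map_add,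
    eq_sub_of_add_eq (hO.W1_10 _ _), eq_sub_of_add_eq (hO.W1_01 _ _),
    AddMonoidHom.add_apply, AddMonoidHom.sub_apply, H2_apply, R.d_h₀]
  abel

theorem T32_100 (x y z) : - R.T32 (O.d₁ x) y z
    = R.T100 x y z + R.T100 x z y + O.m11 x (R.i₁ (R.p₁ (O.s00 y z)))
      + O.s10 (R.i₁ (R.p₁ (O.m10 x y))) z + O.s01 y (R.i₁ (R.p₁ (O.m10 x z))) := by
  linear_combination (norm := skip) hO.W4_100 x y z - hO.L1_12 x (R.h₁ (O.s00 y z))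
    + hO.W1_20 (R.h₁ (O.m10 x y)) z + hO.W1_02 y (R.h₁ (O.m10 x z))
  simp only [T32_apply, T100_apply, map_sub, R.d_h₁, R.H2_d hO, hO.W1_20, hO.W1_02, hO.W1_00,
    map_add, R.d_h₀, AddMonoidHom.add_apply, AddMonoidHom.sub_apply, H2_apply]
  abel

theorem T32_010 (x y z) : - R.T32 x (O.d₁ y) z
    = R.T010 x y z + R.T001 x z y - O.m02 x (R.i₂ (R.p₂ (O.s10 y z)))
      + O.s10 (R.i₁ (R.p₁ (O.m01 x y))) z + O.s10 y (R.i₀ (R.p₀ (O.m00 x z))) := by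
  linear_combination (norm := skip) hO.W4_010 x y z - hO.W1_11 y (R.H2 x z)
  simp only [T32_apply, T010_apply, T001_apply, map_sub, R.i_p₂, R.H2_d' hO, hO.W1_20,
    eq_sub_of_add_eq (hO.W1_10 _ _), map_add, R.d_h₀,
    AddMonoidHom.add_apply, AddMonoidHom.sub_apply, H2_apply]
  abel

theorem T32_001 (x y z) : - R.T32 x y (O.d₁ z)
    = R.T001 x y z + R.T010 x z y - O.m02 x (R.i₂ (R.p₂ (O.s01 y z)))
      + O.s01 (R.i₀ (R.p₀ (O.m00 x y))) z + O.s01 y (R.i₁ (R.p₁ (O.m01 x z))) := by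
  linear_combination (norm := skip) hO.W4_001 x y z + hO.W1_11 (R.H2 x y) z
  simp only [T32_apply, T010_apply, T001_apply, map_sub, R.i_p₂, R.H2_d' hO, hO.W1_02,
    eq_sub_of_add_eq (hO.W1_01 _ _), map_add, R.d_h₀,
    AddMonoidHom.add_apply, AddMonoidHom.sub_apply, H2_apply]
  abel

theorem T31_sub_swap (x y z) : R.T31 x y z - R.T31 y x z = O.m20 (R.i₂ (R.p₂ (O.r x y))) z := by
  linear_combination (norm := skip) hO.W6 x y z
  simp only [T31_apply, R.i_p₂, hO.W2_00, map_sub, AddMonoidHom.sub_apply]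
  abel

theorem T31_T32 (x y z) : R.T31 x y z - R.T32 y x z + R.T31 y z x - R.T32 x y z + R.T31 x z y
      - R.T32 z x y
    = O.s01 x (R.i₁ (R.p₁ (O.s00 y z))) + O.s10 (R.i₁ (R.p₁ (O.s00 x y))) z
      + O.s01 y (R.i₁ (R.p₁ (O.s00 x z))) + O.r y (R.i₀ (R.p₀ (O.m00 z x))) := by
  linear_combination (norm := skip) hO.W7 x y z - hO.W2_01 y (R.H2 z x)
    + hO.W1_02 x (R.h₁ (O.s00 y z)) + hO.W1_20 (R.h₁ (O.s00 x y)) z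
    + hO.W1_02 y (R.h₁ (O.s00 x z))
  simp only [T31_apply, T32_apply, R.d_h₀, R.d_h₁, map_sub, map_add, AddMonoidHom.sub_apply,
    AddMonoidHom.add_apply, hO.W1_02, hO.W1_20, hO.W1_00, H2_apply]
  abel

theorem T32_sub_swap (x y z) : R.T32 x y z - R.T32 x z y
    = - O.m02 x (R.i₂ (R.p₂ (O.r y z))) + O.r (R.i₀ (R.p₀ (O.m00 x y))) z
      + O.r y (R.i₀ (R.p₀ (O.m00 x z))) := by
  linear_combination (norm := skip) hO.W8 x y z - hO.W2_10 (R.H2 x y) z - hO.W2_01 y (R.H2 x z)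
  simp only [T32_apply, R.d_H2, R.i_p₂, hO.W2_00, map_sub, AddMonoidHom.sub_apply]
  abel

theorem T4_add_swap₁₂ (x y z w) : R.T4 x y z w + R.T4 y x z w
    = O.m20 (R.i₂ (R.p₂ (R.T31 x y z))) w - R.T31 x y (R.i₀ (R.p₀ (O.m00 z w)))
      + O.m02 z (R.i₂ (R.p₂ (R.T31 x y w))) + R.T100 (R.i₁ (R.p₁ (O.s00 x y))) z w := by
  linear_combination (norm := skip) hO.W9 x y z w + R.T31_001 hO x y (R.H2 z w)
    + hO.L2_200 (R.h₁ (O.s00 x y)) z w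
  simp only [R.d_H2, R.d_h₁, R.i_p₂, R.d_T31 hO, hO.W1_00, map_sub, AddMonoidHom.sub_apply,
    R.T100_d hO, map_add, AddMonoidHom.add_apply, ← H2_apply]
  simp only [T4_apply, T31_apply, T100_apply, T001_apply, R.d_h₁, R.i_p₂, hO.L1_20, map_sub,
    AddMonoidHom.sub_apply, map_add, AddMonoidHom.add_apply, H3_apply, H2_apply, hO.W1_00]
  abel

theorem T4_add_swap₂₃ (x y z w) : R.T4 x y z w + R.T4 x z y w
    = O.m20 (R.i₂ (R.p₂ (R.T32 x y z))) w - R.T010 x (R.i₁ (R.p₁ (O.s00 y z))) w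
      + O.m02 x (R.i₂ (R.p₂ (R.T31 y z w))) - R.T31 (R.i₀ (R.p₀ (O.m00 x y))) z w
      - R.T31 y (R.i₀ (R.p₀ (O.m00 x z))) w - R.T31 y z (R.i₀ (R.p₀ (O.m00 x w))) := by
  linear_combination (norm := skip) hO.W10 x y z w + R.T31_100 hO (R.H2 x y) z w
    + R.T31_010 hO y (R.H2 x z) w + R.T31_001 hO y z (R.H2 x w)
    - hO.L2_020 x (R.h₁ (O.s00 y z)) w
  simp only [R.d_H2, R.d_h₁, R.i_p₂, R.d_T31 hO, hO.W1_00, map_sub, AddMonoidHom.sub_apply,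
    R.T010_d hO, map_add, AddMonoidHom.add_apply, ← H2_apply]
  simp only [T4_apply, T31_apply, T32_apply, T100_apply, T010_apply, T001_apply, R.d_h₁, R.i_p₂,
    hO.L1_02, hO.W4_000, eq_sub_of_add_eq (hO.W1_10 _ _), eq_sub_of_add_eq (hO.W1_01 _ _), map_sub,
    AddMonoidHom.sub_apply, map_add, AddMonoidHom.add_apply, H3_apply, T000_apply, H2_apply,
    R.d_h₀, hO.W1_00]
  abel

theorem T4_add_swap₃₄ (x y z w) : R.T4 x y z w + R.T4 x y w z
    = O.s10 (R.i₁ (R.p₁ (R.T000 x y z))) w - R.T32 (R.i₀ (R.p₀ (O.m00 x y))) z w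
      + R.T32 x (R.i₀ (R.p₀ (O.m00 y z))) w - R.T32 y (R.i₀ (R.p₀ (O.m00 x z))) w
      + R.T001 x y (R.i₁ (R.p₁ (O.s00 z w))) + R.T32 x z (R.i₀ (R.p₀ (O.m00 y w)))
      - R.T32 y z (R.i₀ (R.p₀ (O.m00 x w))) + O.m02 x (R.i₂ (R.p₂ (R.T32 y z w)))
      - O.m02 y (R.i₂ (R.p₂ (R.T32 x z w))) + O.s01 z (R.i₁ (R.p₁ (R.T000 x y w))) := by
  linear_combination (norm := skip) hO.W11 x y z w + R.T32_100 hO (R.H2 x y) z w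
    - R.T32_010 hO x (R.H2 y z) w + R.T32_010 hO y (R.H2 x z) w
    - R.T32_001 hO x z (R.H2 y w) + R.T32_001 hO y z (R.H2 x w)
    + hO.L2_002 x y (R.h₁ (O.s00 z w)) + hO.W1_20 (R.h₁ (O.t000 x y z)) w
    + hO.W1_02 z (R.h₁ (O.t000 x y w))
    + hO.W1_11 (R.H2 x z) (R.H2 y w) - hO.W1_11 (R.H2 y z) (R.H2 x w)
  simp only [R.d_H2, R.d_h₁, R.d_H3 hO, R.i_p₂, R.d_T32 hO, hO.W1_00, map_sub,
    AddMonoidHom.sub_apply, map_add, AddMonoidHom.add_apply, ← H2_apply]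
  simp only [T4_apply, T32_apply, T010_apply, T001_apply, T100_apply, T000_apply, R.d_h₁, R.i_p₂,
    map_sub, AddMonoidHom.sub_apply, map_add, AddMonoidHom.add_apply, H3_apply, H2_apply,
    eq_sub_of_add_eq (hO.W1_10 _ _), eq_sub_of_add_eq (hO.W1_01 _ _),
    R.d_h₀, hO.W1_00, hO.L2_000, hO.W4_000, hO.L1_02]
  abel

set_option maxHeartbeats 4000000 in
theorem T4_jacobi (x y z w e) :
    0 = O.m20 (R.i₂ (R.p₂ (R.T4 x y z w))) e - O.m02 x (R.i₂ (R.p₂ (R.T4 y z w e)))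
      + O.m02 y (R.i₂ (R.p₂ (R.T4 x z w e))) - O.m02 z (R.i₂ (R.p₂ (R.T4 x y w e)))
      + O.m02 w (R.i₂ (R.p₂ (R.T4 x y z e))) + R.T100 (R.i₁ (R.p₁ (R.T000 x y z))) w e
      + R.T010 x (R.i₁ (R.p₁ (R.T000 y z w))) e - R.T010 y (R.i₁ (R.p₁ (R.T000 x z w))) e
      + R.T010 z (R.i₁ (R.p₁ (R.T000 x y w))) e + R.T001 x y (R.i₁ (R.p₁ (R.T000 z w e)))
      - R.T001 x z (R.i₁ (R.p₁ (R.T000 y w e))) + R.T001 y z (R.i₁ (R.p₁ (R.T000 x w e)))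
      + R.T001 x w (R.i₁ (R.p₁ (R.T000 y z e))) - R.T001 y w (R.i₁ (R.p₁ (R.T000 x z e)))
      + R.T001 z w (R.i₁ (R.p₁ (R.T000 x y e))) + R.T4 (R.i₀ (R.p₀ (O.m00 x y))) z w e
      - R.T4 x (R.i₀ (R.p₀ (O.m00 y z))) w e + R.T4 y (R.i₀ (R.p₀ (O.m00 x z))) w e
      + R.T4 x y (R.i₀ (R.p₀ (O.m00 z w))) e - R.T4 x z (R.i₀ (R.p₀ (O.m00 y w))) e
      + R.T4 y z (R.i₀ (R.p₀ (O.m00 x w))) e - R.T4 x y z (R.i₀ (R.p₀ (O.m00 w e)))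
      + R.T4 x y w (R.i₀ (R.p₀ (O.m00 z e))) - R.T4 x z w (R.i₀ (R.p₀ (O.m00 y e)))
      + R.T4 y z w (R.i₀ (R.p₀ (O.m00 x e))) := by
  linear_combination (norm := skip) hO.L4 x y z w e - hO.L1_12 (R.H2 x w) (R.H3 y z e)
    - hO.L1_12 (R.H2 x y) (R.H3 z w e) + hO.L1_12 (R.H2 x z) (R.H3 y w e)
    + hO.L1_12 (R.H2 y w) (R.H3 x z e) - hO.L1_12 (R.H2 y z) (R.H3 x w e)
    - hO.L1_12 (R.H2 z w) (R.H3 x y e) - hO.L1_21 (R.H3 x y w) (R.H2 z e)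
    + hO.L1_21 (R.H3 x y z) (R.H2 w e) + hO.L1_21 (R.H3 x z w) (R.H2 y e)
    - hO.L1_21 (R.H3 y z w) (R.H2 x e) + hO.L2_002 x w (R.H3 y z e) + hO.L2_002 x y (R.H3 z w e)
    - hO.L2_002 x z (R.H3 y w e) - hO.L2_002 y w (R.H3 x z e) + hO.L2_002 y z (R.H3 x w e)
    + hO.L2_002 z w (R.H3 x y e) - hO.L2_011 x (R.H2 y w) (R.H2 z e)
    + hO.L2_011 x (R.H2 y z) (R.H2 w e) + hO.L2_011 x (R.H2 z w) (R.H2 y e)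
    + hO.L2_011 y (R.H2 x w) (R.H2 z e) - hO.L2_011 y (R.H2 x z) (R.H2 w e)
    - hO.L2_011 y (R.H2 z w) (R.H2 x e) - hO.L2_011 z (R.H2 x w) (R.H2 y e)
    + hO.L2_011 z (R.H2 y w) (R.H2 x e) + hO.L2_020 x (R.H3 y z w) e - hO.L2_020 y (R.H3 x z w) e
    + hO.L2_020 z (R.H3 x y w) e + hO.L2_101 (R.H2 x y) w (R.H2 z e)
    - hO.L2_101 (R.H2 x y) z (R.H2 w e) - hO.L2_101 (R.H2 x z) w (R.H2 y e)
    + hO.L2_101 (R.H2 y z) w (R.H2 x e) + hO.L2_110 (R.H2 x y) (R.H2 z w) e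
    - hO.L2_110 (R.H2 x z) (R.H2 y w) e + hO.L2_110 (R.H2 y z) (R.H2 x w) e
    + hO.L2_200 (R.H3 x y z) w e - hO.L3_0001 x y w (R.H2 z e) + hO.L3_0001 x y z (R.H2 w e)
    + hO.L3_0001 x z w (R.H2 y e) - hO.L3_0001 y z w (R.H2 x e) - hO.L3_0010 x y (R.H2 z w) e
    + hO.L3_0010 x z (R.H2 y w) e - hO.L3_0010 y z (R.H2 x w) e + hO.L3_0100 x (R.H2 y z) w e
    - hO.L3_0100 y (R.H2 x z) w e - hO.L3_1000 (R.H2 x y) z w e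
  simp only [R.i_p_T4 hO, R.d_H2, R.d_H3 hO, T100_apply, T010_apply, T001_apply, map_add, map_sub,
    AddMonoidHom.add_apply, AddMonoidHom.sub_apply]
  generalize R.i₁ (R.p₁ (R.T000 x y z)) = a₀, R.i₁ (R.p₁ (R.T000 y z w)) = a₁,
    R.i₁ (R.p₁ (R.T000 x z w)) = a₂, R.i₁ (R.p₁ (R.T000 x y w)) = a₃,
    R.i₁ (R.p₁ (R.T000 z w e)) = a₄, R.i₁ (R.p₁ (R.T000 y w e)) = a₅,
    R.i₁ (R.p₁ (R.T000 x w e)) = a₆, R.i₁ (R.p₁ (R.T000 y z e)) = a₇,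
    R.i₁ (R.p₁ (R.T000 x z e)) = a₈, R.i₁ (R.p₁ (R.T000 x y e)) = a₉
  simp only [T4_apply, T000_apply, map_add, map_sub, AddMonoidHom.add_apply,
    AddMonoidHom.sub_apply]
  abel

/-- The transferred structure is again a weak Lie 3-algebra, in components. -/
theorem transfer_eqs : R.transfer.Eqs := by
  constructor <;> intros <;>
    simp only [transfer, hom₂_apply, hom₃_apply, hom₄_apply, R.e_p₁, R.e_p₂, R.i_e₁, R.i_e₂,
      ← map_add R.p₀, ← map_sub R.p₀, ← map_add R.p₁, ← map_sub R.p₁, ← map_add R.p₂,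
      ← map_sub R.p₂, ← map_neg R.p₂]
  · exact congrArg _ (hO.L1_10 _ _)
  · exact congrArg _ (hO.L1_01 _ _)
  · exact congrArg _ (hO.L1_20 _ _)
  · exact congrArg _ (hO.L1_11 _ _)
  · exact congrArg _ (hO.L1_02 _ _)
  · rw [hO.L1_21 _ _, map_zero]
  · rw [hO.L1_12 _ _, map_zero]
  · exact congrArg _ (R.d_T000 hO _ _ _)
  · exact congrArg _ (R.d_T100 hO _ _ _)
  · exact congrArg _ (R.d_T010 hO _ _ _)
  · exact congrArg _ (R.d_T001 hO _ _ _)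
  · exact congrArg _ (R.T100_d hO _ _ _)
  · exact congrArg _ (R.T010_d hO _ _ _)
  · exact congrArg _ (R.T001_d hO _ _ _)
  · exact congrArg _ (R.T_110 hO _ _ _)
  · exact congrArg _ (R.T_101 hO _ _ _)
  · exact congrArg _ (R.T_011 hO _ _ _)
  · exact congrArg _ (R.d_T4 hO _ _ _ _)
  · exact congrArg _ (R.T4_1000 hO _ _ _ _)
  · exact congrArg _ (R.T4_0100 hO _ _ _ _)
  · exact congrArg _ (R.T4_0010 hO _ _ _ _)
  · exact congrArg _ (R.T4_0001 hO _ _ _ _)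
  · rw [← R.T4_jacobi hO _ _ _ _ _, map_zero]
  · exact congrArg _ (hO.W1_00 _ _)
  · exact congrArg _ (hO.W1_10 _ _)
  · exact congrArg _ (hO.W1_01 _ _)
  · exact congrArg _ (hO.W1_20 _ _)
  · exact congrArg _ (hO.W1_11 _ _)
  · exact congrArg _ (hO.W1_02 _ _)
  · exact congrArg _ (hO.W2_00 _ _)
  · exact congrArg _ (hO.W2_10 _ _)
  · exact congrArg _ (hO.W2_01 _ _)
  · exact congrArg _ (R.d_T31 hO _ _ _)
  · exact congrArg _ (R.T31_100 hO _ _ _)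
  · exact congrArg _ (R.T31_010 hO _ _ _)
  · exact congrArg _ (R.T31_001 hO _ _ _)
  · exact congrArg _ (R.d_T32 hO _ _ _)
  · exact congrArg _ (R.T32_100 hO _ _ _)
  · exact congrArg _ (R.T32_010 hO _ _ _)
  · exact congrArg _ (R.T32_001 hO _ _ _)
  · rw [hO.W5 _ _, map_zero]
  · exact congrArg _ (R.T31_sub_swap hO _ _ _)
  · exact congrArg _ (R.T31_T32 hO _ _ _)
  · exact congrArg _ (R.T32_sub_swap hO _ _ _)
  · exact congrArg _ (R.T4_add_swap₁₂ hO _ _ _ _)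
  · exact congrArg _ (R.T4_add_swap₂₃ hO _ _ _ _)
  · exact congrArg _ (R.T4_add_swap₃₄ hO _ _ _ _)

end Retract

end Ops

section Multilinear

/-- Multilinearity of a function of `m` arguments in the product of the graded pieces. -/
def IsMultiadditive (k : Type) [CommRing k] {V W : Type} [AddCommGroup V] [AddCommGroup W]
    [Module k V] [Module k W] {m : ℕ} (F : (Fin m → V) → W) : Prop :=
  ∀ (X : Fin m → V) (j : Fin m),
    (∀ Y Z, F (Function.update X j (Y + Z))
      = F (Function.update X j Y) + F (Function.update X j Z)) ∧
    ∀ (c : k) Y, F (Function.update X j (c • Y)) = c • F (Function.update X j Y)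

theorem update_comp_of_forall_ne {V W : Type} {m n : ℕ} (F : (Fin n → V) → W)
    (e : Fin n → Fin m) {j : Fin m} (h : ∀ i, e i ≠ j) (X : Fin m → V) (Y : V) :
    F (fun i => Function.update X j Y (e i)) = F (fun i => X (e i)) :=
  congrArg F (funext fun i => Function.update_of_ne (h i) _ _)

variable {k : Type} [CommRing k]

namespace IsMultiadditive

variable {V W U : Type} [AddCommGroup V] [AddCommGroup W] [AddCommGroup U]
  [Module k V] [Module k W] [Module k U] {m n : ℕ}

theorem map_eq_zero {F : (Fin m → V) → W} (hF : IsMultiadditive k F) {X : Fin m → V}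
    (j : Fin m) (hX : X j = 0) : F X = 0 := by
  have h := (hF X j).2 0 0
  rwa [zero_smul, zero_smul, ← hX, Function.update_eq_self] at h

theorem zsmul {F : (Fin m → V) → W} (hF : IsMultiadditive k F) (c : ℤ) :
    IsMultiadditive k fun X => c • F X :=
  fun X j => ⟨fun Y Z => by simp only [(hF X j).1, smul_add],
    fun a Y => by simp only [(hF X j).2, smul_comm c a]⟩

/-- Substituting functions of disjoint blocks of variables into a multilinear function. -/
theorem comp {G : (Fin n → W) → U} (hG : IsMultiadditive k G) {g : Fin n → (Fin m → V) → W}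
    (hg : ∀ j, ∃ t, (∀ s, s ≠ t → ∀ X Y, g s (Function.update X j Y) = g s X) ∧ ∀ X,
      (∀ Y Z, g t (Function.update X j (Y + Z))
        = g t (Function.update X j Y) + g t (Function.update X j Z)) ∧
      ∀ (c : k) Y, g t (Function.update X j (c • Y)) = c • g t (Function.update X j Y)) :
    IsMultiadditive k fun X => G fun t => g t X := by
  intro X j
  obtain ⟨t, h₁, h₂⟩ := hg j
  have key : ∀ Y, (fun s => g s (Function.update X j Y))
      = Function.update (fun s => g s X) t (g t (Function.update X j Y)) := by
    intro Y
    ext s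
    by_cases hs : s = t
    · subst hs; rw [Function.update_self]
    · rw [Function.update_of_ne hs, h₁ s hs]
  simp only [key, (h₂ X).1, (h₂ X).2, (hG _ t).1, (hG _ t).2, implies_true, and_self]

/-- The block condition of `IsMultiadditive.comp` for a block of variables `e`. -/
theorem of_block {F : (Fin n → V) → W} (hF : IsMultiadditive k F) {e : Fin n → Fin m}
    (he : Function.Injective e) (j : Fin n) (X : Fin m → V) :
    (∀ Y Z, F (fun i => Function.update X (e j) (Y + Z) (e i))
        = F (fun i => Function.update X (e j) Y (e i))
          + F (fun i => Function.update X (e j) Z (e i))) ∧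
      ∀ (c : k) Y, F (fun i => Function.update X (e j) (c • Y) (e i))
        = c • F (fun i => Function.update X (e j) Y (e i)) := by
  have key : ∀ Y, (fun i => Function.update X (e j) Y (e i))
      = Function.update (fun i => X (e i)) j Y := fun Y =>
    Function.update_comp_eq_of_injective X he j Y
  simp only [key, (hF _ j).1, (hF _ j).2, implies_true, and_self]

end IsMultiadditive

variable {L M N : ℤ → Type} [∀ i, AddCommGroup (L i)] [∀ i, AddCommGroup (M i)]
  [∀ i, AddCommGroup (N i)] [∀ i, Module k (L i)] [∀ i, Module k (M i)] [∀ i, Module k (N i)]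

theorem incl_smul (i : ℤ) (c : k) (x : L i) : incl i (c • x) = c • incl i x :=
  Pi.single_smul i c x

theorem isMultilinear_iff {m : ℕ} {r : ℤ} {μ : MMap L M m r} :
    IsMultilinear k μ ↔ ∀ d, IsMultiadditive k (ev μ d) := by
  have key : ∀ (d : Fin m → ℤ) (X : Fin m → ∀ i, L i) (j : Fin m) (Y : ∀ i, L i),
      (fun t => Function.update X j Y t (d t))
        = Function.update (fun t => X t (d t)) j (Y (d j)) := by
    intro d X j Y
    ext t
    by_cases h : t = j
    · subst h; simp
    · simp [h]
  constructor
  · intro h d X j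
    have := h d (fun t => X t (d t)) j
    simp only [ev, key, Pi.add_apply, Pi.smul_apply, this.1, this.2, map_add, incl_smul,
      implies_true, and_self]
  · intro h d x j
    have h' := h d (fun t => incl (d t) (x t)) j
    simp only [ev, key, incl_apply_self, Pi.add_apply, Pi.smul_apply, ← map_add,
      ← incl_smul] at h'
    refine ⟨fun a b => incl_injective _ ?_, fun c a => incl_injective _ ?_⟩
    · simpa using h'.1 (incl _ a) (incl _ b)
    · simpa using h'.2 c (incl _ a)

namespace IsMultilinear

variable {m : ℕ} {r : ℤ} {μ ν : MMap L M m r}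

theorem add (hμ : IsMultilinear k μ) (hν : IsMultilinear k ν) : IsMultilinear k (μ + ν) :=
  fun d x j => ⟨fun a b => by
      simp only [Pi.add_apply, (hμ d x j).1, (hν d x j).1]; abel,
    fun c a => by simp only [Pi.add_apply, (hμ d x j).2, (hν d x j).2, smul_add]⟩

theorem zsmul (hμ : IsMultilinear k μ) (c : ℤ) : IsMultilinear k (c • μ) :=
  fun d x j => ⟨fun a b => by simp only [Pi.smul_apply, (hμ d x j).1, smul_add],
    fun a b => by simp only [Pi.smul_apply, (hμ d x j).2, smul_comm c a]⟩

theorem neg (hμ : IsMultilinear k μ) : IsMultilinear k (-μ) := by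
  simpa using hμ.zsmul (-1)

theorem sub (hμ : IsMultilinear k μ) (hν : IsMultilinear k ν) : IsMultilinear k (μ - ν) := by
  simpa only [sub_eq_add_neg] using hμ.add hν.neg

theorem zero : IsMultilinear k (0 : MMap L M m r) :=
  fun d x j => ⟨fun a b => by simp, fun a b => by simp⟩

theorem sum {ι : Type} (s : Finset ι) (f : ι → MMap L M m r)
    (hf : ∀ t, IsMultilinear k (f t)) : IsMultilinear k (∑ t ∈ s, f t) := by
  classical
  induction s using Finset.induction_on with
  | empty => simpa using zero
  | insert a s ha ih => rw [Finset.sum_insert ha]; exact (hf a).add ih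

theorem mcast {m' : ℕ} {r' : ℤ} (hμ : IsMultilinear k μ) (hm : m = m') (hr : r = r') :
    IsMultilinear k (WL3.mcast hm hr μ) := by
  subst hm hr; exact hμ

theorem pa (hμ : IsMultilinear k μ) (σ : Equiv.Perm (Fin m)) :
    IsMultilinear k (WL3.pa σ μ) := by
  rw [isMultilinear_iff] at hμ ⊢
  intro d
  have : ev (WL3.pa σ μ) d = fun X => koszulSign d σ •
      ev μ (fun j => d (σ.symm j)) (fun j => X (σ.symm j)) := funext (ev_pa μ d · σ)
  rw [this]
  refine ((hμ _).comp (g := fun t X => X (σ.symm t)) fun j => ⟨σ j, ?_, ?_⟩).zsmul _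
  · intro s hs X Y
    exact Function.update_of_ne (fun h => hs (by rw [← h, Equiv.apply_symm_apply])) _ _
  · intro X; simp

theorem pcomp (m₁ m₂ : ℕ) {n : ℕ} {s : ℤ} {μ : MMap L M (m₁ + 1 + m₂) r} {ν : MMap L L n s}
    (hμ : IsMultilinear k μ) (hν : IsMultilinear k ν) :
    IsMultilinear k (WL3.pcomp m₁ m₂ μ ν) := by
  rw [isMultilinear_iff] at hμ hν ⊢
  intro d
  rw [show ev (WL3.pcomp m₁ m₂ μ ν) d = _ from funext (ev_pcomp m₁ m₂ μ ν d)]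
  refine ((hμ _).comp (g := fun t X => Fin.append (Fin.append
      (fun j => X (Fin.castAdd m₂ (Fin.castAdd n j)))
      (fun _ => ev ν (fun j => d (Fin.castAdd m₂ (Fin.natAdd m₁ j)))
        (fun j => X (Fin.castAdd m₂ (Fin.natAdd m₁ j)))))
      (fun j => X (Fin.natAdd (m₁ + n) j)) t) ?_).zsmul _
  intro j
  induction j using Fin.addCases with
  | left j =>
    induction j using Fin.addCases with
    | left j =>
      refine ⟨Fin.castAdd m₂ (Fin.castAdd 1 j), ?_, fun X => by simp⟩
      intro t ht X Y
      induction t using Fin.addCases with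
      | left t =>
        induction t using Fin.addCases with
        | left t => simp_all [Function.update_apply, Fin.ext_iff]
        | right t =>
          simp only [Fin.append_left, Fin.append_right]
          congr 1
          ext i : 1
          refine Function.update_of_ne ?_ _ _
          simp [Fin.ext_iff]; omega
      | right t =>
        simp only [Fin.append_right]
        refine Function.update_of_ne ?_ _ _
        simp [Fin.ext_iff]; omega
    | right j =>
      refine ⟨Fin.castAdd m₂ (Fin.natAdd m₁ 0), ?_, fun X => ?_⟩
      · intro t ht X Y
        induction t using Fin.addCases with
        | left t =>
          induction t using Fin.addCases with
          | left t =>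
            simp only [Fin.append_left]
            refine Function.update_of_ne ?_ _ _
            simp [Fin.ext_iff]; omega
          | right t => exact absurd (by rw [Subsingleton.elim t 0]) ht
        | right t =>
          simp only [Fin.append_right]
          refine Function.update_of_ne ?_ _ _
          simp [Fin.ext_iff]; omega
      · simp only [Fin.append_left, Fin.append_right]
        exact (hν _).of_block (e := fun j => Fin.castAdd m₂ (Fin.natAdd m₁ j))
          (fun a b hab => by simpa [Fin.ext_iff] using hab) j X
  | right j =>
    refine ⟨Fin.natAdd (m₁ + 1) j, ?_, fun X => by simp⟩
    intro t ht X Y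
    induction t using Fin.addCases with
    | left t =>
      induction t using Fin.addCases with
      | left t =>
        simp only [Fin.append_left]
        refine Function.update_of_ne ?_ _ _
        simp [Fin.ext_iff]; omega
      | right t =>
        simp only [Fin.append_left, Fin.append_right]
        congr 1
        ext i : 1
        refine Function.update_of_ne ?_ _ _
        simp [Fin.ext_iff]; omega
    | right t => simp_all [Function.update_apply, Fin.ext_iff]

theorem pc {R : ℤ} (m₁ m₂ : ℕ) {n : ℕ} {s : ℤ} {μ : MMap L M (m₁ + 1 + m₂) r}
    {ν : MMap L L n s} (hμ : IsMultilinear k μ) (hν : IsMultilinear k ν) (h : r + s = R) :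
    IsMultilinear k (WL3.pc R m₁ m₂ μ ν h) :=
  (pcomp m₁ m₂ hμ hν).mcast rfl h

theorem fc1 {R : ℤ} {a : ℕ} {s : ℤ} {μ : MMap M N 1 r} {g : MMap L M a s}
    (hμ : IsMultilinear k μ) (hg : IsMultilinear k g) (h : r + s = R) :
    IsMultilinear k (WL3.fc1 R μ g h) := by
  rw [isMultilinear_iff] at hμ hg ⊢
  intro d
  rw [show ev (WL3.fc1 R μ g h) d = _ from funext (ev_fc1 μ g h d)]
  have := (hμ ![s + ∑ j, d j]).comp (g := ![ev g d]) fun j => ⟨0, fun s hs => absurd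
    (Subsingleton.elim s 0) hs, fun X => hg d X j⟩
  convert this using 3 with X
  ext t : 1
  fin_cases t; rfl

theorem fc2 {R : ℤ} {a b : ℕ} {s₁ s₂ : ℤ} {μ : MMap M N 2 r} {g₁ : MMap L M a s₁}
    {g₂ : MMap L M b s₂} (hμ : IsMultilinear k μ) (h₁ : IsMultilinear k g₁)
    (h₂ : IsMultilinear k g₂) (h : r + (s₁ + s₂) = R) :
    IsMultilinear k (WL3.fc2 R μ g₁ g₂ h) := by
  rw [isMultilinear_iff] at hμ h₁ h₂ ⊢
  intro d
  rw [show ev (WL3.fc2 R μ g₁ g₂ h) d = _ from funext (ev_fc2 μ g₁ g₂ h d)]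
  refine IsMultiadditive.zsmul ?_ _
  convert (hμ _).comp (g := ![fun X : Fin (a + b) → ∀ i, L i =>
      ev g₁ (fun j => d (Fin.castAdd b j)) (fun j => X (Fin.castAdd b j)),
    fun X => ev g₂ (fun j => d (Fin.natAdd a j)) (fun j => X (Fin.natAdd a j))]) ?_ using 3 with X
  · ext t : 1; fin_cases t <;> rfl
  intro j
  induction j using Fin.addCases with
  | left j =>
    refine ⟨0, fun s hs X Y => ?_, fun X => (h₁ _).of_block (Fin.castAdd_injective a b) j X⟩
    fin_cases s
    · exact absurd rfl hs
    · exact update_comp_of_forall_ne (ev g₂ _) (Fin.natAdd a)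
        (fun i => by simp [Fin.ext_iff]; omega) _ _
  | right j =>
    refine ⟨1, fun s hs X Y => ?_, fun X => (h₂ _).of_block (Fin.natAdd_injective b a) j X⟩
    fin_cases s
    · exact update_comp_of_forall_ne (ev g₁ _) (Fin.castAdd b)
        (fun i => by simp [Fin.ext_iff]; omega) _ _
    · exact absurd rfl hs

theorem fc3 {R : ℤ} {s₁ s₂ s₃ : ℤ} {μ : MMap M N 3 r} {g₁ : MMap L M 1 s₁}
    {g₂ : MMap L M 1 s₂} {g₃ : MMap L M 1 s₃} (hμ : IsMultilinear k μ)
    (h₁ : IsMultilinear k g₁) (h₂ : IsMultilinear k g₂) (h₃ : IsMultilinear k g₃)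
    (h : r + (s₁ + s₂ + s₃) = R) : IsMultilinear k (WL3.fc3 R μ g₁ g₂ g₃ h) := by
  rw [isMultilinear_iff] at hμ h₁ h₂ h₃ ⊢
  intro d
  rw [show ev (WL3.fc3 R μ g₁ g₂ g₃ h) d = _ from funext (ev_fc3 μ g₁ g₂ g₃ h d)]
  refine IsMultiadditive.zsmul ?_ _
  convert (hμ _).comp (g := ![fun X : Fin 3 → ∀ i, L i => ev g₁ (fun j => d (Fin.castAdd 1 (Fin.castAdd 1 j))) (fun j => X (Fin.castAdd 1 (Fin.castAdd 1 j))),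
    fun X => ev g₂ (fun j => d (Fin.castAdd 1 (Fin.natAdd 1 j))) (fun j => X (Fin.castAdd 1 (Fin.natAdd 1 j))),
    fun X => ev g₃ (fun j => d (Fin.natAdd 2 j)) (fun j => X (Fin.natAdd 2 j))]) ?_ using 3 with X
  · ext t : 1; fin_cases t <;> rfl
  intro j
  fin_cases j
  · refine ⟨0, fun s hs X Y => ?_, fun X => (h₁ _).of_block
      (e := fun j : Fin 1 => Fin.castAdd 1 (Fin.castAdd 1 j)) (fun i j _ => Subsingleton.elim i j) 0 X⟩
    fin_cases s <;> first
      | exact absurd rfl hs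
      | exact update_comp_of_forall_ne (ev _ _) (fun j : Fin 1 => _) (by decide) _ _
  · refine ⟨1, fun s hs X Y => ?_, fun X => (h₂ _).of_block
      (e := fun j : Fin 1 => Fin.castAdd 1 (Fin.natAdd 1 j)) (fun i j _ => Subsingleton.elim i j) 0 X⟩
    fin_cases s <;> first
      | exact absurd rfl hs
      | exact update_comp_of_forall_ne (ev _ _) (fun j : Fin 1 => _) (by decide) _ _
  · refine ⟨2, fun s hs X Y => ?_, fun X => (h₃ _).of_block
      (e := fun j : Fin 1 => Fin.natAdd 2 j) (fun i j _ => Subsingleton.elim i j) 0 X⟩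
    fin_cases s <;> first
      | exact absurd rfl hs
      | exact update_comp_of_forall_ne (ev _ _) (fun j : Fin 1 => _) (by decide) _ _

theorem fc4 {R : ℤ} {s₁ s₂ s₃ s₄ : ℤ} {μ : MMap M N 4 r} {g₁ : MMap L M 1 s₁}
    {g₂ : MMap L M 1 s₂} {g₃ : MMap L M 1 s₃} {g₄ : MMap L M 1 s₄} (hμ : IsMultilinear k μ)
    (h₁ : IsMultilinear k g₁) (h₂ : IsMultilinear k g₂) (h₃ : IsMultilinear k g₃)
    (h₄ : IsMultilinear k g₄) (h : r + (s₁ + s₂ + s₃ + s₄) = R) :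
    IsMultilinear k (WL3.fc4 R μ g₁ g₂ g₃ g₄ h) := by
  rw [isMultilinear_iff] at hμ h₁ h₂ h₃ h₄ ⊢
  intro d
  rw [show ev (WL3.fc4 R μ g₁ g₂ g₃ g₄ h) d = _ from funext (ev_fc4 μ g₁ g₂ g₃ g₄ h d)]
  refine IsMultiadditive.zsmul ?_ _
  convert (hμ _).comp (g := ![fun X : Fin 4 → ∀ i, L i => ev g₁ (fun j => d (Fin.castAdd 1 (Fin.castAdd 1 (Fin.castAdd 1 j)))) (fun j => X (Fin.castAdd 1 (Fin.castAdd 1 (Fin.castAdd 1 j)))),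
    fun X => ev g₂ (fun j => d (Fin.castAdd 1 (Fin.castAdd 1 (Fin.natAdd 1 j)))) (fun j => X (Fin.castAdd 1 (Fin.castAdd 1 (Fin.natAdd 1 j)))),
    fun X => ev g₃ (fun j => d (Fin.castAdd 1 (Fin.natAdd 2 j))) (fun j => X (Fin.castAdd 1 (Fin.natAdd 2 j))),
    fun X => ev g₄ (fun j => d (Fin.natAdd 3 j)) (fun j => X (Fin.natAdd 3 j))]) ?_ using 3 with X
  · ext t : 1; fin_cases t <;> rfl
  intro j
  fin_cases j
  · refine ⟨0, fun s hs X Y => ?_, fun X => (h₁ _).of_block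
      (e := fun j : Fin 1 => Fin.castAdd 1 (Fin.castAdd 1 (Fin.castAdd 1 j))) (fun i j _ => Subsingleton.elim i j) 0 X⟩
    fin_cases s <;> first
      | exact absurd rfl hs
      | exact update_comp_of_forall_ne (ev _ _) (fun j : Fin 1 => _) (by decide) _ _
  · refine ⟨1, fun s hs X Y => ?_, fun X => (h₂ _).of_block
      (e := fun j : Fin 1 => Fin.castAdd 1 (Fin.castAdd 1 (Fin.natAdd 1 j))) (fun i j _ => Subsingleton.elim i j) 0 X⟩
    fin_cases s <;> first
      | exact absurd rfl hs
      | exact update_comp_of_forall_ne (ev _ _) (fun j : Fin 1 => _) (by decide) _ _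
  · refine ⟨2, fun s hs X Y => ?_, fun X => (h₃ _).of_block
      (e := fun j : Fin 1 => Fin.castAdd 1 (Fin.natAdd 2 j)) (fun i j _ => Subsingleton.elim i j) 0 X⟩
    fin_cases s <;> first
      | exact absurd rfl hs
      | exact update_comp_of_forall_ne (ev _ _) (fun j : Fin 1 => _) (by decide) _ _
  · refine ⟨3, fun s hs X Y => ?_, fun X => (h₄ _).of_block
      (e := fun j : Fin 1 => Fin.natAdd 3 j) (fun i j _ => Subsingleton.elim i j) 0 X⟩
    fin_cases s <;> first
      | exact absurd rfl hs
      | exact update_comp_of_forall_ne (ev _ _) (fun j : Fin 1 => _) (by decide) _ _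

theorem bd {R : ℤ} {D' : MMap M M 1 (-1)} {D : MMap L L 1 (-1)} (hD' : IsMultilinear k D')
    (hD : IsMultilinear k D) (hμ : IsMultilinear k μ) (h : -1 + r = R) :
    IsMultilinear k (WL3.bd R D' D μ h) := by
  refine IsMultilinear.mcast (IsMultilinear.sub (hD'.fc1 hμ rfl) (IsMultilinear.zsmul
    (IsMultilinear.sum _ _ fun p => IsMultilinear.mcast ?_ _ _) _)) rfl h
  exact pcomp _ _ (hμ.mcast _ _) hD

/-- Two multilinear maps agree if they agree on homogeneous elements of degrees in `{0, 1, 2}`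
whose value has degree in `{0, 1, 2}`. -/
theorem ext_of_bounded (hL : ∀ i : ℤ, (i < 0 ∨ 2 < i) → ∀ x : L i, x = 0)
    (hM : ∀ i : ℤ, (i < 0 ∨ 2 < i) → ∀ x : M i, x = 0)
    (hμ : IsMultilinear k μ) (hν : IsMultilinear k ν)
    (h : ∀ d : Fin m → ℤ, (∀ j, 0 ≤ d j ∧ d j ≤ 2) → 0 ≤ r + ∑ j, d j → r + ∑ j, d j ≤ 2 →
      ∀ x : ∀ j, L (d j),
        ev μ d (fun j => incl (d j) (x j)) = ev ν d (fun j => incl (d j) (x j))) : μ = ν := by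
  have hz : ∀ {μ : MMap L M m r}, IsMultilinear k μ → ∀ d (x : ∀ j, L (d j)) j, x j = 0 →
      μ d x = 0 := by
    intro μ hμ d x j hx
    have h := (hμ d x j).2 0 0
    rwa [zero_smul, zero_smul, ← hx, Function.update_eq_self] at h
  funext d x
  by_cases hd : ∀ j, 0 ≤ d j ∧ d j ≤ 2
  · by_cases hr : 0 ≤ r + ∑ j, d j ∧ r + ∑ j, d j ≤ 2
    · have := incl_injective _ (h d hd hr.1 hr.2 x)
      simpa using this
    · have hr' : r + ∑ j, d j < 0 ∨ 2 < r + ∑ j, d j := by omega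
      rw [hM _ hr' (μ d x), hM _ hr' (ν d x)]
  · push Not at hd
    obtain ⟨j, hj⟩ := hd
    have := hL (d j) (by by_contra; omega) (x j)
    rw [hz hμ d x j this, hz hν d x j this]

end IsMultilinear

end Multilinear

section Concrete

variable {L M : ℤ → Type} [∀ i, AddCommGroup (M i)]

theorem ev_pa_eq {m : ℕ} {r : ℤ} (μ : MMap L M m r) {d d' : Fin m → ℤ}
    {X X' : Fin m → ∀ i, L i} {σ : Equiv.Perm (Fin m)}
    (hd : ∀ j, d (σ.symm j) = d' j := by intro j; fin_cases j <;> rfl)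
    (hX : ∀ j, X (σ.symm j) = X' j := by intro j; fin_cases j <;> rfl) : ev (pa σ μ) d X = koszulSign d σ • ev μ d' X' := by
  rw [ev_pa, funext hd, funext hX]

section Permutations

variable {r : ℤ} {a b c e f : ℤ} {X Y Z W T : ∀ i, L i}

theorem ev_P12_2 (μ : MMap L M 2 r) : ev (pa (P12 2) μ) ![a, b] ![X, Y]
    = koszulSign ![a, b] (P12 2) • ev μ ![b, a] ![Y, X] :=
  ev_pa_eq μ

theorem ev_P12_3 (μ : MMap L M 3 r) : ev (pa (P12 3) μ) ![a, b, c] ![X, Y, Z]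
    = koszulSign ![a, b, c] (P12 3) • ev μ ![b, a, c] ![Y, X, Z] :=
  ev_pa_eq μ

theorem ev_P12_4 (μ : MMap L M 4 r) : ev (pa (P12 4) μ) ![a, b, c, e] ![X, Y, Z, W]
    = koszulSign ![a, b, c, e] (P12 4) • ev μ ![b, a, c, e] ![Y, X, Z, W] :=
  ev_pa_eq μ

theorem ev_P12_5 (μ : MMap L M 5 r) : ev (pa (P12 5) μ) ![a, b, c, e, f] ![X, Y, Z, W, T]
    = koszulSign ![a, b, c, e, f] (P12 5) • ev μ ![b, a, c, e, f] ![Y, X, Z, W, T] :=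
  ev_pa_eq μ

theorem ev_P23_3 (μ : MMap L M 3 r) : ev (pa (P23 3) μ) ![a, b, c] ![X, Y, Z]
    = koszulSign ![a, b, c] (P23 3) • ev μ ![a, c, b] ![X, Z, Y] :=
  ev_pa_eq μ

theorem ev_P23_4 (μ : MMap L M 4 r) : ev (pa (P23 4) μ) ![a, b, c, e] ![X, Y, Z, W]
    = koszulSign ![a, b, c, e] (P23 4) • ev μ ![a, c, b, e] ![X, Z, Y, W] :=
  ev_pa_eq μ

theorem ev_P23_5 (μ : MMap L M 5 r) : ev (pa (P23 5) μ) ![a, b, c, e, f] ![X, Y, Z, W, T]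
    = koszulSign ![a, b, c, e, f] (P23 5) • ev μ ![a, c, b, e, f] ![X, Z, Y, W, T] :=
  ev_pa_eq μ

theorem ev_P34_4 (μ : MMap L M 4 r) : ev (pa (P34 4) μ) ![a, b, c, e] ![X, Y, Z, W]
    = koszulSign ![a, b, c, e] (P34 4) • ev μ ![a, b, e, c] ![X, Y, W, Z] :=
  ev_pa_eq μ

theorem ev_P34_5 (μ : MMap L M 5 r) : ev (pa (P34 5) μ) ![a, b, c, e, f] ![X, Y, Z, W, T]
    = koszulSign ![a, b, c, e, f] (P34 5) • ev μ ![a, b, e, c, f] ![X, Y, W, Z, T] :=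
  ev_pa_eq μ

theorem ev_P123_3 (μ : MMap L M 3 r) : ev (pa (P123 3) μ) ![a, b, c] ![X, Y, Z]
    = koszulSign ![a, b, c] (P123 3) • ev μ ![c, a, b] ![Z, X, Y] :=
  ev_pa_eq μ

theorem ev_P123_4 (μ : MMap L M 4 r) : ev (pa (P123 4) μ) ![a, b, c, e] ![X, Y, Z, W]
    = koszulSign ![a, b, c, e] (P123 4) • ev μ ![c, a, b, e] ![Z, X, Y, W] :=
  ev_pa_eq μ

theorem ev_P123_5 (μ : MMap L M 5 r) : ev (pa (P123 5) μ) ![a, b, c, e, f] ![X, Y, Z, W, T]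
    = koszulSign ![a, b, c, e, f] (P123 5) • ev μ ![c, a, b, e, f] ![Z, X, Y, W, T] :=
  ev_pa_eq μ

theorem ev_P132_3 (μ : MMap L M 3 r) : ev (pa (P132 3) μ) ![a, b, c] ![X, Y, Z]
    = koszulSign ![a, b, c] (P132 3) • ev μ ![b, c, a] ![Y, Z, X] :=
  ev_pa_eq μ

theorem ev_P132_4 (μ : MMap L M 4 r) : ev (pa (P132 4) μ) ![a, b, c, e] ![X, Y, Z, W]
    = koszulSign ![a, b, c, e] (P132 4) • ev μ ![b, c, a, e] ![Y, Z, X, W] :=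
  ev_pa_eq μ

theorem ev_P132_5 (μ : MMap L M 5 r) : ev (pa (P132 5) μ) ![a, b, c, e, f] ![X, Y, Z, W, T]
    = koszulSign ![a, b, c, e, f] (P132 5) • ev μ ![b, c, a, e, f] ![Y, Z, X, W, T] :=
  ev_pa_eq μ

theorem ev_P13_4 (μ : MMap L M 4 r) : ev (pa (P13 4) μ) ![a, b, c, e] ![X, Y, Z, W]
    = koszulSign ![a, b, c, e] (P13 4) • ev μ ![c, b, a, e] ![Z, Y, X, W] :=
  ev_pa_eq μ

theorem ev_P234_5 (μ : MMap L M 5 r) : ev (pa (P234 5) μ) ![a, b, c, e, f] ![X, Y, Z, W, T]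
    = koszulSign ![a, b, c, e, f] (P234 5) • ev μ ![a, e, b, c, f] ![X, W, Y, Z, T] :=
  ev_pa_eq μ

theorem ev_P243_5 (μ : MMap L M 5 r) : ev (pa (P243 5) μ) ![a, b, c, e, f] ![X, Y, Z, W, T]
    = koszulSign ![a, b, c, e, f] (P243 5) • ev μ ![a, c, e, b, f] ![X, Z, W, Y, T] :=
  ev_pa_eq μ

theorem ev_P1234_5 (μ : MMap L M 5 r) : ev (pa (P1234 5) μ) ![a, b, c, e, f] ![X, Y, Z, W, T]
    = koszulSign ![a, b, c, e, f] (P1234 5) • ev μ ![e, a, b, c, f] ![W, X, Y, Z, T] :=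
  ev_pa_eq μ

theorem ev_P1432_5 (μ : MMap L M 5 r) : ev (pa (P1432 5) μ) ![a, b, c, e, f] ![X, Y, Z, W, T]
    = koszulSign ![a, b, c, e, f] (P1432 5) • ev μ ![b, c, e, a, f] ![Y, Z, W, X, T] :=
  ev_pa_eq μ

theorem ev_P1342_5 (μ : MMap L M 5 r) : ev (pa (P1342 5) μ) ![a, b, c, e, f] ![X, Y, Z, W, T]
    = koszulSign ![a, b, c, e, f] (P1342 5) • ev μ ![b, e, a, c, f] ![Y, W, X, Z, T] :=
  ev_pa_eq μ

theorem ev_P13P24_5 (μ : MMap L M 5 r) : ev (pa (P13P24 5) μ) ![a, b, c, e, f] ![X, Y, Z, W, T]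
    = koszulSign ![a, b, c, e, f] (P13P24 5) • ev μ ![c, e, a, b, f] ![Z, W, X, Y, T] :=
  ev_pa_eq μ

end Permutations

theorem koszulSign_eq_one {m : ℕ} {d : Fin m → ℤ} (h : ∀ i j, i < j → d i * d j = 0)
    (σ : Equiv.Perm (Fin m)) : koszulSign d σ = 1 := by
  refine Finset.prod_eq_one fun p hp => ?_
  rw [h p.1 p.2 (Finset.mem_filter.1 hp).2.1]
  rfl

theorem koszulSign_eq_one_two (σ : Equiv.Perm (Fin 2)) :
    koszulSign ![0, 0] σ = 1 ∧ koszulSign ![1, 0] σ = 1 ∧ koszulSign ![0, 1] σ = 1 ∧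
    koszulSign ![2, 0] σ = 1 ∧ koszulSign ![0, 2] σ = 1 := by
  refine ⟨?_, ?_, ?_, ?_, ?_⟩ <;> exact koszulSign_eq_one (by decide) σ

theorem koszulSign_eq_one_three (σ : Equiv.Perm (Fin 3)) :
    koszulSign ![0, 0, 0] σ = 1 ∧ koszulSign ![1, 0, 0] σ = 1 ∧ koszulSign ![0, 1, 0] σ = 1 ∧
    koszulSign ![0, 0, 1] σ = 1 ∧ koszulSign ![2, 0, 0] σ = 1 ∧ koszulSign ![0, 2, 0] σ = 1 ∧
    koszulSign ![0, 0, 2] σ = 1 := by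
  refine ⟨?_, ?_, ?_, ?_, ?_, ?_, ?_⟩ <;> exact koszulSign_eq_one (by decide) σ

theorem koszulSign_eq_one_four (σ : Equiv.Perm (Fin 4)) :
    koszulSign ![0, 0, 0, 0] σ = 1 ∧ koszulSign ![1, 0, 0, 0] σ = 1 ∧
    koszulSign ![0, 1, 0, 0] σ = 1 ∧ koszulSign ![0, 0, 1, 0] σ = 1 ∧
    koszulSign ![0, 0, 0, 1] σ = 1 := by
  refine ⟨?_, ?_, ?_, ?_, ?_⟩ <;> exact koszulSign_eq_one (by decide) σ

theorem koszulSign_eq_one_five (σ : Equiv.Perm (Fin 5)) :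
    koszulSign ![0, 0, 0, 0, 0] σ = 1 := by
  exact koszulSign_eq_one (by decide) σ

theorem koszulSign_11_P12 : koszulSign ![1, 1] (P12 2) = -1 := by decide

theorem koszulSign_110_P12 : koszulSign ![1, 1, 0] (P12 3) = -1 := by decide

theorem koszulSign_101_P12 : koszulSign ![1, 0, 1] (P12 3) = 1 := by decide

theorem koszulSign_011_P12 : koszulSign ![0, 1, 1] (P12 3) = 1 := by decide

variable [∀ i, AddCommGroup (L i)]

section Insertions

theorem ev_pc_eq {R : ℤ} (m₁ m₂ : ℕ) {n : ℕ} {r s : ℤ} (μ : MMap L M (m₁ + 1 + m₂) r)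
    (ν : MMap L L n s) {h : r + s = R} {d : Fin (m₁ + n + m₂) → ℤ}
    {X : Fin (m₁ + n + m₂) → ∀ i, L i} {d₁ : Fin m₁ → ℤ} {d' : Fin (m₁ + 1 + m₂) → ℤ}
    {dn : Fin n → ℤ} {X' : Fin (m₁ + 1 + m₂) → ∀ i, L i} {Xn : Fin n → ∀ i, L i}
    (hd₁ : ∀ j, d (Fin.castAdd m₂ (Fin.castAdd n j)) = d₁ j := by intro j; fin_cases j <;> rfl)
    (hdn : ∀ j, d (Fin.castAdd m₂ (Fin.natAdd m₁ j)) = dn j := by intro j; fin_cases j <;> rfl)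
    (hXn : ∀ j, X (Fin.castAdd m₂ (Fin.natAdd m₁ j)) = Xn j := by intro j; fin_cases j <;> rfl)
    (hd' : ∀ j, Fin.append (Fin.append d₁ (fun _ : Fin 1 => s + ∑ j, dn j))
      (fun j => d (Fin.natAdd (m₁ + n) j)) j = d' j := by
        intro j; fin_cases j <;> rfl)
    (hX' : ∀ j, Fin.append (Fin.append (fun j => X (Fin.castAdd m₂ (Fin.castAdd n j)))
      (fun _ : Fin 1 => ev ν dn Xn)) (fun j => X (Fin.natAdd (m₁ + n) j)) j = X' j := by
        intro j; fin_cases j <;> rfl) :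
    ev (pc R m₁ m₂ μ ν h) d X = (-1 : ℤ) ^ (s * ∑ j, d₁ j).natAbs • ev μ d' X' := by
  rw [pc, ev_mcast, ev_pcomp, outDeg]
  simp only [hd₁, hdn, hXn, funext hd', funext hX']

variable {R r s : ℤ} {h : r + s = R} {a b c e f : ℤ} {X Y Z W T : ∀ i, L i}

theorem ev_pc_0_1_0 (μ : MMap L M 1 r) (ν : MMap L L 1 s) :
    ev (pc R 0 0 μ ν h) ![a] ![X] =
      ev μ ![s + a] ![ev ν ![a] ![X]] := by
  rw [ev_pc_eq 0 0 μ ν (d₁ := ![]) (dn := ![a]) (Xn := ![X])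
    (d' := ![s + ∑ j, ![a] j]) (X' := ![ev ν ![a] ![X]])]
  simp [Fin.sum_univ_succ, add_assoc]

theorem ev_pc_0_1_1 (μ : MMap L M 2 r) (ν : MMap L L 1 s) :
    ev (pc R 0 1 μ ν h) ![a, b] ![X, Y] =
      ev μ ![s + a, b] ![ev ν ![a] ![X], Y] := by
  rw [ev_pc_eq 0 1 μ ν (d₁ := ![]) (dn := ![a]) (Xn := ![X])
    (d' := ![s + ∑ j, ![a] j, b]) (X' := ![ev ν ![a] ![X], Y])]
  simp [Fin.sum_univ_succ, add_assoc]

theorem ev_pc_1_1_0 (μ : MMap L M 2 r) (ν : MMap L L 1 s) :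
    ev (pc R 1 0 μ ν h) ![a, b] ![X, Y] =
      (-1 : ℤ) ^ (s * a).natAbs •
        ev μ ![a, s + b] ![X, ev ν ![b] ![Y]] := by
  rw [ev_pc_eq 1 0 μ ν (d₁ := ![a]) (dn := ![b]) (Xn := ![Y])
    (d' := ![a, s + ∑ j, ![b] j]) (X' := ![X, ev ν ![b] ![Y]])]
  simp [Fin.sum_univ_succ, add_assoc]

theorem ev_pc_0_1_2 (μ : MMap L M 3 r) (ν : MMap L L 1 s) :
    ev (pc R 0 2 μ ν h) ![a, b, c] ![X, Y, Z] =
      ev μ ![s + a, b, c] ![ev ν ![a] ![X], Y, Z] := by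
  rw [ev_pc_eq 0 2 μ ν (d₁ := ![]) (dn := ![a]) (Xn := ![X])
    (d' := ![s + ∑ j, ![a] j, b, c]) (X' := ![ev ν ![a] ![X], Y, Z])]
  simp [Fin.sum_univ_succ, add_assoc]

theorem ev_pc_1_1_1 (μ : MMap L M 3 r) (ν : MMap L L 1 s) :
    ev (pc R 1 1 μ ν h) ![a, b, c] ![X, Y, Z] =
      (-1 : ℤ) ^ (s * a).natAbs •
        ev μ ![a, s + b, c] ![X, ev ν ![b] ![Y], Z] := by
  rw [ev_pc_eq 1 1 μ ν (d₁ := ![a]) (dn := ![b]) (Xn := ![Y])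
    (d' := ![a, s + ∑ j, ![b] j, c]) (X' := ![X, ev ν ![b] ![Y], Z])]
  simp [Fin.sum_univ_succ, add_assoc]

theorem ev_pc_2_1_0 (μ : MMap L M 3 r) (ν : MMap L L 1 s) :
    ev (pc R 2 0 μ ν h) ![a, b, c] ![X, Y, Z] =
      (-1 : ℤ) ^ (s * (a + b)).natAbs •
        ev μ ![a, b, s + c] ![X, Y, ev ν ![c] ![Z]] := by
  rw [ev_pc_eq 2 0 μ ν (d₁ := ![a, b]) (dn := ![c]) (Xn := ![Z])
    (d' := ![a, b, s + ∑ j, ![c] j]) (X' := ![X, Y, ev ν ![c] ![Z]])]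
  simp [Fin.sum_univ_succ, add_assoc]

theorem ev_pc_0_1_3 (μ : MMap L M 4 r) (ν : MMap L L 1 s) :
    ev (pc R 0 3 μ ν h) ![a, b, c, e] ![X, Y, Z, W] =
      ev μ ![s + a, b, c, e] ![ev ν ![a] ![X], Y, Z, W] := by
  rw [ev_pc_eq 0 3 μ ν (d₁ := ![]) (dn := ![a]) (Xn := ![X])
    (d' := ![s + ∑ j, ![a] j, b, c, e]) (X' := ![ev ν ![a] ![X], Y, Z, W])]
  simp [Fin.sum_univ_succ, add_assoc]

theorem ev_pc_1_1_2 (μ : MMap L M 4 r) (ν : MMap L L 1 s) :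
    ev (pc R 1 2 μ ν h) ![a, b, c, e] ![X, Y, Z, W] =
      (-1 : ℤ) ^ (s * a).natAbs •
        ev μ ![a, s + b, c, e] ![X, ev ν ![b] ![Y], Z, W] := by
  rw [ev_pc_eq 1 2 μ ν (d₁ := ![a]) (dn := ![b]) (Xn := ![Y])
    (d' := ![a, s + ∑ j, ![b] j, c, e]) (X' := ![X, ev ν ![b] ![Y], Z, W])]
  simp [Fin.sum_univ_succ, add_assoc]

theorem ev_pc_2_1_1 (μ : MMap L M 4 r) (ν : MMap L L 1 s) :
    ev (pc R 2 1 μ ν h) ![a, b, c, e] ![X, Y, Z, W] =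
      (-1 : ℤ) ^ (s * (a + b)).natAbs •
        ev μ ![a, b, s + c, e] ![X, Y, ev ν ![c] ![Z], W] := by
  rw [ev_pc_eq 2 1 μ ν (d₁ := ![a, b]) (dn := ![c]) (Xn := ![Z])
    (d' := ![a, b, s + ∑ j, ![c] j, e]) (X' := ![X, Y, ev ν ![c] ![Z], W])]
  simp [Fin.sum_univ_succ, add_assoc]

theorem ev_pc_3_1_0 (μ : MMap L M 4 r) (ν : MMap L L 1 s) :
    ev (pc R 3 0 μ ν h) ![a, b, c, e] ![X, Y, Z, W] =
      (-1 : ℤ) ^ (s * (a + b + c)).natAbs •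
        ev μ ![a, b, c, s + e] ![X, Y, Z, ev ν ![e] ![W]] := by
  rw [ev_pc_eq 3 0 μ ν (d₁ := ![a, b, c]) (dn := ![e]) (Xn := ![W])
    (d' := ![a, b, c, s + ∑ j, ![e] j]) (X' := ![X, Y, Z, ev ν ![e] ![W]])]
  simp [Fin.sum_univ_succ, add_assoc]

theorem ev_pc_0_2_1 (μ : MMap L M 2 r) (ν : MMap L L 2 s) :
    ev (pc R 0 1 μ ν h) ![a, b, c] ![X, Y, Z] =
      ev μ ![s + (a + b), c] ![ev ν ![a, b] ![X, Y], Z] := by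
  rw [ev_pc_eq 0 1 μ ν (d₁ := ![]) (dn := ![a, b]) (Xn := ![X, Y])
    (d' := ![s + ∑ j, ![a, b] j, c]) (X' := ![ev ν ![a, b] ![X, Y], Z])]
  simp [Fin.sum_univ_succ, add_assoc]

theorem ev_pc_1_2_0 (μ : MMap L M 2 r) (ν : MMap L L 2 s) :
    ev (pc R 1 0 μ ν h) ![a, b, c] ![X, Y, Z] =
      (-1 : ℤ) ^ (s * a).natAbs •
        ev μ ![a, s + (b + c)] ![X, ev ν ![b, c] ![Y, Z]] := by
  rw [ev_pc_eq 1 0 μ ν (d₁ := ![a]) (dn := ![b, c]) (Xn := ![Y, Z])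
    (d' := ![a, s + ∑ j, ![b, c] j]) (X' := ![X, ev ν ![b, c] ![Y, Z]])]
  simp [Fin.sum_univ_succ, add_assoc]

theorem ev_pc_0_2_2 (μ : MMap L M 3 r) (ν : MMap L L 2 s) :
    ev (pc R 0 2 μ ν h) ![a, b, c, e] ![X, Y, Z, W] =
      ev μ ![s + (a + b), c, e] ![ev ν ![a, b] ![X, Y], Z, W] := by
  rw [ev_pc_eq 0 2 μ ν (d₁ := ![]) (dn := ![a, b]) (Xn := ![X, Y])
    (d' := ![s + ∑ j, ![a, b] j, c, e]) (X' := ![ev ν ![a, b] ![X, Y], Z, W])]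
  simp [Fin.sum_univ_succ, add_assoc]

theorem ev_pc_1_2_1 (μ : MMap L M 3 r) (ν : MMap L L 2 s) :
    ev (pc R 1 1 μ ν h) ![a, b, c, e] ![X, Y, Z, W] =
      (-1 : ℤ) ^ (s * a).natAbs •
        ev μ ![a, s + (b + c), e] ![X, ev ν ![b, c] ![Y, Z], W] := by
  rw [ev_pc_eq 1 1 μ ν (d₁ := ![a]) (dn := ![b, c]) (Xn := ![Y, Z])
    (d' := ![a, s + ∑ j, ![b, c] j, e]) (X' := ![X, ev ν ![b, c] ![Y, Z], W])]
  simp [Fin.sum_univ_succ, add_assoc]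

theorem ev_pc_2_2_0 (μ : MMap L M 3 r) (ν : MMap L L 2 s) :
    ev (pc R 2 0 μ ν h) ![a, b, c, e] ![X, Y, Z, W] =
      (-1 : ℤ) ^ (s * (a + b)).natAbs •
        ev μ ![a, b, s + (c + e)] ![X, Y, ev ν ![c, e] ![Z, W]] := by
  rw [ev_pc_eq 2 0 μ ν (d₁ := ![a, b]) (dn := ![c, e]) (Xn := ![Z, W])
    (d' := ![a, b, s + ∑ j, ![c, e] j]) (X' := ![X, Y, ev ν ![c, e] ![Z, W]])]
  simp [Fin.sum_univ_succ, add_assoc]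

theorem ev_pc_0_2_3 (μ : MMap L M 4 r) (ν : MMap L L 2 s) :
    ev (pc R 0 3 μ ν h) ![a, b, c, e, f] ![X, Y, Z, W, T] =
      ev μ ![s + (a + b), c, e, f] ![ev ν ![a, b] ![X, Y], Z, W, T] := by
  rw [ev_pc_eq 0 3 μ ν (d₁ := ![]) (dn := ![a, b]) (Xn := ![X, Y])
    (d' := ![s + ∑ j, ![a, b] j, c, e, f]) (X' := ![ev ν ![a, b] ![X, Y], Z, W, T])]
  simp [Fin.sum_univ_succ, add_assoc]

theorem ev_pc_1_2_2 (μ : MMap L M 4 r) (ν : MMap L L 2 s) :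
    ev (pc R 1 2 μ ν h) ![a, b, c, e, f] ![X, Y, Z, W, T] =
      (-1 : ℤ) ^ (s * a).natAbs •
        ev μ ![a, s + (b + c), e, f] ![X, ev ν ![b, c] ![Y, Z], W, T] := by
  rw [ev_pc_eq 1 2 μ ν (d₁ := ![a]) (dn := ![b, c]) (Xn := ![Y, Z])
    (d' := ![a, s + ∑ j, ![b, c] j, e, f]) (X' := ![X, ev ν ![b, c] ![Y, Z], W, T])]
  simp [Fin.sum_univ_succ, add_assoc]

theorem ev_pc_2_2_1 (μ : MMap L M 4 r) (ν : MMap L L 2 s) :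
    ev (pc R 2 1 μ ν h) ![a, b, c, e, f] ![X, Y, Z, W, T] =
      (-1 : ℤ) ^ (s * (a + b)).natAbs •
        ev μ ![a, b, s + (c + e), f] ![X, Y, ev ν ![c, e] ![Z, W], T] := by
  rw [ev_pc_eq 2 1 μ ν (d₁ := ![a, b]) (dn := ![c, e]) (Xn := ![Z, W])
    (d' := ![a, b, s + ∑ j, ![c, e] j, f]) (X' := ![X, Y, ev ν ![c, e] ![Z, W], T])]
  simp [Fin.sum_univ_succ, add_assoc]

theorem ev_pc_3_2_0 (μ : MMap L M 4 r) (ν : MMap L L 2 s) :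
    ev (pc R 3 0 μ ν h) ![a, b, c, e, f] ![X, Y, Z, W, T] =
      (-1 : ℤ) ^ (s * (a + b + c)).natAbs •
        ev μ ![a, b, c, s + (e + f)] ![X, Y, Z, ev ν ![e, f] ![W, T]] := by
  rw [ev_pc_eq 3 0 μ ν (d₁ := ![a, b, c]) (dn := ![e, f]) (Xn := ![W, T])
    (d' := ![a, b, c, s + ∑ j, ![e, f] j]) (X' := ![X, Y, Z, ev ν ![e, f] ![W, T]])]
  simp [Fin.sum_univ_succ, add_assoc]

theorem ev_pc_0_3_1 (μ : MMap L M 2 r) (ν : MMap L L 3 s) :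
    ev (pc R 0 1 μ ν h) ![a, b, c, e] ![X, Y, Z, W] =
      ev μ ![s + (a + b + c), e] ![ev ν ![a, b, c] ![X, Y, Z], W] := by
  rw [ev_pc_eq 0 1 μ ν (d₁ := ![]) (dn := ![a, b, c]) (Xn := ![X, Y, Z])
    (d' := ![s + ∑ j, ![a, b, c] j, e]) (X' := ![ev ν ![a, b, c] ![X, Y, Z], W])]
  simp [Fin.sum_univ_succ, add_assoc]

theorem ev_pc_1_3_0 (μ : MMap L M 2 r) (ν : MMap L L 3 s) :
    ev (pc R 1 0 μ ν h) ![a, b, c, e] ![X, Y, Z, W] =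
      (-1 : ℤ) ^ (s * a).natAbs •
        ev μ ![a, s + (b + c + e)] ![X, ev ν ![b, c, e] ![Y, Z, W]] := by
  rw [ev_pc_eq 1 0 μ ν (d₁ := ![a]) (dn := ![b, c, e]) (Xn := ![Y, Z, W])
    (d' := ![a, s + ∑ j, ![b, c, e] j]) (X' := ![X, ev ν ![b, c, e] ![Y, Z, W]])]
  simp [Fin.sum_univ_succ, add_assoc]

theorem ev_pc_0_3_2 (μ : MMap L M 3 r) (ν : MMap L L 3 s) :
    ev (pc R 0 2 μ ν h) ![a, b, c, e, f] ![X, Y, Z, W, T] =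
      ev μ ![s + (a + b + c), e, f] ![ev ν ![a, b, c] ![X, Y, Z], W, T] := by
  rw [ev_pc_eq 0 2 μ ν (d₁ := ![]) (dn := ![a, b, c]) (Xn := ![X, Y, Z])
    (d' := ![s + ∑ j, ![a, b, c] j, e, f]) (X' := ![ev ν ![a, b, c] ![X, Y, Z], W, T])]
  simp [Fin.sum_univ_succ, add_assoc]

theorem ev_pc_1_3_1 (μ : MMap L M 3 r) (ν : MMap L L 3 s) :
    ev (pc R 1 1 μ ν h) ![a, b, c, e, f] ![X, Y, Z, W, T] =
      (-1 : ℤ) ^ (s * a).natAbs •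
        ev μ ![a, s + (b + c + e), f] ![X, ev ν ![b, c, e] ![Y, Z, W], T] := by
  rw [ev_pc_eq 1 1 μ ν (d₁ := ![a]) (dn := ![b, c, e]) (Xn := ![Y, Z, W])
    (d' := ![a, s + ∑ j, ![b, c, e] j, f]) (X' := ![X, ev ν ![b, c, e] ![Y, Z, W], T])]
  simp [Fin.sum_univ_succ, add_assoc]

theorem ev_pc_2_3_0 (μ : MMap L M 3 r) (ν : MMap L L 3 s) :
    ev (pc R 2 0 μ ν h) ![a, b, c, e, f] ![X, Y, Z, W, T] =
      (-1 : ℤ) ^ (s * (a + b)).natAbs •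
        ev μ ![a, b, s + (c + e + f)] ![X, Y, ev ν ![c, e, f] ![Z, W, T]] := by
  rw [ev_pc_eq 2 0 μ ν (d₁ := ![a, b]) (dn := ![c, e, f]) (Xn := ![Z, W, T])
    (d' := ![a, b, s + ∑ j, ![c, e, f] j]) (X' := ![X, Y, ev ν ![c, e, f] ![Z, W, T]])]
  simp [Fin.sum_univ_succ, add_assoc]

theorem ev_pc_0_4_1 (μ : MMap L M 2 r) (ν : MMap L L 4 s) :
    ev (pc R 0 1 μ ν h) ![a, b, c, e, f] ![X, Y, Z, W, T] =
      ev μ ![s + (a + b + c + e), f] ![ev ν ![a, b, c, e] ![X, Y, Z, W], T] := by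
  rw [ev_pc_eq 0 1 μ ν (d₁ := ![]) (dn := ![a, b, c, e]) (Xn := ![X, Y, Z, W])
    (d' := ![s + ∑ j, ![a, b, c, e] j, f]) (X' := ![ev ν ![a, b, c, e] ![X, Y, Z, W], T])]
  simp [Fin.sum_univ_succ, add_assoc]

theorem ev_pc_1_4_0 (μ : MMap L M 2 r) (ν : MMap L L 4 s) :
    ev (pc R 1 0 μ ν h) ![a, b, c, e, f] ![X, Y, Z, W, T] =
      (-1 : ℤ) ^ (s * a).natAbs •
        ev μ ![a, s + (b + c + e + f)] ![X, ev ν ![b, c, e, f] ![Y, Z, W, T]] := by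
  rw [ev_pc_eq 1 0 μ ν (d₁ := ![a]) (dn := ![b, c, e, f]) (Xn := ![Y, Z, W, T])
    (d' := ![a, s + ∑ j, ![b, c, e, f] j]) (X' := ![X, ev ν ![b, c, e, f] ![Y, Z, W, T]])]
  simp [Fin.sum_univ_succ, add_assoc]

end Insertions

section Differential

variable {R r : ℤ} (D' : MMap M M 1 (-1)) (D : MMap L L 1 (-1)) (h : -1 + r = R)

theorem bd_1 (μ : MMap L M 1 r) : bd R D' D μ h = fc1 R D' μ h
    - (-1 : ℤ) ^ r.natAbs • (pc R 0 0 μ D (by omega)) := by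
  subst h
  simp only [bd, bdry, Fin.sum_univ_one]
  rfl

theorem bd_2 (μ : MMap L M 2 r) : bd R D' D μ h = fc1 R D' μ h
    - (-1 : ℤ) ^ r.natAbs • (pc R 0 1 μ D (by omega) + pc R 1 0 μ D (by omega)) := by
  subst h
  simp only [bd, bdry, Fin.sum_univ_two]
  rfl

theorem bd_3 (μ : MMap L M 3 r) : bd R D' D μ h = fc1 R D' μ h
    - (-1 : ℤ) ^ r.natAbs • (pc R 0 2 μ D (by omega) + pc R 1 1 μ D (by omega)
      + pc R 2 0 μ D (by omega)) := by
  subst h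
  simp only [bd, bdry, Fin.sum_univ_three]
  rfl

theorem bd_4 (μ : MMap L M 4 r) : bd R D' D μ h = fc1 R D' μ h
    - (-1 : ℤ) ^ r.natAbs • (pc R 0 3 μ D (by omega) + pc R 1 2 μ D (by omega)
      + pc R 2 1 μ D (by omega) + pc R 3 0 μ D (by omega)) := by
  subst h
  simp only [bd, bdry, Fin.sum_univ_four]
  rfl

end Differential

end Concrete

section Components

section FullCompositions

variable {L M N : ℤ → Type} [∀ i, AddCommGroup (M i)] [∀ i, AddCommGroup (N i)] {R r s : ℤ}
  {a b c e : ℤ} {X Y Z W : ∀ i, L i}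

theorem ev_fc1_1 (μ : MMap M N 1 r) (g : MMap L M 1 s) (h : r + s = R) :
    ev (fc1 R μ g h) ![a] ![X]
      = ev μ ![s + (a)] ![ev g ![a] ![X]] := by
  rw [ev_fc1]; simp [Fin.sum_univ_succ, add_assoc]

theorem ev_fc1_2 (μ : MMap M N 1 r) (g : MMap L M 2 s) (h : r + s = R) :
    ev (fc1 R μ g h) ![a, b] ![X, Y]
      = ev μ ![s + (a + b)] ![ev g ![a, b] ![X, Y]] := by
  rw [ev_fc1]; simp [Fin.sum_univ_succ, add_assoc]

theorem ev_fc1_3 (μ : MMap M N 1 r) (g : MMap L M 3 s) (h : r + s = R) :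
    ev (fc1 R μ g h) ![a, b, c] ![X, Y, Z]
      = ev μ ![s + (a + b + c)] ![ev g ![a, b, c] ![X, Y, Z]] := by
  rw [ev_fc1]; simp [Fin.sum_univ_succ, add_assoc]

theorem ev_fc1_4 (μ : MMap M N 1 r) (g : MMap L M 4 s) (h : r + s = R) :
    ev (fc1 R μ g h) ![a, b, c, e] ![X, Y, Z, W]
      = ev μ ![s + (a + b + c + e)] ![ev g ![a, b, c, e] ![X, Y, Z, W]] := by
  rw [ev_fc1]; simp [Fin.sum_univ_succ, add_assoc]

section

variable {s₁ s₂ s₃ s₄ : ℤ}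

theorem ev_congr {m : ℕ} (μ : MMap L M m r) {d d' : Fin m → ℤ} {X X' : Fin m → ∀ i, L i}
    (hd : ∀ j, d j = d' j) (hX : ∀ j, X j = X' j) : ev μ d X = ev μ d' X' := by
  rw [funext hd, funext hX]

theorem ev_fc2_1_1 (μ : MMap M N 2 r) (g₁ : MMap L M 1 s₁) (g₂ : MMap L M 1 s₂)
    (h : r + (s₁ + s₂) = R) : ev (fc2 R μ g₁ g₂ h) ![a, b] ![X, Y]
      = (-1 : ℤ) ^ (s₂ * (a)).natAbs •
        ev μ ![s₁ + a, s₂ + b]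
          ![ev g₁ ![a] ![X],
            ev g₂ ![b] ![Y]] := by
  refine (ev_fc2 μ g₁ g₂ h ![a, b] ![X, Y]).trans ?_
  simp only [Fin.sum_univ_one]
  refine congrArg _ (congrArg _ (funext fun j => ?_))
  fin_cases j <;> exact ev_congr _ (fun j => by fin_cases j <;> rfl)
    fun j => by fin_cases j <;> rfl

theorem ev_fc2_2_2 (μ : MMap M N 2 r) (g₁ : MMap L M 2 s₁) (g₂ : MMap L M 2 s₂)
    (h : r + (s₁ + s₂) = R) : ev (fc2 R μ g₁ g₂ h) ![a, b, c, e] ![X, Y, Z, W]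
      = (-1 : ℤ) ^ (s₂ * ((a + b))).natAbs •
        ev μ ![s₁ + (a + b), s₂ + (c + e)]
          ![ev g₁ ![a, b] ![X, Y],
            ev g₂ ![c, e] ![Z, W]] := by
  refine (ev_fc2 μ g₁ g₂ h ![a, b, c, e] ![X, Y, Z, W]).trans ?_
  simp only [Fin.sum_univ_two]
  refine congrArg _ (congrArg _ (funext fun j => ?_))
  fin_cases j <;> exact ev_congr _ (fun j => by fin_cases j <;> rfl)
    fun j => by fin_cases j <;> rfl

theorem ev_fc3_1_1_1 (μ : MMap M N 3 r) (g₁ : MMap L M 1 s₁) (g₂ : MMap L M 1 s₂) (g₃ : MMap L M 1 s₃)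
    (h : r + (s₁ + s₂ + s₃) = R) : ev (fc3 R μ g₁ g₂ g₃ h) ![a, b, c] ![X, Y, Z]
      = (-1 : ℤ) ^ (s₂ * (a) + s₃ * (a + b)).natAbs •
        ev μ ![s₁ + a, s₂ + b, s₃ + c]
          ![ev g₁ ![a] ![X],
            ev g₂ ![b] ![Y],
            ev g₃ ![c] ![Z]] := by
  refine (ev_fc3 μ g₁ g₂ g₃ h ![a, b, c] ![X, Y, Z]).trans ?_
  simp only [Fin.sum_univ_one]
  refine congrArg _ (congrArg _ (funext fun j => ?_))
  fin_cases j <;> exact ev_congr _ (fun j => by fin_cases j <;> rfl)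
    fun j => by fin_cases j <;> rfl

theorem ev_fc4_1_1_1_1 (μ : MMap M N 4 r) (g₁ : MMap L M 1 s₁) (g₂ : MMap L M 1 s₂) (g₃ : MMap L M 1 s₃) (g₄ : MMap L M 1 s₄)
    (h : r + (s₁ + s₂ + s₃ + s₄) = R) : ev (fc4 R μ g₁ g₂ g₃ g₄ h) ![a, b, c, e] ![X, Y, Z, W]
      = (-1 : ℤ) ^ (s₂ * (a) + s₃ * (a + b) + s₄ * (a + b + c)).natAbs •
        ev μ ![s₁ + a, s₂ + b, s₃ + c, s₄ + e]
          ![ev g₁ ![a] ![X],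
            ev g₂ ![b] ![Y],
            ev g₃ ![c] ![Z],
            ev g₄ ![e] ![W]] := by
  refine (ev_fc4 μ g₁ g₂ g₃ g₄ h ![a, b, c, e] ![X, Y, Z, W]).trans ?_
  simp only [Fin.sum_univ_one]
  refine congrArg _ (congrArg _ (funext fun j => ?_))
  fin_cases j <;> exact ev_congr _ (fun j => by fin_cases j <;> rfl)
    fun j => by fin_cases j <;> rfl

end

end FullCompositions

variable {k : Type} [CommRing k] {L M : ℤ → Type} [∀ i, AddCommGroup (L i)]
  [∀ i, AddCommGroup (M i)] [∀ i, Module k (L i)] [∀ i, Module k (M i)]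

theorem IsMultiadditive.map_add_of {V W : Type} [AddCommGroup V] [AddCommGroup W] [Module k V]
    [Module k W] {m : ℕ} {F : (Fin m → V) → W} (hF : IsMultiadditive k F) (j : Fin m)
    {A B C : Fin m → V} (h : A j = B j + C j) (hB : ∀ t, t ≠ j → A t = B t)
    (hC : ∀ t, t ≠ j → A t = C t) : F A = F B + F C := by
  have key : ∀ B : Fin m → V, (∀ t, t ≠ j → A t = B t) → Function.update A j (B j) = B := by
    intro B hB
    ext t
    by_cases ht : t = j
    · subst ht; simp
    · rw [Function.update_of_ne ht, hB t ht]
  rw [← key B hB, ← key C hC, ← (hF A j).1, ← h, Function.update_eq_self]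

theorem ev_eq_zero_of_degree {m : ℕ} {r : ℤ} (hM : ∀ i : ℤ, (i < 0 ∨ 2 < i) → ∀ x : M i, x = 0)
    (μ : MMap L M m r) (d : Fin m → ℤ) (X : Fin m → ∀ i, L i)
    (h : r + ∑ j, d j < 0 ∨ 2 < r + ∑ j, d j) : ev μ d X = 0 := by
  rw [ev, hM _ h (μ d _), map_zero]

section Coefficients

variable {r : ℤ}

/-- The component of a multilinear map in the given degrees. -/
def coeff₁ {μ : MMap L M 1 r} (hμ : IsMultilinear k μ) (a t : ℤ) :
    L a →+ M t := by
  refine AddMonoidHom.mk' (fun x => ev μ ![a] ![incl a x] t) ?_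
  · intros
    refine congrFun ((isMultilinear_iff.1 hμ _).map_add_of 0 (map_add _ _ _) ?_ ?_) _ <;>
      intro j hj <;> fin_cases j <;> first | rfl | exact absurd rfl hj

theorem ev_coeff₁ {μ : MMap L M 1 r} (hμ : IsMultilinear k μ) {a t : ℤ}
    (h : r + (a) = t) (x : L a) :
    ev μ ![a] ![incl a x]
      = incl t (coeff₁ hμ a t x) := by
  have h' : r + ∑ j, ![a] j = t := by
    rw [← h]; simp [Fin.sum_univ_succ, add_assoc]
  subst h'
  exact congrArg _ (incl_apply_self _ _).symm

/-- The component of a multilinear map in the given degrees. -/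
def coeff₂ {μ : MMap L M 2 r} (hμ : IsMultilinear k μ) (a b t : ℤ) :
    L a →+ L b →+ M t := by
  refine hom₂ (fun x y => ev μ ![a, b] ![incl a x, incl b y] t) ?_ ?_
  · intros
    refine congrFun ((isMultilinear_iff.1 hμ _).map_add_of 0 (map_add _ _ _) ?_ ?_) _ <;>
      intro j hj <;> fin_cases j <;> first | rfl | exact absurd rfl hj
  · intros
    refine congrFun ((isMultilinear_iff.1 hμ _).map_add_of 1 (map_add _ _ _) ?_ ?_) _ <;>
      intro j hj <;> fin_cases j <;> first | rfl | exact absurd rfl hj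

theorem ev_coeff₂ {μ : MMap L M 2 r} (hμ : IsMultilinear k μ) {a b t : ℤ}
    (h : r + (a + b) = t) (x : L a) (y : L b) :
    ev μ ![a, b] ![incl a x, incl b y]
      = incl t (coeff₂ hμ a b t x y) := by
  have h' : r + ∑ j, ![a, b] j = t := by
    rw [← h]; simp [Fin.sum_univ_succ, add_assoc]
  subst h'
  exact congrArg _ (incl_apply_self _ _).symm

/-- The component of a multilinear map in the given degrees. -/
def coeff₃ {μ : MMap L M 3 r} (hμ : IsMultilinear k μ) (a b c t : ℤ) :
    L a →+ L b →+ L c →+ M t := by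
  refine hom₃ (fun x y z => ev μ ![a, b, c] ![incl a x, incl b y, incl c z] t) ?_ ?_ ?_
  · intros
    refine congrFun ((isMultilinear_iff.1 hμ _).map_add_of 0 (map_add _ _ _) ?_ ?_) _ <;>
      intro j hj <;> fin_cases j <;> first | rfl | exact absurd rfl hj
  · intros
    refine congrFun ((isMultilinear_iff.1 hμ _).map_add_of 1 (map_add _ _ _) ?_ ?_) _ <;>
      intro j hj <;> fin_cases j <;> first | rfl | exact absurd rfl hj
  · intros
    refine congrFun ((isMultilinear_iff.1 hμ _).map_add_of 2 (map_add _ _ _) ?_ ?_) _ <;>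
      intro j hj <;> fin_cases j <;> first | rfl | exact absurd rfl hj

theorem ev_coeff₃ {μ : MMap L M 3 r} (hμ : IsMultilinear k μ) {a b c t : ℤ}
    (h : r + (a + b + c) = t) (x : L a) (y : L b) (z : L c) :
    ev μ ![a, b, c] ![incl a x, incl b y, incl c z]
      = incl t (coeff₃ hμ a b c t x y z) := by
  have h' : r + ∑ j, ![a, b, c] j = t := by
    rw [← h]; simp [Fin.sum_univ_succ, add_assoc]
  subst h'
  exact congrArg _ (incl_apply_self _ _).symm

/-- The component of a multilinear map in the given degrees. -/
def coeff₄ {μ : MMap L M 4 r} (hμ : IsMultilinear k μ) (a b c e t : ℤ) :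
    L a →+ L b →+ L c →+ L e →+ M t := by
  refine hom₄ (fun x y z w => ev μ ![a, b, c, e] ![incl a x, incl b y, incl c z, incl e w] t) ?_ ?_ ?_ ?_
  · intros
    refine congrFun ((isMultilinear_iff.1 hμ _).map_add_of 0 (map_add _ _ _) ?_ ?_) _ <;>
      intro j hj <;> fin_cases j <;> first | rfl | exact absurd rfl hj
  · intros
    refine congrFun ((isMultilinear_iff.1 hμ _).map_add_of 1 (map_add _ _ _) ?_ ?_) _ <;>
      intro j hj <;> fin_cases j <;> first | rfl | exact absurd rfl hj
  · intros
    refine congrFun ((isMultilinear_iff.1 hμ _).map_add_of 2 (map_add _ _ _) ?_ ?_) _ <;>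
      intro j hj <;> fin_cases j <;> first | rfl | exact absurd rfl hj
  · intros
    refine congrFun ((isMultilinear_iff.1 hμ _).map_add_of 3 (map_add _ _ _) ?_ ?_) _ <;>
      intro j hj <;> fin_cases j <;> first | rfl | exact absurd rfl hj

theorem ev_coeff₄ {μ : MMap L M 4 r} (hμ : IsMultilinear k μ) {a b c e t : ℤ}
    (h : r + (a + b + c + e) = t) (x : L a) (y : L b) (z : L c) (w : L e) :
    ev μ ![a, b, c, e] ![incl a x, incl b y, incl c z, incl e w]
      = incl t (coeff₄ hμ a b c e t x y z w) := by
  have h' : r + ∑ j, ![a, b, c, e] j = t := by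
    rw [← h]; simp [Fin.sum_univ_succ, add_assoc]
  subst h'
  exact congrArg _ (incl_apply_self _ _).symm

end Coefficients

section Vanishing

variable {r a b c e : ℤ} {X Y Z W : ∀ i, L i}

theorem IsMultilinear.ev_zero_1_1 {μ : MMap L M 1 r} (hμ : IsMultilinear k μ) :
    ev μ ![a] ![0] = 0 :=
  (isMultilinear_iff.1 hμ _).map_eq_zero 0 rfl

theorem IsMultilinear.ev_zero_2_1 {μ : MMap L M 2 r} (hμ : IsMultilinear k μ) :
    ev μ ![a, b] ![0, Y] = 0 :=
  (isMultilinear_iff.1 hμ _).map_eq_zero 0 rfl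

theorem IsMultilinear.ev_zero_2_2 {μ : MMap L M 2 r} (hμ : IsMultilinear k μ) :
    ev μ ![a, b] ![X, 0] = 0 :=
  (isMultilinear_iff.1 hμ _).map_eq_zero 1 rfl

theorem IsMultilinear.ev_zero_3_1 {μ : MMap L M 3 r} (hμ : IsMultilinear k μ) :
    ev μ ![a, b, c] ![0, Y, Z] = 0 :=
  (isMultilinear_iff.1 hμ _).map_eq_zero 0 rfl

theorem IsMultilinear.ev_zero_3_2 {μ : MMap L M 3 r} (hμ : IsMultilinear k μ) :
    ev μ ![a, b, c] ![X, 0, Z] = 0 :=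
  (isMultilinear_iff.1 hμ _).map_eq_zero 1 rfl

theorem IsMultilinear.ev_zero_3_3 {μ : MMap L M 3 r} (hμ : IsMultilinear k μ) :
    ev μ ![a, b, c] ![X, Y, 0] = 0 :=
  (isMultilinear_iff.1 hμ _).map_eq_zero 2 rfl

theorem IsMultilinear.ev_zero_4_1 {μ : MMap L M 4 r} (hμ : IsMultilinear k μ) :
    ev μ ![a, b, c, e] ![0, Y, Z, W] = 0 :=
  (isMultilinear_iff.1 hμ _).map_eq_zero 0 rfl

theorem IsMultilinear.ev_zero_4_2 {μ : MMap L M 4 r} (hμ : IsMultilinear k μ) :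
    ev μ ![a, b, c, e] ![X, 0, Z, W] = 0 :=
  (isMultilinear_iff.1 hμ _).map_eq_zero 1 rfl

theorem IsMultilinear.ev_zero_4_3 {μ : MMap L M 4 r} (hμ : IsMultilinear k μ) :
    ev μ ![a, b, c, e] ![X, Y, 0, W] = 0 :=
  (isMultilinear_iff.1 hμ _).map_eq_zero 2 rfl

theorem IsMultilinear.ev_zero_4_4 {μ : MMap L M 4 r} (hμ : IsMultilinear k μ) :
    ev μ ![a, b, c, e] ![X, Y, Z, 0] = 0 :=
  (isMultilinear_iff.1 hμ _).map_eq_zero 3 rfl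

end Vanishing

end Components

section Extensionality

variable {k : Type} [CommRing k] {L M : ℤ → Type} [∀ i, AddCommGroup (L i)]
  [∀ i, AddCommGroup (M i)] [∀ i, Module k (L i)] [∀ i, Module k (M i)]

/-- Equality of the components of two multilinear maps in the given degrees. -/
def AgreeAt₂ {r : ℤ} (μ ν : MMap L M 2 r) (a b : ℤ) : Prop :=
  ∀ (x : L a) (y : L b),
    ev μ ![a, b] ![incl a x, incl b y]
      = ev ν ![a, b] ![incl a x, incl b y]

/-- Equality of the components of two multilinear maps in the given degrees. -/
def AgreeAt₃ {r : ℤ} (μ ν : MMap L M 3 r) (a b c : ℤ) : Prop :=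
  ∀ (x : L a) (y : L b) (z : L c),
    ev μ ![a, b, c] ![incl a x, incl b y, incl c z]
      = ev ν ![a, b, c] ![incl a x, incl b y, incl c z]

/-- Equality of the components of two multilinear maps in the given degrees. -/
def AgreeAt₄ {r : ℤ} (μ ν : MMap L M 4 r) (a b c e : ℤ) : Prop :=
  ∀ (x : L a) (y : L b) (z : L c) (w : L e),
    ev μ ![a, b, c, e] ![incl a x, incl b y, incl c z, incl e w]
      = ev ν ![a, b, c, e] ![incl a x, incl b y, incl c z, incl e w]

/-- Equality of the components of two multilinear maps in the given degrees. -/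
def AgreeAt₅ {r : ℤ} (μ ν : MMap L M 5 r) (a b c e f : ℤ) : Prop :=
  ∀ (x : L a) (y : L b) (z : L c) (w : L e) (t : L f),
    ev μ ![a, b, c, e, f] ![incl a x, incl b y, incl c z, incl e w, incl f t]
      = ev ν ![a, b, c, e, f] ![incl a x, incl b y, incl c z, incl e w, incl f t]

theorem of_vec_2 {r : ℤ} {μ ν : MMap L M 2 r} {d : Fin 2 → ℤ} {a b : ℤ}
    (hd : d 0 = a ∧ d 1 = b)
    (h : AgreeAt₂ μ ν a b) (x : ∀ j, L (d j)) :
    ev μ d (fun j => incl (d j) (x j)) = ev ν d (fun j => incl (d j) (x j)) := by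
  obtain rfl : d = ![a, b] := by
    obtain ⟨h0, h1⟩ := hd
    ext j
    fin_cases j <;> assumption
  refine (ev_congr μ (fun _ => rfl) fun j => ?_).trans ((h (x 0) (x 1)).trans
    (ev_congr ν (fun _ => rfl) fun j => ?_)) <;> fin_cases j <;> rfl

theorem of_vec_3 {r : ℤ} {μ ν : MMap L M 3 r} {d : Fin 3 → ℤ} {a b c : ℤ}
    (hd : d 0 = a ∧ d 1 = b ∧ d 2 = c)
    (h : AgreeAt₃ μ ν a b c) (x : ∀ j, L (d j)) :
    ev μ d (fun j => incl (d j) (x j)) = ev ν d (fun j => incl (d j) (x j)) := by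
  obtain rfl : d = ![a, b, c] := by
    obtain ⟨h0, h1, h2⟩ := hd
    ext j
    fin_cases j <;> assumption
  refine (ev_congr μ (fun _ => rfl) fun j => ?_).trans ((h (x 0) (x 1) (x 2)).trans
    (ev_congr ν (fun _ => rfl) fun j => ?_)) <;> fin_cases j <;> rfl

theorem of_vec_4 {r : ℤ} {μ ν : MMap L M 4 r} {d : Fin 4 → ℤ} {a b c e : ℤ}
    (hd : d 0 = a ∧ d 1 = b ∧ d 2 = c ∧ d 3 = e)
    (h : AgreeAt₄ μ ν a b c e) (x : ∀ j, L (d j)) :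
    ev μ d (fun j => incl (d j) (x j)) = ev ν d (fun j => incl (d j) (x j)) := by
  obtain rfl : d = ![a, b, c, e] := by
    obtain ⟨h0, h1, h2, h3⟩ := hd
    ext j
    fin_cases j <;> assumption
  refine (ev_congr μ (fun _ => rfl) fun j => ?_).trans ((h (x 0) (x 1) (x 2) (x 3)).trans
    (ev_congr ν (fun _ => rfl) fun j => ?_)) <;> fin_cases j <;> rfl

theorem of_vec_5 {r : ℤ} {μ ν : MMap L M 5 r} {d : Fin 5 → ℤ} {a b c e f : ℤ}
    (hd : d 0 = a ∧ d 1 = b ∧ d 2 = c ∧ d 3 = e ∧ d 4 = f)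
    (h : AgreeAt₅ μ ν a b c e f) (x : ∀ j, L (d j)) :
    ev μ d (fun j => incl (d j) (x j)) = ev ν d (fun j => incl (d j) (x j)) := by
  obtain rfl : d = ![a, b, c, e, f] := by
    obtain ⟨h0, h1, h2, h3, h4⟩ := hd
    ext j
    fin_cases j <;> assumption
  refine (ev_congr μ (fun _ => rfl) fun j => ?_).trans ((h (x 0) (x 1) (x 2) (x 3) (x 4)).trans
    (ev_congr ν (fun _ => rfl) fun j => ?_)) <;> fin_cases j <;> rfl

theorem ext_2_neg_one (hL : ∀ i : ℤ, (i < 0 ∨ 2 < i) → ∀ x : L i, x = 0)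
    (hM : ∀ i : ℤ, (i < 0 ∨ 2 < i) → ∀ x : M i, x = 0) {μ ν : MMap L M 2 (-1)}
    (hμ : IsMultilinear k μ) (hν : IsMultilinear k ν) : μ = ν ↔
      AgreeAt₂ μ ν 1 0 ∧
      AgreeAt₂ μ ν 0 1 ∧
      AgreeAt₂ μ ν 2 0 ∧
      AgreeAt₂ μ ν 1 1 ∧
      AgreeAt₂ μ ν 0 2 ∧
      AgreeAt₂ μ ν 2 1 ∧
      AgreeAt₂ μ ν 1 2 := by
  refine ⟨by rintro rfl; simp [AgreeAt₂], fun h =>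
    IsMultilinear.ext_of_bounded hL hM hμ hν fun d hd h₁ h₂ x => ?_⟩
  rw [Fin.sum_univ_two] at h₁ h₂
  have := hd 0
  have := hd 1
  have hcases : (d 0 = 1 ∧ d 1 = 0) ∨ (d 0 = 0 ∧ d 1 = 1) ∨ (d 0 = 2 ∧ d 1 = 0) ∨ (d 0 = 1 ∧ d
      1 = 1) ∨ (d 0 = 0 ∧ d 1 = 2) ∨ (d 0 = 2 ∧ d 1 = 1) ∨ (d 0 = 1 ∧ d 1 = 2) := by
    omega
  obtain ⟨g1, g2, g3, g4, g5, g6, g7⟩ := h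
  rcases hcases with hc | hc | hc | hc | hc | hc | hc
  exacts [of_vec_2 hc g1 x, of_vec_2 hc g2 x, of_vec_2 hc g3 x, of_vec_2 hc g4 x, of_vec_2 hc g5
    x, of_vec_2 hc g6 x, of_vec_2 hc g7 x]

theorem ext_3_0 (hL : ∀ i : ℤ, (i < 0 ∨ 2 < i) → ∀ x : L i, x = 0)
    (hM : ∀ i : ℤ, (i < 0 ∨ 2 < i) → ∀ x : M i, x = 0) {μ ν : MMap L M 3 0}
    (hμ : IsMultilinear k μ) (hν : IsMultilinear k ν) : μ = ν ↔
      AgreeAt₃ μ ν 0 0 0 ∧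
      AgreeAt₃ μ ν 1 0 0 ∧
      AgreeAt₃ μ ν 0 1 0 ∧
      AgreeAt₃ μ ν 0 0 1 ∧
      AgreeAt₃ μ ν 2 0 0 ∧
      AgreeAt₃ μ ν 0 2 0 ∧
      AgreeAt₃ μ ν 0 0 2 ∧
      AgreeAt₃ μ ν 1 1 0 ∧
      AgreeAt₃ μ ν 1 0 1 ∧
      AgreeAt₃ μ ν 0 1 1 := by
  refine ⟨by rintro rfl; simp [AgreeAt₃], fun h =>
    IsMultilinear.ext_of_bounded hL hM hμ hν fun d hd h₁ h₂ x => ?_⟩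
  rw [Fin.sum_univ_three] at h₁ h₂
  have := hd 0
  have := hd 1
  have := hd 2
  have hcases : (d 0 = 0 ∧ d 1 = 0 ∧ d 2 = 0) ∨ (d 0 = 1 ∧ d 1 = 0 ∧ d 2 = 0) ∨ (d 0 = 0 ∧ d 1
      = 1 ∧ d 2 = 0) ∨ (d 0 = 0 ∧ d 1 = 0 ∧ d 2 = 1) ∨ (d 0 = 2 ∧ d 1 = 0 ∧ d 2 = 0) ∨ (d 0 =
      0 ∧ d 1 = 2 ∧ d 2 = 0) ∨ (d 0 = 0 ∧ d 1 = 0 ∧ d 2 = 2) ∨ (d 0 = 1 ∧ d 1 = 1 ∧ d 2 = 0) ∨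
      (d 0 = 1 ∧ d 1 = 0 ∧ d 2 = 1) ∨ (d 0 = 0 ∧ d 1 = 1 ∧ d 2 = 1) := by
    omega
  obtain ⟨g1, g2, g3, g4, g5, g6, g7, g8, g9, g10⟩ := h
  rcases hcases with hc | hc | hc | hc | hc | hc | hc | hc | hc | hc
  exacts [of_vec_3 hc g1 x, of_vec_3 hc g2 x, of_vec_3 hc g3 x, of_vec_3 hc g4 x, of_vec_3 hc g5
    x, of_vec_3 hc g6 x, of_vec_3 hc g7 x, of_vec_3 hc g8 x, of_vec_3 hc g9 x, of_vec_3 hc g10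
    x]

theorem ext_2_0 (hL : ∀ i : ℤ, (i < 0 ∨ 2 < i) → ∀ x : L i, x = 0)
    (hM : ∀ i : ℤ, (i < 0 ∨ 2 < i) → ∀ x : M i, x = 0) {μ ν : MMap L M 2 0}
    (hμ : IsMultilinear k μ) (hν : IsMultilinear k ν) : μ = ν ↔
      AgreeAt₂ μ ν 0 0 ∧
      AgreeAt₂ μ ν 1 0 ∧
      AgreeAt₂ μ ν 0 1 ∧
      AgreeAt₂ μ ν 2 0 ∧
      AgreeAt₂ μ ν 1 1 ∧
      AgreeAt₂ μ ν 0 2 := by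
  refine ⟨by rintro rfl; simp [AgreeAt₂], fun h =>
    IsMultilinear.ext_of_bounded hL hM hμ hν fun d hd h₁ h₂ x => ?_⟩
  rw [Fin.sum_univ_two] at h₁ h₂
  have := hd 0
  have := hd 1
  have hcases : (d 0 = 0 ∧ d 1 = 0) ∨ (d 0 = 1 ∧ d 1 = 0) ∨ (d 0 = 0 ∧ d 1 = 1) ∨ (d 0 = 2 ∧ d
      1 = 0) ∨ (d 0 = 1 ∧ d 1 = 1) ∨ (d 0 = 0 ∧ d 1 = 2) := by
    omega
  obtain ⟨g1, g2, g3, g4, g5, g6⟩ := h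
  rcases hcases with hc | hc | hc | hc | hc | hc
  exacts [of_vec_2 hc g1 x, of_vec_2 hc g2 x, of_vec_2 hc g3 x, of_vec_2 hc g4 x, of_vec_2 hc g5
    x, of_vec_2 hc g6 x]

theorem ext_2_1 (hL : ∀ i : ℤ, (i < 0 ∨ 2 < i) → ∀ x : L i, x = 0)
    (hM : ∀ i : ℤ, (i < 0 ∨ 2 < i) → ∀ x : M i, x = 0) {μ ν : MMap L M 2 1}
    (hμ : IsMultilinear k μ) (hν : IsMultilinear k ν) : μ = ν ↔
      AgreeAt₂ μ ν 0 0 ∧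
      AgreeAt₂ μ ν 1 0 ∧
      AgreeAt₂ μ ν 0 1 := by
  refine ⟨by rintro rfl; simp [AgreeAt₂], fun h =>
    IsMultilinear.ext_of_bounded hL hM hμ hν fun d hd h₁ h₂ x => ?_⟩
  rw [Fin.sum_univ_two] at h₁ h₂
  have := hd 0
  have := hd 1
  have hcases : (d 0 = 0 ∧ d 1 = 0) ∨ (d 0 = 1 ∧ d 1 = 0) ∨ (d 0 = 0 ∧ d 1 = 1) := by
    omega
  obtain ⟨g1, g2, g3⟩ := h
  rcases hcases with hc | hc | hc
  exacts [of_vec_2 hc g1 x, of_vec_2 hc g2 x, of_vec_2 hc g3 x]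

theorem ext_3_1 (hL : ∀ i : ℤ, (i < 0 ∨ 2 < i) → ∀ x : L i, x = 0)
    (hM : ∀ i : ℤ, (i < 0 ∨ 2 < i) → ∀ x : M i, x = 0) {μ ν : MMap L M 3 1}
    (hμ : IsMultilinear k μ) (hν : IsMultilinear k ν) : μ = ν ↔
      AgreeAt₃ μ ν 0 0 0 ∧
      AgreeAt₃ μ ν 1 0 0 ∧
      AgreeAt₃ μ ν 0 1 0 ∧
      AgreeAt₃ μ ν 0 0 1 := by
  refine ⟨by rintro rfl; simp [AgreeAt₃], fun h =>
    IsMultilinear.ext_of_bounded hL hM hμ hν fun d hd h₁ h₂ x => ?_⟩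
  rw [Fin.sum_univ_three] at h₁ h₂
  have := hd 0
  have := hd 1
  have := hd 2
  have hcases : (d 0 = 0 ∧ d 1 = 0 ∧ d 2 = 0) ∨ (d 0 = 1 ∧ d 1 = 0 ∧ d 2 = 0) ∨ (d 0 = 0 ∧ d 1
      = 1 ∧ d 2 = 0) ∨ (d 0 = 0 ∧ d 1 = 0 ∧ d 2 = 1) := by
    omega
  obtain ⟨g1, g2, g3, g4⟩ := h
  rcases hcases with hc | hc | hc | hc
  exacts [of_vec_3 hc g1 x, of_vec_3 hc g2 x, of_vec_3 hc g3 x, of_vec_3 hc g4 x]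

theorem ext_4_1 (hL : ∀ i : ℤ, (i < 0 ∨ 2 < i) → ∀ x : L i, x = 0)
    (hM : ∀ i : ℤ, (i < 0 ∨ 2 < i) → ∀ x : M i, x = 0) {μ ν : MMap L M 4 1}
    (hμ : IsMultilinear k μ) (hν : IsMultilinear k ν) : μ = ν ↔
      AgreeAt₄ μ ν 0 0 0 0 ∧
      AgreeAt₄ μ ν 1 0 0 0 ∧
      AgreeAt₄ μ ν 0 1 0 0 ∧
      AgreeAt₄ μ ν 0 0 1 0 ∧
      AgreeAt₄ μ ν 0 0 0 1 := by
  refine ⟨by rintro rfl; simp [AgreeAt₄], fun h =>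
    IsMultilinear.ext_of_bounded hL hM hμ hν fun d hd h₁ h₂ x => ?_⟩
  rw [Fin.sum_univ_four] at h₁ h₂
  have := hd 0
  have := hd 1
  have := hd 2
  have := hd 3
  have hcases : (d 0 = 0 ∧ d 1 = 0 ∧ d 2 = 0 ∧ d 3 = 0) ∨ (d 0 = 1 ∧ d 1 = 0 ∧ d 2 = 0 ∧ d 3 =
      0) ∨ (d 0 = 0 ∧ d 1 = 1 ∧ d 2 = 0 ∧ d 3 = 0) ∨ (d 0 = 0 ∧ d 1 = 0 ∧ d 2 = 1 ∧ d 3 = 0) ∨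
      (d 0 = 0 ∧ d 1 = 0 ∧ d 2 = 0 ∧ d 3 = 1) := by
    omega
  obtain ⟨g1, g2, g3, g4, g5⟩ := h
  rcases hcases with hc | hc | hc | hc | hc
  exacts [of_vec_4 hc g1 x, of_vec_4 hc g2 x, of_vec_4 hc g3 x, of_vec_4 hc g4 x, of_vec_4 hc g5
    x]

theorem ext_5_2 (hL : ∀ i : ℤ, (i < 0 ∨ 2 < i) → ∀ x : L i, x = 0)
    (hM : ∀ i : ℤ, (i < 0 ∨ 2 < i) → ∀ x : M i, x = 0) {μ ν : MMap L M 5 2}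
    (hμ : IsMultilinear k μ) (hν : IsMultilinear k ν) : μ = ν ↔
      AgreeAt₅ μ ν 0 0 0 0 0 := by
  refine ⟨by rintro rfl; simp [AgreeAt₅], fun h =>
    IsMultilinear.ext_of_bounded hL hM hμ hν fun d hd h₁ h₂ x => ?_⟩
  rw [Fin.sum_univ_five] at h₁ h₂
  have := hd 0
  have := hd 1
  have := hd 2
  have := hd 3
  have := hd 4
  have hcases : (d 0 = 0 ∧ d 1 = 0 ∧ d 2 = 0 ∧ d 3 = 0 ∧ d 4 = 0) := by
    omega
  exact of_vec_5 hcases h x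

theorem ext_2_2 (hL : ∀ i : ℤ, (i < 0 ∨ 2 < i) → ∀ x : L i, x = 0)
    (hM : ∀ i : ℤ, (i < 0 ∨ 2 < i) → ∀ x : M i, x = 0) {μ ν : MMap L M 2 2}
    (hμ : IsMultilinear k μ) (hν : IsMultilinear k ν) : μ = ν ↔
      AgreeAt₂ μ ν 0 0 := by
  refine ⟨by rintro rfl; simp [AgreeAt₂], fun h =>
    IsMultilinear.ext_of_bounded hL hM hμ hν fun d hd h₁ h₂ x => ?_⟩
  rw [Fin.sum_univ_two] at h₁ h₂
  have := hd 0
  have := hd 1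
  have hcases : (d 0 = 0 ∧ d 1 = 0) := by
    omega
  exact of_vec_2 hcases h x

theorem ext_3_2 (hL : ∀ i : ℤ, (i < 0 ∨ 2 < i) → ∀ x : L i, x = 0)
    (hM : ∀ i : ℤ, (i < 0 ∨ 2 < i) → ∀ x : M i, x = 0) {μ ν : MMap L M 3 2}
    (hμ : IsMultilinear k μ) (hν : IsMultilinear k ν) : μ = ν ↔
      AgreeAt₃ μ ν 0 0 0 := by
  refine ⟨by rintro rfl; simp [AgreeAt₃], fun h =>
    IsMultilinear.ext_of_bounded hL hM hμ hν fun d hd h₁ h₂ x => ?_⟩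
  rw [Fin.sum_univ_three] at h₁ h₂
  have := hd 0
  have := hd 1
  have := hd 2
  have hcases : (d 0 = 0 ∧ d 1 = 0 ∧ d 2 = 0) := by
    omega
  exact of_vec_3 hcases h x

theorem ext_4_2 (hL : ∀ i : ℤ, (i < 0 ∨ 2 < i) → ∀ x : L i, x = 0)
    (hM : ∀ i : ℤ, (i < 0 ∨ 2 < i) → ∀ x : M i, x = 0) {μ ν : MMap L M 4 2}
    (hμ : IsMultilinear k μ) (hν : IsMultilinear k ν) : μ = ν ↔
      AgreeAt₄ μ ν 0 0 0 0 := by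
  refine ⟨by rintro rfl; simp [AgreeAt₄], fun h =>
    IsMultilinear.ext_of_bounded hL hM hμ hν fun d hd h₁ h₂ x => ?_⟩
  rw [Fin.sum_univ_four] at h₁ h₂
  have := hd 0
  have := hd 1
  have := hd 2
  have := hd 3
  have hcases : (d 0 = 0 ∧ d 1 = 0 ∧ d 2 = 0 ∧ d 3 = 0) := by
    omega
  exact of_vec_4 hcases h x

end Extensionality

section StructureMaps

/-- A complex in degrees `0, 1, 2` with multilinear maps of the arities and degrees of the
structure maps of a weak Lie 3-algebra, with no equations imposed. -/
structure StructureMaps (k : Type) [CommRing k] (L : ℤ → Type) [∀ i, AddCommGroup (L i)]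
    [∀ i, Module k (L i)] where
  D : MMap L L 1 (-1)
  l2 : MMap L L 2 0
  l3 : MMap L L 3 1
  l4 : MMap L L 4 2
  l21 : MMap L L 2 1
  l211 : MMap L L 2 2
  l31 : MMap L L 3 2
  l32 : MMap L L 3 2
  linD : IsMultilinear k D
  lin2 : IsMultilinear k l2
  lin3 : IsMultilinear k l3
  lin4 : IsMultilinear k l4
  lin21 : IsMultilinear k l21
  lin211 : IsMultilinear k l211
  lin31 : IsMultilinear k l31
  lin32 : IsMultilinear k l32
  bound : ∀ i : ℤ, (i < 0 ∨ 2 < i) → ∀ x : L i, x = 0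

namespace StructureMaps

variable {k : Type} [CommRing k] {L : ℤ → Type} [∀ i, AddCommGroup (L i)]
  [∀ i, Module k (L i)] (S : StructureMaps k L)

/-- The components of the structure maps in the degrees where they can be nonzero. -/
def ops : Ops (L 0) (L 1) (L 2) where
  d₁ := coeff₁ S.linD 1 0
  d₂ := coeff₁ S.linD 2 1
  m00 := coeff₂ S.lin2 0 0 0
  m10 := coeff₂ S.lin2 1 0 1
  m01 := coeff₂ S.lin2 0 1 1
  m20 := coeff₂ S.lin2 2 0 2
  m11 := coeff₂ S.lin2 1 1 2
  m02 := coeff₂ S.lin2 0 2 2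
  t000 := coeff₃ S.lin3 0 0 0 1
  t100 := coeff₃ S.lin3 1 0 0 2
  t010 := coeff₃ S.lin3 0 1 0 2
  t001 := coeff₃ S.lin3 0 0 1 2
  q := coeff₄ S.lin4 0 0 0 0 2
  s00 := coeff₂ S.lin21 0 0 1
  s10 := coeff₂ S.lin21 1 0 2
  s01 := coeff₂ S.lin21 0 1 2
  r := coeff₂ S.lin211 0 0 2
  u := coeff₃ S.lin31 0 0 0 2
  v := coeff₃ S.lin32 0 0 0 2

theorem ev_D_1 (x : L 1) :
    ev S.D ![1] ![incl 1 x] = incl 0 (S.ops.d₁ x) :=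
  ev_coeff₁ S.linD (by norm_num) x

theorem ev_D_2 (x : L 2) :
    ev S.D ![2] ![incl 2 x] = incl 1 (S.ops.d₂ x) :=
  ev_coeff₁ S.linD (by norm_num) x

theorem ev_l2_00 (x : L 0) (y : L 0) :
    ev S.l2 ![0, 0] ![incl 0 x, incl 0 y] = incl 0 (S.ops.m00 x y) :=
  ev_coeff₂ S.lin2 (by norm_num) x y

theorem ev_l2_10 (x : L 1) (y : L 0) :
    ev S.l2 ![1, 0] ![incl 1 x, incl 0 y] = incl 1 (S.ops.m10 x y) :=
  ev_coeff₂ S.lin2 (by norm_num) x y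

theorem ev_l2_01 (x : L 0) (y : L 1) :
    ev S.l2 ![0, 1] ![incl 0 x, incl 1 y] = incl 1 (S.ops.m01 x y) :=
  ev_coeff₂ S.lin2 (by norm_num) x y

theorem ev_l2_20 (x : L 2) (y : L 0) :
    ev S.l2 ![2, 0] ![incl 2 x, incl 0 y] = incl 2 (S.ops.m20 x y) :=
  ev_coeff₂ S.lin2 (by norm_num) x y

theorem ev_l2_11 (x : L 1) (y : L 1) :
    ev S.l2 ![1, 1] ![incl 1 x, incl 1 y] = incl 2 (S.ops.m11 x y) :=
  ev_coeff₂ S.lin2 (by norm_num) x y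

theorem ev_l2_02 (x : L 0) (y : L 2) :
    ev S.l2 ![0, 2] ![incl 0 x, incl 2 y] = incl 2 (S.ops.m02 x y) :=
  ev_coeff₂ S.lin2 (by norm_num) x y

theorem ev_l3_000 (x : L 0) (y : L 0) (z : L 0) :
    ev S.l3 ![0, 0, 0] ![incl 0 x, incl 0 y, incl 0 z] = incl 1 (S.ops.t000 x y z) :=
  ev_coeff₃ S.lin3 (by norm_num) x y z

theorem ev_l3_100 (x : L 1) (y : L 0) (z : L 0) :
    ev S.l3 ![1, 0, 0] ![incl 1 x, incl 0 y, incl 0 z] = incl 2 (S.ops.t100 x y z) :=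
  ev_coeff₃ S.lin3 (by norm_num) x y z

theorem ev_l3_010 (x : L 0) (y : L 1) (z : L 0) :
    ev S.l3 ![0, 1, 0] ![incl 0 x, incl 1 y, incl 0 z] = incl 2 (S.ops.t010 x y z) :=
  ev_coeff₃ S.lin3 (by norm_num) x y z

theorem ev_l3_001 (x : L 0) (y : L 0) (z : L 1) :
    ev S.l3 ![0, 0, 1] ![incl 0 x, incl 0 y, incl 1 z] = incl 2 (S.ops.t001 x y z) :=
  ev_coeff₃ S.lin3 (by norm_num) x y z

theorem ev_l4_0000 (x : L 0) (y : L 0) (z : L 0) (w : L 0) :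
    ev S.l4 ![0, 0, 0, 0] ![incl 0 x, incl 0 y, incl 0 z, incl 0 w] = incl 2 (S.ops.q x y z w) :=
  ev_coeff₄ S.lin4 (by norm_num) x y z w

theorem ev_l21_00 (x : L 0) (y : L 0) :
    ev S.l21 ![0, 0] ![incl 0 x, incl 0 y] = incl 1 (S.ops.s00 x y) :=
  ev_coeff₂ S.lin21 (by norm_num) x y

theorem ev_l21_10 (x : L 1) (y : L 0) :
    ev S.l21 ![1, 0] ![incl 1 x, incl 0 y] = incl 2 (S.ops.s10 x y) :=
  ev_coeff₂ S.lin21 (by norm_num) x y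

theorem ev_l21_01 (x : L 0) (y : L 1) :
    ev S.l21 ![0, 1] ![incl 0 x, incl 1 y] = incl 2 (S.ops.s01 x y) :=
  ev_coeff₂ S.lin21 (by norm_num) x y

theorem ev_l211_00 (x : L 0) (y : L 0) :
    ev S.l211 ![0, 0] ![incl 0 x, incl 0 y] = incl 2 (S.ops.r x y) :=
  ev_coeff₂ S.lin211 (by norm_num) x y

theorem ev_l31_000 (x : L 0) (y : L 0) (z : L 0) :
    ev S.l31 ![0, 0, 0] ![incl 0 x, incl 0 y, incl 0 z] = incl 2 (S.ops.u x y z) :=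
  ev_coeff₃ S.lin31 (by norm_num) x y z

theorem ev_l32_000 (x : L 0) (y : L 0) (z : L 0) :
    ev S.l32 ![0, 0, 0] ![incl 0 x, incl 0 y, incl 0 z] = incl 2 (S.ops.v x y z) :=
  ev_coeff₃ S.lin32 (by norm_num) x y z

theorem ev_D_eq_zero (X : Fin 1 → ∀ i, L i) :
    ev S.D ![0] X = 0 := by
  exact ev_eq_zero_of_degree S.bound _ _ _ (by decide)

theorem ev_l2_eq_zero (X : Fin 2 → ∀ i, L i) :
    ev S.l2 ![2, 1] X = 0 ∧ ev S.l2 ![1, 2] X = 0 := by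
  refine ⟨?_, ?_⟩ <;> exact ev_eq_zero_of_degree S.bound _ _ _ (by decide)

theorem ev_l3_eq_zero (X : Fin 3 → ∀ i, L i) :
    ev S.l3 ![2, 0, 0] X = 0 ∧ ev S.l3 ![0, 2, 0] X = 0 ∧ ev S.l3 ![0, 0, 2] X = 0 ∧
    ev S.l3 ![1, 1, 0] X = 0 ∧ ev S.l3 ![1, 0, 1] X = 0 ∧ ev S.l3 ![0, 1, 1] X = 0 := by
  refine ⟨?_, ?_, ?_, ?_, ?_, ?_⟩ <;> exact ev_eq_zero_of_degree S.bound _ _ _ (by decide)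

theorem ev_l4_eq_zero (X : Fin 4 → ∀ i, L i) :
    ev S.l4 ![1, 0, 0, 0] X = 0 ∧ ev S.l4 ![0, 1, 0, 0] X = 0 ∧ ev S.l4 ![0, 0, 1, 0] X = 0 ∧
    ev S.l4 ![0, 0, 0, 1] X = 0 := by
  refine ⟨?_, ?_, ?_, ?_⟩ <;> exact ev_eq_zero_of_degree S.bound _ _ _ (by decide)

theorem ev_l21_eq_zero (X : Fin 2 → ∀ i, L i) :
    ev S.l21 ![2, 0] X = 0 ∧ ev S.l21 ![1, 1] X = 0 ∧ ev S.l21 ![0, 2] X = 0 := by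
  refine ⟨?_, ?_, ?_⟩ <;> exact ev_eq_zero_of_degree S.bound _ _ _ (by decide)

theorem ev_l211_eq_zero (X : Fin 2 → ∀ i, L i) :
    ev S.l211 ![1, 0] X = 0 ∧ ev S.l211 ![0, 1] X = 0 := by
  refine ⟨?_, ?_⟩ <;> exact ev_eq_zero_of_degree S.bound _ _ _ (by decide)

theorem ev_l31_eq_zero (X : Fin 3 → ∀ i, L i) :
    ev S.l31 ![1, 0, 0] X = 0 ∧ ev S.l31 ![0, 1, 0] X = 0 ∧ ev S.l31 ![0, 0, 1] X = 0 := by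
  refine ⟨?_, ?_, ?_⟩ <;> exact ev_eq_zero_of_degree S.bound _ _ _ (by decide)

theorem ev_l32_eq_zero (X : Fin 3 → ∀ i, L i) :
    ev S.l32 ![1, 0, 0] X = 0 ∧ ev S.l32 ![0, 1, 0] X = 0 ∧ ev S.l32 ![0, 0, 1] X = 0 := by
  refine ⟨?_, ?_, ?_⟩ <;> exact ev_eq_zero_of_degree S.bound _ _ _ (by decide)

end StructureMaps

end StructureMaps

attribute [local simp] bd_1 bd_2 bd_3 bd_4 ev_fc1_1 ev_fc1_2 ev_fc1_3 ev_fc1_4 ev_P12_2 ev_P12_3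
  ev_P12_4 ev_P12_5 ev_P23_3 ev_P23_4 ev_P23_5 ev_P34_4 ev_P34_5 ev_P123_3 ev_P123_4 ev_P123_5
  ev_P132_3 ev_P132_4 ev_P132_5 ev_P13_4 ev_P234_5 ev_P243_5 ev_P1234_5 ev_P1432_5 ev_P1342_5
  ev_P13P24_5 koszulSign_eq_one_two koszulSign_eq_one_three koszulSign_eq_one_four
  koszulSign_eq_one_five koszulSign_11_P12 koszulSign_110_P12 koszulSign_101_P12 koszulSign_011_P12
  ev_pc_0_1_0 ev_pc_0_1_1 ev_pc_1_1_0 ev_pc_0_1_2 ev_pc_1_1_1 ev_pc_2_1_0 ev_pc_0_1_3 ev_pc_1_1_2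
  ev_pc_2_1_1 ev_pc_3_1_0 ev_pc_0_2_1 ev_pc_1_2_0 ev_pc_0_2_2 ev_pc_1_2_1 ev_pc_2_2_0 ev_pc_0_2_3
  ev_pc_1_2_2 ev_pc_2_2_1 ev_pc_3_2_0 ev_pc_0_3_1 ev_pc_1_3_0 ev_pc_0_3_2 ev_pc_1_3_1 ev_pc_2_3_0
  ev_pc_0_4_1 ev_pc_1_4_0 StructureMaps.ev_D_1 StructureMaps.ev_D_2 StructureMaps.ev_l2_00
  StructureMaps.ev_l2_10 StructureMaps.ev_l2_01 StructureMaps.ev_l2_20 StructureMaps.ev_l2_11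
  StructureMaps.ev_l2_02 StructureMaps.ev_l3_000 StructureMaps.ev_l3_100 StructureMaps.ev_l3_010
  StructureMaps.ev_l3_001 StructureMaps.ev_l4_0000 StructureMaps.ev_l21_00 StructureMaps.ev_l21_10
  StructureMaps.ev_l21_01 StructureMaps.ev_l211_00 StructureMaps.ev_l31_000
  StructureMaps.ev_l32_000 StructureMaps.ev_D_eq_zero StructureMaps.ev_l2_eq_zero
  StructureMaps.ev_l3_eq_zero StructureMaps.ev_l4_eq_zero StructureMaps.ev_l21_eq_zero
  StructureMaps.ev_l211_eq_zero StructureMaps.ev_l31_eq_zero StructureMaps.ev_l32_eq_zero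

theorem ev_eq_iff {M : ℤ → Type} [∀ i, AddCommGroup (M i)] {P Q : ∀ i, M i} {c : ℤ}
    {a b : M c} (h : P - Q = incl c (a - b)) : P = Q ↔ a = b := by
  rw [← sub_eq_zero, h, map_eq_zero_iff _ (incl_injective c), sub_eq_zero]

theorem ev_eq_iff_symm {M : ℤ → Type} [∀ i, AddCommGroup (M i)] {P Q : ∀ i, M i} {c : ℤ}
    {a b : M c} (h : P - Q = incl c (b - a)) : P = Q ↔ a = b :=
  (ev_eq_iff h).trans eq_comm

section Components

set_option linter.unusedSimpArgs false

variable {k : Type} [CommRing k] {L : ℤ → Type} [∀ i, AddCommGroup (L i)]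
  [∀ i, Module k (L i)] {S : StructureMaps k L}

namespace StructureMaps

theorem eqL1_iff : bd (-1) S.D S.D S.l2 = 0 ↔
      (∀ x y, S.ops.d₁ (S.ops.m10 x y) = S.ops.m00 (S.ops.d₁ x) y) ∧
      (∀ x y, S.ops.d₁ (S.ops.m01 x y) = S.ops.m00 x (S.ops.d₁ y)) ∧
      (∀ x y, S.ops.d₂ (S.ops.m20 x y) = S.ops.m10 (S.ops.d₂ x) y) ∧
      (∀ x y, S.ops.d₂ (S.ops.m11 x y) = S.ops.m01 (S.ops.d₁ x) y - S.ops.m10 x (S.ops.d₁ y)) ∧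
      (∀ x y, S.ops.d₂ (S.ops.m02 x y) = S.ops.m01 x (S.ops.d₂ y)) ∧
      (∀ x y, S.ops.m11 (S.ops.d₂ x) y + S.ops.m20 x (S.ops.d₁ y) = 0) ∧
      (∀ x y, S.ops.m02 (S.ops.d₁ x) y - S.ops.m11 x (S.ops.d₂ y) = 0) := by
  refine (ext_2_neg_one (k := k) S.bound S.bound ?_ ?_).trans (and_congr
    (forall₂_congr fun x y => ?_) (and_congr (forall₂_congr fun x y => ?_) (and_congr
    (forall₂_congr fun x y => ?_) (and_congr (forall₂_congr fun x y => ?_) (and_congr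
    (forall₂_congr fun x y => ?_) (and_congr (forall₂_congr fun x y => ?_)
    (forall₂_congr fun x y => ?_)))))))
  iterate 2
    · with_reducible repeat' first
        | exact S.lin2 | exact S.linD
        | apply IsMultilinear.bd | apply IsMultilinear.zero
  all_goals first
    | (refine ev_eq_iff ?_; simp [S.linD.ev_zero_1_1, S.lin2.ev_zero_2_1,
      S.lin2.ev_zero_2_2] <;> abel1)
    | (refine ev_eq_iff_symm ?_; simp [S.linD.ev_zero_1_1, S.lin2.ev_zero_2_1,
      S.lin2.ev_zero_2_2] <;> abel1)

theorem eqL2_iff : bd 0 S.D S.D S.l3 =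
    pc 0 1 0 S.l2 S.l2 - pc 0 0 1 S.l2 S.l2 - pa (P12 3) (pc 0 1 0 S.l2 S.l2) ↔
      (∀ x y z, S.ops.d₁ (S.ops.t000 x y z)
    = S.ops.m00 x (S.ops.m00 y z) - S.ops.m00 (S.ops.m00 x y) z - S.ops.m00 y (S.ops.m00 x z)) ∧
      (∀ x y z, S.ops.d₂ (S.ops.t100 x y z) + S.ops.t000 (S.ops.d₁ x) y z
    = S.ops.m10 x (S.ops.m00 y z) - S.ops.m10 (S.ops.m10 x y) z - S.ops.m01 y (S.ops.m10 x z)) ∧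
      (∀ x y z, S.ops.d₂ (S.ops.t010 x y z) + S.ops.t000 x (S.ops.d₁ y) z
    = S.ops.m01 x (S.ops.m10 y z) - S.ops.m10 (S.ops.m01 x y) z - S.ops.m10 y (S.ops.m00 x z)) ∧
      (∀ x y z, S.ops.d₂ (S.ops.t001 x y z) + S.ops.t000 x y (S.ops.d₁ z)
    = S.ops.m01 x (S.ops.m01 y z) - S.ops.m01 (S.ops.m00 x y) z - S.ops.m01 y (S.ops.m01 x z)) ∧
      (∀ x y z, S.ops.t100 (S.ops.d₂ x) y z
    = S.ops.m20 x (S.ops.m00 y z) - S.ops.m20 (S.ops.m20 x y) z - S.ops.m02 y (S.ops.m20 x z)) ∧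
      (∀ x y z, S.ops.t010 x (S.ops.d₂ y) z
    = S.ops.m02 x (S.ops.m20 y z) - S.ops.m20 (S.ops.m02 x y) z - S.ops.m20 y (S.ops.m00 x z)) ∧
      (∀ x y z, S.ops.t001 x y (S.ops.d₂ z)
    = S.ops.m02 x (S.ops.m02 y z) - S.ops.m02 (S.ops.m00 x y) z - S.ops.m02 y (S.ops.m02 x z)) ∧
      (∀ x y z, S.ops.t010 (S.ops.d₁ x) y z - S.ops.t100 x (S.ops.d₁ y) z
    = S.ops.m11 x (S.ops.m10 y z) - S.ops.m20 (S.ops.m11 x y) z + S.ops.m11 y (S.ops.m10 x z)) ∧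
      (∀ x y z, S.ops.t001 (S.ops.d₁ x) y z - S.ops.t100 x y (S.ops.d₁ z)
    = S.ops.m11 x (S.ops.m01 y z) - S.ops.m11 (S.ops.m10 x y) z - S.ops.m02 y (S.ops.m11 x z)) ∧
      (∀ x y z, S.ops.t001 x (S.ops.d₁ y) z - S.ops.t010 x y (S.ops.d₁ z)
    = S.ops.m02 x (S.ops.m11 y z) - S.ops.m11 (S.ops.m01 x y) z - S.ops.m11 y (S.ops.m01 x z)) := by
  refine (ext_3_0 (k := k) S.bound S.bound ?_ ?_).trans (and_congr (forall₃_congr fun x y z => ?_)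
    (and_congr (forall₃_congr fun x y z => ?_) (and_congr (forall₃_congr fun x y z => ?_)
    (and_congr (forall₃_congr fun x y z => ?_) (and_congr (forall₃_congr fun x y z => ?_)
    (and_congr (forall₃_congr fun x y z => ?_) (and_congr (forall₃_congr fun x y z => ?_)
    (and_congr (forall₃_congr fun x y z => ?_) (and_congr (forall₃_congr fun x y z => ?_)
    (forall₃_congr fun x y z => ?_))))))))))
  iterate 2
    · with_reducible repeat' first
        | exact S.lin2 | exact S.lin3 | exact S.linD
        | apply IsMultilinear.bd | apply IsMultilinear.sub | apply IsMultilinear.pa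
          | apply IsMultilinear.pc
  all_goals
    refine ev_eq_iff ?_
    simp [S.linD.ev_zero_1_1, S.lin2.ev_zero_2_1, S.lin2.ev_zero_2_2, S.lin3.ev_zero_3_1,
      S.lin3.ev_zero_3_2, S.lin3.ev_zero_3_3] <;> abel1

theorem eqL3_iff : bd 1 S.D S.D S.l4 =
    pc 1 0 1 S.l2 S.l3 + pc 1 1 0 S.l2 S.l3 - pa (P12 4) (pc 1 1 0 S.l2 S.l3)
      + pa (P123 4) (pc 1 1 0 S.l2 S.l3) - pc 1 0 2 S.l3 S.l2
      + pc 1 1 1 S.l3 S.l2 - pa (P12 4) (pc 1 1 1 S.l3 S.l2)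
      - pc 1 2 0 S.l3 S.l2 + pa (P23 4) (pc 1 2 0 S.l3 S.l2) - pa (P132 4) (pc 1 2 0 S.l3 S.l2) ↔
      (∀ x y z w, S.ops.d₂ (S.ops.q x y z w)
    = S.ops.m10 (S.ops.t000 x y z) w + S.ops.m01 x (S.ops.t000 y z w) - S.ops.m01 y
      (S.ops.t000 x z w)
      + S.ops.m01 z (S.ops.t000 x y w) - S.ops.t000 (S.ops.m00 x y) z w + S.ops.t000 x
        (S.ops.m00 y z) w
      - S.ops.t000 y (S.ops.m00 x z) w - S.ops.t000 x y (S.ops.m00 z w) + S.ops.t000 x z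
        (S.ops.m00 y w)
      - S.ops.t000 y z (S.ops.m00 x w)) ∧
      (∀ x y z w, - S.ops.q (S.ops.d₁ x) y z w
    = S.ops.m20 (S.ops.t100 x y z) w - S.ops.m11 x (S.ops.t000 y z w) - S.ops.m02 y
      (S.ops.t100 x z w)
      + S.ops.m02 z (S.ops.t100 x y w) - S.ops.t100 (S.ops.m10 x y) z w + S.ops.t100 x
        (S.ops.m00 y z) w
      - S.ops.t010 y (S.ops.m10 x z) w - S.ops.t100 x y (S.ops.m00 z w) + S.ops.t100 x z
        (S.ops.m00 y w)
      - S.ops.t001 y z (S.ops.m10 x w)) ∧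
      (∀ x y z w, - S.ops.q x (S.ops.d₁ y) z w
    = S.ops.m20 (S.ops.t010 x y z) w + S.ops.m02 x (S.ops.t100 y z w) + S.ops.m11 y
      (S.ops.t000 x z w)
      + S.ops.m02 z (S.ops.t010 x y w) - S.ops.t100 (S.ops.m01 x y) z w + S.ops.t010 x
        (S.ops.m10 y z) w
      - S.ops.t100 y (S.ops.m00 x z) w - S.ops.t010 x y (S.ops.m00 z w) + S.ops.t001 x z
        (S.ops.m10 y w)
      - S.ops.t100 y z (S.ops.m00 x w)) ∧
      (∀ x y z w, - S.ops.q x y (S.ops.d₁ z) w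
    = S.ops.m20 (S.ops.t001 x y z) w + S.ops.m02 x (S.ops.t010 y z w) - S.ops.m02 y
      (S.ops.t010 x z w)
      - S.ops.m11 z (S.ops.t000 x y w) - S.ops.t010 (S.ops.m00 x y) z w + S.ops.t010 x
        (S.ops.m01 y z) w
      - S.ops.t010 y (S.ops.m01 x z) w - S.ops.t001 x y (S.ops.m10 z w) + S.ops.t010 x z
        (S.ops.m00 y w)
      - S.ops.t010 y z (S.ops.m00 x w)) ∧
      (∀ x y z w, - S.ops.q x y z (S.ops.d₁ w)
    = S.ops.m11 (S.ops.t000 x y z) w + S.ops.m02 x (S.ops.t001 y z w) - S.ops.m02 y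
      (S.ops.t001 x z w)
      + S.ops.m02 z (S.ops.t001 x y w) - S.ops.t001 (S.ops.m00 x y) z w + S.ops.t001 x
        (S.ops.m00 y z) w
      - S.ops.t001 y (S.ops.m00 x z) w - S.ops.t001 x y (S.ops.m01 z w) + S.ops.t001 x z
        (S.ops.m01 y w)
      - S.ops.t001 y z (S.ops.m01 x w)) := by
  refine (ext_4_1 (k := k) S.bound S.bound ?_ ?_).trans (and_congr
    (forall₄_congr fun x y z w => ?_) (and_congr (forall₄_congr fun x y z w => ?_) (and_congr
    (forall₄_congr fun x y z w => ?_) (and_congr (forall₄_congr fun x y z w => ?_)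
    (forall₄_congr fun x y z w => ?_)))))
  iterate 2
    · with_reducible repeat' first
        | exact S.lin2 | exact S.lin3 | exact S.lin4 | exact S.linD
        | apply IsMultilinear.bd | apply IsMultilinear.add | apply IsMultilinear.sub
          | apply IsMultilinear.pa | apply IsMultilinear.pc
  all_goals
    refine ev_eq_iff ?_
    simp [S.linD.ev_zero_1_1, S.lin2.ev_zero_2_1, S.lin2.ev_zero_2_2, S.lin3.ev_zero_3_1,
      S.lin3.ev_zero_3_2, S.lin3.ev_zero_3_3, S.lin4.ev_zero_4_1, S.lin4.ev_zero_4_2,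
      S.lin4.ev_zero_4_3, S.lin4.ev_zero_4_4] <;> abel1

theorem eqL4_iff : (0 : MMap L L 5 2) =
    pc 2 0 1 S.l2 S.l4 - pc 2 1 0 S.l2 S.l4 + pa (P12 5) (pc 2 1 0 S.l2 S.l4)
      - pa (P123 5) (pc 2 1 0 S.l2 S.l4) + pa (P1234 5) (pc 2 1 0 S.l2 S.l4)
      + pc 2 0 2 S.l3 S.l3 + pc 2 1 1 S.l3 S.l3 - pa (P12 5) (pc 2 1 1 S.l3 S.l3)
      + pa (P123 5) (pc 2 1 1 S.l3 S.l3) + pc 2 2 0 S.l3 S.l3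
      - pa (P23 5) (pc 2 2 0 S.l3 S.l3) + pa (P132 5) (pc 2 2 0 S.l3 S.l3)
      + pa (P234 5) (pc 2 2 0 S.l3 S.l3) - pa (P1342 5) (pc 2 2 0 S.l3 S.l3)
      + pa (P13P24 5) (pc 2 2 0 S.l3 S.l3)
      + pc 2 0 3 S.l4 S.l2 - pc 2 1 2 S.l4 S.l2 + pa (P12 5) (pc 2 1 2 S.l4 S.l2)
      + pc 2 2 1 S.l4 S.l2 - pa (P23 5) (pc 2 2 1 S.l4 S.l2) + pa (P132 5) (pc 2 2 1 S.l4 S.l2)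
      - pc 2 3 0 S.l4 S.l2 + pa (P34 5) (pc 2 3 0 S.l4 S.l2) - pa (P243 5) (pc 2 3 0 S.l4 S.l2)
      + pa (P1432 5) (pc 2 3 0 S.l4 S.l2) ↔
      ∀ x y z w e, 0 = S.ops.m20 (S.ops.q x y z w) e - S.ops.m02 x (S.ops.q y z w e)
      + S.ops.m02 y (S.ops.q x z w e) - S.ops.m02 z (S.ops.q x y w e) + S.ops.m02 w
        (S.ops.q x y z e)
      + S.ops.t100 (S.ops.t000 x y z) w e + S.ops.t010 x (S.ops.t000 y z w) e - S.ops.t010 y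
        (S.ops.t000 x z w) e
      + S.ops.t010 z (S.ops.t000 x y w) e + S.ops.t001 x y (S.ops.t000 z w e) - S.ops.t001 x z
        (S.ops.t000 y w e)
      + S.ops.t001 y z (S.ops.t000 x w e) + S.ops.t001 x w (S.ops.t000 y z e) - S.ops.t001 y w
        (S.ops.t000 x z e)
      + S.ops.t001 z w (S.ops.t000 x y e)
      + S.ops.q (S.ops.m00 x y) z w e - S.ops.q x (S.ops.m00 y z) w e + S.ops.q y
        (S.ops.m00 x z) w e
      + S.ops.q x y (S.ops.m00 z w) e - S.ops.q x z (S.ops.m00 y w) e + S.ops.q y z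
        (S.ops.m00 x w) e
      - S.ops.q x y z (S.ops.m00 w e) + S.ops.q x y w (S.ops.m00 z e) - S.ops.q x z w
        (S.ops.m00 y e)
      + S.ops.q y z w (S.ops.m00 x e) := by
  refine (ext_5_2 (k := k) S.bound S.bound ?_ ?_).trans (forall₅_congr fun x y z w e => ?_)
  iterate 2
    · with_reducible repeat' first
        | exact S.lin2 | exact S.lin3 | exact S.lin4
        | apply IsMultilinear.add | apply IsMultilinear.sub | apply IsMultilinear.pa
          | apply IsMultilinear.pc | apply IsMultilinear.zero
  all_goals
    refine ev_eq_iff ?_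
    simp [S.lin2.ev_zero_2_1, S.lin2.ev_zero_2_2, S.lin3.ev_zero_3_1, S.lin3.ev_zero_3_2,
      S.lin3.ev_zero_3_3, S.lin4.ev_zero_4_1, S.lin4.ev_zero_4_2, S.lin4.ev_zero_4_3,
      S.lin4.ev_zero_4_4]

theorem w1_iff : bd 0 S.D S.D S.l21 = S.l2 + pa (P12 2) S.l2 ↔
      (∀ x y, S.ops.d₁ (S.ops.s00 x y) = S.ops.m00 x y + S.ops.m00 y x) ∧
      (∀ x y, S.ops.d₂ (S.ops.s10 x y) + S.ops.s00 (S.ops.d₁ x) y = S.ops.m10 x y + S.ops.m01 y x) ∧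
      (∀ x y, S.ops.d₂ (S.ops.s01 x y) + S.ops.s00 x (S.ops.d₁ y) = S.ops.m01 x y + S.ops.m10 y x) ∧
      (∀ x y, S.ops.s10 (S.ops.d₂ x) y = S.ops.m20 x y + S.ops.m02 y x) ∧
      (∀ x y, S.ops.s01 (S.ops.d₁ x) y - S.ops.s10 x (S.ops.d₁ y) = S.ops.m11 x y - S.ops.m11 y x) ∧
      (∀ x y, S.ops.s01 x (S.ops.d₂ y) = S.ops.m02 x y + S.ops.m20 y x) := by
  refine (ext_2_0 (k := k) S.bound S.bound ?_ ?_).trans (and_congr (forall₂_congr fun x y => ?_)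
    (and_congr (forall₂_congr fun x y => ?_) (and_congr (forall₂_congr fun x y => ?_) (and_congr
    (forall₂_congr fun x y => ?_) (and_congr (forall₂_congr fun x y => ?_)
    (forall₂_congr fun x y => ?_))))))
  iterate 2
    · with_reducible repeat' first
        | exact S.lin2 | exact S.lin21 | exact S.linD
        | apply IsMultilinear.bd | apply IsMultilinear.add | apply IsMultilinear.pa
  all_goals
    refine ev_eq_iff ?_
    simp [S.linD.ev_zero_1_1, S.lin2.ev_zero_2_1, S.lin2.ev_zero_2_2, S.lin21.ev_zero_2_1,
      S.lin21.ev_zero_2_2] <;> abel1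

theorem w2_iff : bd 1 S.D S.D S.l211 = S.l21 - pa (P12 2) S.l21 ↔
      (∀ x y, S.ops.d₂ (S.ops.r x y) = S.ops.s00 x y - S.ops.s00 y x) ∧
      (∀ x y, - S.ops.r (S.ops.d₁ x) y = S.ops.s10 x y - S.ops.s01 y x) ∧
      (∀ x y, - S.ops.r x (S.ops.d₁ y) = S.ops.s01 x y - S.ops.s10 y x) := by
  refine (ext_2_1 (k := k) S.bound S.bound ?_ ?_).trans (and_congr (forall₂_congr fun x y => ?_)
    (and_congr (forall₂_congr fun x y => ?_) (forall₂_congr fun x y => ?_)))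
  iterate 2
    · with_reducible repeat' first
        | exact S.lin21 | exact S.lin211 | exact S.linD
        | apply IsMultilinear.bd | apply IsMultilinear.sub | apply IsMultilinear.pa
  all_goals
    refine ev_eq_iff ?_
    simp [S.linD.ev_zero_1_1, S.lin21.ev_zero_2_1, S.lin21.ev_zero_2_2, S.lin211.ev_zero_2_1,
      S.lin211.ev_zero_2_2]

theorem w3_iff : bd 1 S.D S.D S.l31 = S.l3 + pa (P12 3) S.l3 + pc 1 0 1 S.l2 S.l21 ↔
      (∀ x y z, S.ops.d₂ (S.ops.u x y z)
    = S.ops.t000 x y z + S.ops.t000 y x z + S.ops.m10 (S.ops.s00 x y) z) ∧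
      (∀ x y z, - S.ops.u (S.ops.d₁ x) y z
    = S.ops.t100 x y z + S.ops.t010 y x z + S.ops.m20 (S.ops.s10 x y) z) ∧
      (∀ x y z, - S.ops.u x (S.ops.d₁ y) z
    = S.ops.t010 x y z + S.ops.t100 y x z + S.ops.m20 (S.ops.s01 x y) z) ∧
      (∀ x y z, - S.ops.u x y (S.ops.d₁ z)
    = S.ops.t001 x y z + S.ops.t001 y x z + S.ops.m11 (S.ops.s00 x y) z) := by
  refine (ext_3_1 (k := k) S.bound S.bound ?_ ?_).trans (and_congr (forall₃_congr fun x y z => ?_)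
    (and_congr (forall₃_congr fun x y z => ?_) (and_congr (forall₃_congr fun x y z => ?_)
    (forall₃_congr fun x y z => ?_))))
  iterate 2
    · with_reducible repeat' first
        | exact S.lin2 | exact S.lin21 | exact S.lin3 | exact S.lin31 | exact S.linD
        | apply IsMultilinear.bd | apply IsMultilinear.add | apply IsMultilinear.pa
          | apply IsMultilinear.pc
  all_goals
    refine ev_eq_iff ?_
    simp [S.linD.ev_zero_1_1, S.lin2.ev_zero_2_1, S.lin2.ev_zero_2_2, S.lin3.ev_zero_3_1,
      S.lin3.ev_zero_3_2, S.lin3.ev_zero_3_3, S.lin21.ev_zero_2_1, S.lin21.ev_zero_2_2,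
      S.lin31.ev_zero_3_1, S.lin31.ev_zero_3_2, S.lin31.ev_zero_3_3]

theorem w4_iff : bd 1 S.D S.D S.l32 = S.l3 + pa
  (P23 3) S.l3 - pc 1 1 0 S.l2 S.l21 + pc 1 0 1 S.l21 S.l2
        + pa (P12 3) (pc 1 1 0 S.l21 S.l2) ↔
      (∀ x y z, S.ops.d₂ (S.ops.v x y z)
    = S.ops.t000 x y z + S.ops.t000 x z y - S.ops.m01 x (S.ops.s00 y z) + S.ops.s00
      (S.ops.m00 x y) z
      + S.ops.s00 y (S.ops.m00 x z)) ∧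
      (∀ x y z, - S.ops.v (S.ops.d₁ x) y z
    = S.ops.t100 x y z + S.ops.t100 x z y + S.ops.m11 x (S.ops.s00 y z) + S.ops.s10
      (S.ops.m10 x y) z
      + S.ops.s01 y (S.ops.m10 x z)) ∧
      (∀ x y z, - S.ops.v x (S.ops.d₁ y) z
    = S.ops.t010 x y z + S.ops.t001 x z y - S.ops.m02 x (S.ops.s10 y z) + S.ops.s10
      (S.ops.m01 x y) z
      + S.ops.s10 y (S.ops.m00 x z)) ∧
      (∀ x y z, - S.ops.v x y (S.ops.d₁ z)
    = S.ops.t001 x y z + S.ops.t010 x z y - S.ops.m02 x (S.ops.s01 y z) + S.ops.s01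
      (S.ops.m00 x y) z
      + S.ops.s01 y (S.ops.m01 x z)) := by
  refine (ext_3_1 (k := k) S.bound S.bound ?_ ?_).trans (and_congr (forall₃_congr fun x y z => ?_)
    (and_congr (forall₃_congr fun x y z => ?_) (and_congr (forall₃_congr fun x y z => ?_)
    (forall₃_congr fun x y z => ?_))))
  iterate 2
    · with_reducible repeat' first
        | exact S.lin2 | exact S.lin21 | exact S.lin3 | exact S.lin32 | exact S.linD
        | apply IsMultilinear.bd | apply IsMultilinear.add | apply IsMultilinear.sub
          | apply IsMultilinear.pa | apply IsMultilinear.pc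
  all_goals
    refine ev_eq_iff ?_
    simp [S.linD.ev_zero_1_1, S.lin2.ev_zero_2_1, S.lin2.ev_zero_2_2, S.lin3.ev_zero_3_1,
      S.lin3.ev_zero_3_2, S.lin3.ev_zero_3_3, S.lin21.ev_zero_2_1, S.lin21.ev_zero_2_2,
      S.lin32.ev_zero_3_1, S.lin32.ev_zero_3_2, S.lin32.ev_zero_3_3]

theorem w5_iff : S.l211 + pa (P12 2) S.l211 = 0 ↔
      ∀ x y, S.ops.r x y + S.ops.r y x = 0 := by
  refine (ext_2_2 (k := k) S.bound S.bound ?_ ?_).trans (forall₂_congr fun x y => ?_)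
  iterate 2
    · with_reducible repeat' first
        | exact S.lin211
        | apply IsMultilinear.add | apply IsMultilinear.pa | apply IsMultilinear.zero
  all_goals
    refine ev_eq_iff ?_
    simp [S.lin211.ev_zero_2_1, S.lin211.ev_zero_2_2]

theorem w6_iff : S.l31 - pa (P12 3) S.l31 = pc 2 0 1 S.l2 S.l211 ↔
      ∀ x y z, S.ops.u x y z - S.ops.u y x z = S.ops.m20 (S.ops.r x y) z := by
  refine (ext_3_2 (k := k) S.bound S.bound ?_ ?_).trans (forall₃_congr fun x y z => ?_)
  iterate 2
    · with_reducible repeat' first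
        | exact S.lin2 | exact S.lin211 | exact S.lin31
        | apply IsMultilinear.sub | apply IsMultilinear.pa | apply IsMultilinear.pc
  all_goals
    refine ev_eq_iff ?_
    simp [S.lin2.ev_zero_2_1, S.lin2.ev_zero_2_2, S.lin211.ev_zero_2_1, S.lin211.ev_zero_2_2,
      S.lin31.ev_zero_3_1, S.lin31.ev_zero_3_2, S.lin31.ev_zero_3_3]

theorem w7_iff : S.l31 - pa (P12 3) S.l32 + pa (P132 3) S.l31 - S.l32 + pa (P23 3) S.l31 - pa
  (P123 3) S.l32
        = pc 2 1 0 S.l21 S.l21 + pc 2 0 1 S.l21 S.l21 + pa (P12 3) (pc 2 1 0 S.l21 S.l21)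
          + pa (P132 3) (pc 2 1 0 S.l211 S.l2) ↔
      ∀ x y z, S.ops.u x y z - S.ops.v y x z + S.ops.u y z x - S.ops.v x y z + S.ops.u x z y - S.ops.v z x y
    = S.ops.s01 x (S.ops.s00 y z) + S.ops.s10 (S.ops.s00 x y) z + S.ops.s01 y
      (S.ops.s00 x z) + S.ops.r y (S.ops.m00 z x) := by
  refine (ext_3_2 (k := k) S.bound S.bound ?_ ?_).trans (forall₃_congr fun x y z => ?_)
  iterate 2
    · with_reducible repeat' first
        | exact S.lin2 | exact S.lin21 | exact S.lin211 | exact S.lin31 | exact S.lin32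
        | apply IsMultilinear.add | apply IsMultilinear.sub | apply IsMultilinear.pa
          | apply IsMultilinear.pc
  all_goals
    refine ev_eq_iff ?_
    simp [S.lin2.ev_zero_2_1, S.lin2.ev_zero_2_2, S.lin21.ev_zero_2_1, S.lin21.ev_zero_2_2,
      S.lin211.ev_zero_2_1, S.lin211.ev_zero_2_2, S.lin31.ev_zero_3_1, S.lin31.ev_zero_3_2,
      S.lin31.ev_zero_3_3, S.lin32.ev_zero_3_1, S.lin32.ev_zero_3_2, S.lin32.ev_zero_3_3]

theorem w8_iff : S.l32 - pa (P23 3) S.l32 = - pc 2 1 0 S.l2 S.l211 + pc 2 0 1 S.l211 S.l2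
        + pa (P12 3) (pc 2 1 0 S.l211 S.l2) ↔
      ∀ x y z, S.ops.v x y z - S.ops.v x z y
    = - S.ops.m02 x (S.ops.r y z) + S.ops.r (S.ops.m00 x y) z + S.ops.r y (S.ops.m00 x z) := by
  refine (ext_3_2 (k := k) S.bound S.bound ?_ ?_).trans (forall₃_congr fun x y z => ?_)
  iterate 2
    · with_reducible repeat' first
        | exact S.lin2 | exact S.lin211 | exact S.lin32
        | apply IsMultilinear.add | apply IsMultilinear.sub | apply IsMultilinear.neg
          | apply IsMultilinear.pa | apply IsMultilinear.pc
  all_goals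
    refine ev_eq_iff ?_
    simp [S.lin2.ev_zero_2_1, S.lin2.ev_zero_2_2, S.lin211.ev_zero_2_1, S.lin211.ev_zero_2_2,
      S.lin32.ev_zero_3_1, S.lin32.ev_zero_3_2, S.lin32.ev_zero_3_3]

theorem w9_iff : S.l4 + pa (P12 4) S.l4 = pc 2 0 1 S.l2 S.l31 - pc 2 2 0 S.l31 S.l2
        + pa (P123 4) (pc 2 1 0 S.l2 S.l31) + pc 2 0 2 S.l3 S.l21 ↔
      ∀ x y z w, S.ops.q x y z w + S.ops.q y x z w
    = S.ops.m20 (S.ops.u x y z) w - S.ops.u x y (S.ops.m00 z w) + S.ops.m02 z (S.ops.u x y w)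
      + S.ops.t100 (S.ops.s00 x y) z w := by
  refine (ext_4_2 (k := k) S.bound S.bound ?_ ?_).trans (forall₄_congr fun x y z w => ?_)
  iterate 2
    · with_reducible repeat' first
        | exact S.lin2 | exact S.lin21 | exact S.lin3 | exact S.lin31 | exact S.lin4
        | apply IsMultilinear.add | apply IsMultilinear.sub | apply IsMultilinear.pa
          | apply IsMultilinear.pc
  all_goals
    refine ev_eq_iff ?_
    simp [S.lin2.ev_zero_2_1, S.lin2.ev_zero_2_2, S.lin3.ev_zero_3_1, S.lin3.ev_zero_3_2,
      S.lin3.ev_zero_3_3, S.lin4.ev_zero_4_1, S.lin4.ev_zero_4_2, S.lin4.ev_zero_4_3,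
      S.lin4.ev_zero_4_4, S.lin21.ev_zero_2_1, S.lin21.ev_zero_2_2, S.lin31.ev_zero_3_1,
      S.lin31.ev_zero_3_2, S.lin31.ev_zero_3_3]

theorem w10_iff : S.l4 + pa
  (P23 4) S.l4 = pc 2 0 1 S.l2 S.l32 - pc 2 1 1 S.l3 S.l21 + pc 2 1 0 S.l2 S.l31
        - pc 2 0 2 S.l31 S.l2 - pa (P12 4) (pc 2 1 1 S.l31 S.l2) - pa (P132 4)
          (pc 2 2 0 S.l31 S.l2) ↔
      ∀ x y z w, S.ops.q x y z w + S.ops.q x z y w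
    = S.ops.m20 (S.ops.v x y z) w - S.ops.t010 x (S.ops.s00 y z) w + S.ops.m02 x (S.ops.u y z w)
      - S.ops.u (S.ops.m00 x y) z w - S.ops.u y (S.ops.m00 x z) w - S.ops.u y z
        (S.ops.m00 x w) := by
  refine (ext_4_2 (k := k) S.bound S.bound ?_ ?_).trans (forall₄_congr fun x y z w => ?_)
  iterate 2
    · with_reducible repeat' first
        | exact S.lin2 | exact S.lin21 | exact S.lin3 | exact S.lin31 | exact S.lin32 | exact S.lin4
        | apply IsMultilinear.add | apply IsMultilinear.sub | apply IsMultilinear.pa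
          | apply IsMultilinear.pc
  all_goals
    refine ev_eq_iff ?_
    simp [S.lin2.ev_zero_2_1, S.lin2.ev_zero_2_2, S.lin3.ev_zero_3_1, S.lin3.ev_zero_3_2,
      S.lin3.ev_zero_3_3, S.lin4.ev_zero_4_1, S.lin4.ev_zero_4_2, S.lin4.ev_zero_4_3,
      S.lin4.ev_zero_4_4, S.lin21.ev_zero_2_1, S.lin21.ev_zero_2_2, S.lin31.ev_zero_3_1,
      S.lin31.ev_zero_3_2, S.lin31.ev_zero_3_3, S.lin32.ev_zero_3_1, S.lin32.ev_zero_3_2,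
      S.lin32.ev_zero_3_3]

theorem w11_iff : S.l4 + pa
  (P34 4) S.l4 = pc 2 0 1 S.l21 S.l3 - pc 2 0 2 S.l32 S.l2 + pc 2 1 1 S.l32 S.l2
        - pa (P12 4) (pc 2 1 1 S.l32 S.l2) + pc 2 2 0 S.l3 S.l21 + pa (P23 4) (pc 2 2 0 S.l32 S.l2)
        - pa (P132 4) (pc 2 2 0 S.l32 S.l2) + pc 2 1 0 S.l2 S.l32 - pa (P12 4) (pc 2 1 0 S.l2 S.l32)
        + pa (P123 4) (pc 2 1 0 S.l21 S.l3) ↔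
      ∀ x y z w, S.ops.q x y z w + S.ops.q x y w z
    = S.ops.s10 (S.ops.t000 x y z) w - S.ops.v (S.ops.m00 x y) z w + S.ops.v x (S.ops.m00 y z) w
      - S.ops.v y (S.ops.m00 x z) w + S.ops.t001 x y (S.ops.s00 z w) + S.ops.v x z (S.ops.m00 y w)
      - S.ops.v y z (S.ops.m00 x w) + S.ops.m02 x (S.ops.v y z w) - S.ops.m02 y (S.ops.v x z w)
      + S.ops.s01 z (S.ops.t000 x y w) := by
  refine (ext_4_2 (k := k) S.bound S.bound ?_ ?_).trans (forall₄_congr fun x y z w => ?_)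
  iterate 2
    · with_reducible repeat' first
        | exact S.lin2 | exact S.lin21 | exact S.lin3 | exact S.lin32 | exact S.lin4
        | apply IsMultilinear.add | apply IsMultilinear.sub | apply IsMultilinear.pa
          | apply IsMultilinear.pc
  all_goals
    refine ev_eq_iff ?_
    simp [S.lin2.ev_zero_2_1, S.lin2.ev_zero_2_2, S.lin3.ev_zero_3_1, S.lin3.ev_zero_3_2,
      S.lin3.ev_zero_3_3, S.lin4.ev_zero_4_1, S.lin4.ev_zero_4_2, S.lin4.ev_zero_4_3,
      S.lin4.ev_zero_4_4, S.lin21.ev_zero_2_1, S.lin21.ev_zero_2_2, S.lin32.ev_zero_3_1,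
      S.lin32.ev_zero_3_2, S.lin32.ev_zero_3_3]

end StructureMaps

end Components

section Transfer

variable {k : Type} [CommRing k] {L L' : ℤ → Type}
  [∀ i, AddCommGroup (L i)] [∀ i, Module k (L i)]
  [∀ i, AddCommGroup (L' i)] [∀ i, Module k (L' i)]

namespace WeakLie3

/-- The structure maps of a weak Lie 3-algebra, forgetting the equations. -/
def structureMaps (A : WeakLie3 k L) : StructureMaps k L :=
  { A with
    lin2 := A.leib.lin2
    lin3 := A.leib.lin3
    lin4 := A.leib.lin4 }

variable (A : WeakLie3 k L)

theorem D_eq : A.D = A.structureMaps.D := rfl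

theorem l2_eq : A.l2 = A.structureMaps.l2 := rfl

theorem l3_eq : A.l3 = A.structureMaps.l3 := rfl

theorem l4_eq : A.l4 = A.structureMaps.l4 := rfl

theorem l21_eq : A.l21 = A.structureMaps.l21 := rfl

theorem l211_eq : A.l211 = A.structureMaps.l211 := rfl

theorem l31_eq : A.l31 = A.structureMaps.l31 := rfl

theorem l32_eq : A.l32 = A.structureMaps.l32 := rfl

theorem ops_eqs : A.structureMaps.ops.Eqs := by
  obtain ⟨L1_10, L1_01, L1_20, L1_11, L1_02, L1_21, L1_12⟩ := (StructureMaps.eqL1_iff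
    (S := A.structureMaps)).1 A.leib.eqL1
  obtain ⟨L2_000, L2_100, L2_010, L2_001, L2_200, L2_020, L2_002, L2_110, L2_101,
    L2_011⟩ := (StructureMaps.eqL2_iff (S := A.structureMaps)).1 A.leib.eqL2
  obtain ⟨L3_0000, L3_1000, L3_0100, L3_0010, L3_0001⟩ := (StructureMaps.eqL3_iff
    (S := A.structureMaps)).1 A.leib.eqL3
  obtain L4 := (StructureMaps.eqL4_iff (S := A.structureMaps)).1 A.leib.eqL4
  obtain ⟨W1_00, W1_10, W1_01, W1_20, W1_11, W1_02⟩ := (StructureMaps.w1_iff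
    (S := A.structureMaps)).1 A.w1
  obtain ⟨W2_00, W2_10, W2_01⟩ := (StructureMaps.w2_iff (S := A.structureMaps)).1 A.w2
  obtain ⟨W3_000, W3_100, W3_010, W3_001⟩ := (StructureMaps.w3_iff (S := A.structureMaps)).1 A.w3
  obtain ⟨W4_000, W4_100, W4_010, W4_001⟩ := (StructureMaps.w4_iff (S := A.structureMaps)).1 A.w4
  obtain W5 := (StructureMaps.w5_iff (S := A.structureMaps)).1 A.w5
  obtain W6 := (StructureMaps.w6_iff (S := A.structureMaps)).1 A.w6
  obtain W7 := (StructureMaps.w7_iff (S := A.structureMaps)).1 A.w7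
  obtain W8 := (StructureMaps.w8_iff (S := A.structureMaps)).1 A.w8
  obtain W9 := (StructureMaps.w9_iff (S := A.structureMaps)).1 A.w9
  obtain W10 := (StructureMaps.w10_iff (S := A.structureMaps)).1 A.w10
  obtain W11 := (StructureMaps.w11_iff (S := A.structureMaps)).1 A.w11
  constructor <;> assumption

end WeakLie3

namespace StructureMaps

/-- Structure maps whose components satisfy the equations form a weak Lie 3-algebra. -/
def toWeakLie3 (S : StructureMaps k L) (hdd : fc1 (-2) S.D S.D = 0) (hS : S.ops.Eqs) :
    WeakLie3 k L :=
  { S with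
    dd := hdd
    leib :=
      { S with
        eqL1 := eqL1_iff.2 ⟨hS.L1_10, hS.L1_01, hS.L1_20, hS.L1_11, hS.L1_02, hS.L1_21, hS.L1_12⟩
        eqL2 := eqL2_iff.2 ⟨hS.L2_000, hS.L2_100, hS.L2_010, hS.L2_001, hS.L2_200, hS.L2_020,
          hS.L2_002, hS.L2_110, hS.L2_101, hS.L2_011⟩
        eqL3 := eqL3_iff.2 ⟨hS.L3_0000, hS.L3_1000, hS.L3_0100, hS.L3_0010, hS.L3_0001⟩
        eqL4 := eqL4_iff.2 hS.L4 }
    w1 := w1_iff.2 ⟨hS.W1_00, hS.W1_10, hS.W1_01, hS.W1_20, hS.W1_11, hS.W1_02⟩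
    w2 := w2_iff.2 ⟨hS.W2_00, hS.W2_10, hS.W2_01⟩
    w3 := w3_iff.2 ⟨hS.W3_000, hS.W3_100, hS.W3_010, hS.W3_001⟩
    w4 := w4_iff.2 ⟨hS.W4_000, hS.W4_100, hS.W4_010, hS.W4_001⟩
    w5 := w5_iff.2 hS.W5
    w6 := w6_iff.2 hS.W6
    w7 := w7_iff.2 hS.W7
    w8 := w8_iff.2 hS.W8
    w9 := w9_iff.2 hS.W9
    w10 := w10_iff.2 hS.W10
    w11 := w11_iff.2 hS.W11 }

end StructureMaps

variable {A : WeakLie3 k L} {D' : MMap L' L' 1 (-1)} {p : MMap L L' 1 0} {i : MMap L' L 1 0}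
  {h : MMap L L 1 1}

attribute [local simp] WeakLie3.D_eq WeakLie3.l2_eq WeakLie3.l3_eq WeakLie3.l4_eq WeakLie3.l21_eq
  WeakLie3.l211_eq WeakLie3.l31_eq WeakLie3.l32_eq ev_fc2_1_1 ev_fc2_2_2 ev_fc3_1_1_1 ev_fc4_1_1_1_1

namespace IsDefRetract

/-- The components of a deformation retract. -/
def componentRetract (hret : IsDefRetract k A.D D' p i h) (hD' : IsMultilinear k D') :
    A.structureMaps.ops.Retract (L' 0) (L' 1) (L' 2) where
  e₁ := coeff₁ hD' 1 0
  e₂ := coeff₁ hD' 2 1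
  i₀ := coeff₁ hret.lini 0 0
  i₁ := coeff₁ hret.lini 1 1
  i₂ := coeff₁ hret.lini 2 2
  p₀ := coeff₁ hret.linp 0 0
  p₁ := coeff₁ hret.linp 1 1
  p₂ := coeff₁ hret.linp 2 2
  h₀ := coeff₁ hret.linh 0 1
  h₁ := coeff₁ hret.linh 1 2
  e_p₁ x := incl_injective 0 (by
    have := congrArg (fun μ => ev μ ![1] ![incl 1 x]) hret.chainp
    simp [ev_coeff₁ hret.linp (a := 1) (t := 1) (by norm_num),
      ev_coeff₁ hret.linp (a := 0) (t := 0) (by norm_num),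
      ev_coeff₁ hD' (a := 1) (t := 0) (by norm_num)] at this
    exact sub_eq_zero.1 this)
  e_p₂ x := incl_injective 1 (by
    have := congrArg (fun μ => ev μ ![2] ![incl 2 x]) hret.chainp
    simp [ev_coeff₁ hret.linp (a := 2) (t := 2) (by norm_num),
      ev_coeff₁ hret.linp (a := 1) (t := 1) (by norm_num),
      ev_coeff₁ hD' (a := 2) (t := 1) (by norm_num)] at this
    exact sub_eq_zero.1 this)
  i_e₁ x := incl_injective 0 (by
    have := congrArg (fun μ => ev μ ![1] ![incl 1 x]) hret.chaini
    simp [ev_coeff₁ hret.lini (a := 1) (t := 1) (by norm_num),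
      ev_coeff₁ hret.lini (a := 0) (t := 0) (by norm_num),
      ev_coeff₁ hD' (a := 1) (t := 0) (by norm_num)] at this
    exact (sub_eq_zero.1 this).symm)
  i_e₂ x := incl_injective 1 (by
    have := congrArg (fun μ => ev μ ![2] ![incl 2 x]) hret.chaini
    simp [ev_coeff₁ hret.lini (a := 2) (t := 2) (by norm_num),
      ev_coeff₁ hret.lini (a := 1) (t := 1) (by norm_num),
      ev_coeff₁ hD' (a := 2) (t := 1) (by norm_num)] at this
    exact (sub_eq_zero.1 this).symm)
  d_h₀ x := incl_injective 0 (by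
    have := congrArg (fun μ => ev μ ![0] ![incl 0 x]) hret.homotopy
    simp [ev_idm,
      ev_coeff₁ hret.linp (a := 0) (t := 0) (by norm_num),
      ev_coeff₁ hret.lini (a := 0) (t := 0) (by norm_num),
      ev_coeff₁ hret.linh (a := 0) (t := 1) (by norm_num),
      hret.linh.ev_zero_1_1] at this
    rw [map_sub]
    exact this.symm)
  d_h₁ x := incl_injective 1 (by
    have := congrArg (fun μ => ev μ ![1] ![incl 1 x]) hret.homotopy
    simp [ev_idm,
      ev_coeff₁ hret.linp (a := 1) (t := 1) (by norm_num),
      ev_coeff₁ hret.lini (a := 1) (t := 1) (by norm_num),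
      ev_coeff₁ hret.linh (a := 1) (t := 2) (by norm_num),
      ev_coeff₁ hret.linh (a := 0) (t := 1) (by norm_num)] at this
    rw [map_sub, map_sub, eq_sub_iff_add_eq]
    exact this.symm)
  i_p₂ x := incl_injective 2 (by
    have := congrArg (fun μ => ev μ ![2] ![incl 2 x]) hret.homotopy
    simp [ev_idm,
      ev_coeff₁ hret.linp (a := 2) (t := 2) (by norm_num),
      ev_coeff₁ hret.lini (a := 2) (t := 2) (by norm_num),
      ev_coeff₁ hret.linh (a := 1) (t := 2) (by norm_num),
      ev_eq_zero_of_degree A.bound h ![2] _ (by decide),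
      A.structureMaps.linD.ev_zero_1_1] at this
    rw [map_sub, ← this]
    exact (sub_sub_cancel _ _).symm)

end IsDefRetract

theorem IsMultilinear.ev_add_one {r : ℤ} {μ : MMap L L' 1 r} (hμ : IsMultilinear k μ) (a : ℤ)
    (X Y : ∀ i, L i) : ev μ ![a] ![X + Y] = ev μ ![a] ![X] + ev μ ![a] ![Y] := by
  refine (isMultilinear_iff.1 hμ _).map_add_of 0 rfl ?_ ?_ <;>
    intro j hj <;> fin_cases j <;> exact absurd rfl hj

theorem IsMultilinear.ev_sub_one {r : ℤ} {μ : MMap L L' 1 r} (hμ : IsMultilinear k μ) (a : ℤ)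
    (X Y : ∀ i, L i) : ev μ ![a] ![X - Y] = ev μ ![a] ![X] - ev μ ![a] ![Y] :=
  map_sub (AddMonoidHom.mk' (fun X => ev μ ![a] ![X]) (hμ.ev_add_one a)) X Y

theorem IsMultilinear.ev_neg_one {r : ℤ} {μ : MMap L L' 1 r} (hμ : IsMultilinear k μ) (a : ℤ)
    (X : ∀ i, L i) : ev μ ![a] ![-X] = -ev μ ![a] ![X] :=
  map_neg (AddMonoidHom.mk' (fun X => ev μ ![a] ![X]) (hμ.ev_add_one a)) X

namespace IsDefRetract

variable (hret : IsDefRetract k A.D D' p i h) (hD' : IsMultilinear k D')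

theorem ev_i_0 (x : L' 0) :
    ev i ![0] ![incl 0 x] = incl 0 ((hret.componentRetract hD').i₀ x) :=
  ev_coeff₁ hret.lini (by norm_num) x

theorem ev_i_1 (x : L' 1) :
    ev i ![1] ![incl 1 x] = incl 1 ((hret.componentRetract hD').i₁ x) :=
  ev_coeff₁ hret.lini (by norm_num) x

theorem ev_i_2 (x : L' 2) :
    ev i ![2] ![incl 2 x] = incl 2 ((hret.componentRetract hD').i₂ x) :=
  ev_coeff₁ hret.lini (by norm_num) x

theorem ev_p_0 (x : L 0) :
    ev p ![0] ![incl 0 x] = incl 0 ((hret.componentRetract hD').p₀ x) :=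
  ev_coeff₁ hret.linp (by norm_num) x

theorem ev_p_1 (x : L 1) :
    ev p ![1] ![incl 1 x] = incl 1 ((hret.componentRetract hD').p₁ x) :=
  ev_coeff₁ hret.linp (by norm_num) x

theorem ev_p_2 (x : L 2) :
    ev p ![2] ![incl 2 x] = incl 2 ((hret.componentRetract hD').p₂ x) :=
  ev_coeff₁ hret.linp (by norm_num) x

theorem ev_h_0 (x : L 0) :
    ev h ![0] ![incl 0 x] = incl 1 ((hret.componentRetract hD').h₀ x) :=
  ev_coeff₁ hret.linh (by norm_num) x

theorem ev_h_1 (x : L 1) :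
    ev h ![1] ![incl 1 x] = incl 2 ((hret.componentRetract hD').h₁ x) :=
  ev_coeff₁ hret.linh (by norm_num) x

/-- The transferred structure maps. -/
def transferMaps (hL' : ∀ i : ℤ, (i < 0 ∨ 2 < i) → ∀ x : L' i, x = 0) : StructureMaps k L' where
  D := D'
  l2 := tl2 A p i
  l3 := tl3 A p i h
  l4 := tl4 A p i h
  l21 := tl21 A p i
  l211 := tl211 A p i
  l31 := tl31 A p i h
  l32 := tl32 A p i h
  linD := hD'
  bound := hL'
  lin2 := by
    unfold tl2
    with_reducible repeat' first
      | exact hret.linp | exact hret.lini | exact A.leib.lin2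
      | apply IsMultilinear.fc1 | apply IsMultilinear.fc2
  lin3 := by
    unfold tl3 hl2
    with_reducible repeat' first
      | exact hret.linp | exact hret.lini | exact hret.linh | exact A.leib.lin2 | exact A.leib.lin3
      | apply IsMultilinear.add | apply IsMultilinear.sub | apply IsMultilinear.pa
        | apply IsMultilinear.pc | apply IsMultilinear.fc1 | apply IsMultilinear.fc3
  lin4 := by
    unfold tl4 hl2 hl3
    with_reducible repeat' first
      | exact hret.linp | exact hret.lini | exact hret.linh | exact A.leib.lin2
        | exact A.leib.lin3 | exact A.leib.lin4
      | apply IsMultilinear.add | apply IsMultilinear.sub | apply IsMultilinear.pa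
        | apply IsMultilinear.pc | apply IsMultilinear.fc1 | apply IsMultilinear.fc2
        | apply IsMultilinear.fc4
  lin21 := by
    unfold tl21
    with_reducible repeat' first
      | exact hret.linp | exact hret.lini | exact A.lin21
      | apply IsMultilinear.fc1 | apply IsMultilinear.fc2
  lin211 := by
    unfold tl211
    with_reducible repeat' first
      | exact hret.linp | exact hret.lini | exact A.lin211
      | apply IsMultilinear.fc1 | apply IsMultilinear.fc2
  lin31 := by
    unfold tl31 hl21
    with_reducible repeat' first
      | exact hret.linp | exact hret.lini | exact hret.linh | exact A.leib.lin2 | exact A.lin21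
        | exact A.lin31
      | apply IsMultilinear.sub | apply IsMultilinear.pc | apply IsMultilinear.fc1
        | apply IsMultilinear.fc3
  lin32 := by
    unfold tl32 hl2 hl21
    with_reducible repeat' first
      | exact hret.linp | exact hret.lini | exact hret.linh | exact A.leib.lin2 | exact A.lin21
        | exact A.lin32
      | apply IsMultilinear.add | apply IsMultilinear.pa | apply IsMultilinear.pc
        | apply IsMultilinear.fc1 | apply IsMultilinear.fc3
open Ops.Retract in
set_option maxHeartbeats 1000000 in
-- the transferred quaternary bracket has 31 tree summands
theorem ev_tl4 (x y z w : L' 0) : ev (tl4 A p i h) ![0, 0, 0, 0] ![incl 0 x, incl 0 y, incl 0 z,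
  incl 0 w]
    = incl 2 ((hret.componentRetract hD').transfer.q x y z w) := by
  simp [tl4, hl2, hl3, hret.ev_i_0 hD', hret.ev_p_2 hD', hret.ev_h_0 hD', hret.ev_h_1 hD',
    hret.linp.ev_add_one, hret.linp.ev_sub_one, transfer, T000_apply,
    T4_apply, H2_apply, H3_apply]
  abel1

variable (hL' : ∀ i : ℤ, (i < 0 ∨ 2 < i) → ∀ x : L' i, x = 0)

open Ops.Retract in
set_option maxHeartbeats 1000000 in
-- one simplification for each component
theorem ops_transferMaps :
    (hret.transferMaps hD' hL').ops = (hret.componentRetract hD').transfer := by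
  refine Ops.ext rfl rfl ?_ ?_ ?_ ?_ ?_ ?_ ?_ ?_ ?_ ?_ ?_ ?_ ?_ ?_ ?_ ?_ ?_
  · refine AddMonoidHom.ext fun x => AddMonoidHom.ext fun y => incl_injective 0 ?_
    refine (StructureMaps.ev_l2_00 _ x y).symm.trans ?_
    change ev (tl2 A p i) _ _ = _
    simp [tl2, hret.ev_i_0 hD', hret.ev_p_0 hD', transfer]
  · refine AddMonoidHom.ext fun x => AddMonoidHom.ext fun y => incl_injective 1 ?_
    refine (StructureMaps.ev_l2_10 _ x y).symm.trans ?_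
    change ev (tl2 A p i) _ _ = _
    simp [tl2, hret.ev_i_0 hD', hret.ev_i_1 hD', hret.ev_p_1 hD', transfer]
  · refine AddMonoidHom.ext fun x => AddMonoidHom.ext fun y => incl_injective 1 ?_
    refine (StructureMaps.ev_l2_01 _ x y).symm.trans ?_
    change ev (tl2 A p i) _ _ = _
    simp [tl2, hret.ev_i_0 hD', hret.ev_i_1 hD', hret.ev_p_1 hD', transfer]
  · refine AddMonoidHom.ext fun x => AddMonoidHom.ext fun y => incl_injective 2 ?_
    refine (StructureMaps.ev_l2_20 _ x y).symm.trans ?_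
    change ev (tl2 A p i) _ _ = _
    simp [tl2, hret.ev_i_0 hD', hret.ev_i_2 hD', hret.ev_p_2 hD', transfer]
  · refine AddMonoidHom.ext fun x => AddMonoidHom.ext fun y => incl_injective 2 ?_
    refine (StructureMaps.ev_l2_11 _ x y).symm.trans ?_
    change ev (tl2 A p i) _ _ = _
    simp [tl2, hret.ev_i_1 hD', hret.ev_p_2 hD', transfer]
  · refine AddMonoidHom.ext fun x => AddMonoidHom.ext fun y => incl_injective 2 ?_
    refine (StructureMaps.ev_l2_02 _ x y).symm.trans ?_
    change ev (tl2 A p i) _ _ = _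
    simp [tl2, hret.ev_i_0 hD', hret.ev_i_2 hD', hret.ev_p_2 hD', transfer]
  · refine AddMonoidHom.ext fun x => AddMonoidHom.ext fun y => AddMonoidHom.ext fun z =>
      incl_injective 1 ?_
    refine (StructureMaps.ev_l3_000 _ x y z).symm.trans ?_
    change ev (tl3 A p i h) _ _ = _
    simp [tl3, hl2, hret.ev_i_0 hD', hret.ev_p_1 hD', hret.ev_h_0 hD', hret.linp.ev_sub_one,
      T000_apply, H2_apply, transfer]
    abel1
  · refine AddMonoidHom.ext fun x => AddMonoidHom.ext fun y => AddMonoidHom.ext fun z =>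
      incl_injective 2 ?_
    refine (StructureMaps.ev_l3_100 _ x y z).symm.trans ?_
    change ev (tl3 A p i h) _ _ = _
    simp [tl3, hl2, hret.ev_i_0 hD', hret.ev_i_1 hD', hret.ev_p_2 hD', hret.ev_h_0 hD',
      hret.ev_h_1 hD', hret.linp.ev_sub_one, hret.linp.ev_neg_one, T100_apply, H2_apply, transfer]
    abel1
  · refine AddMonoidHom.ext fun x => AddMonoidHom.ext fun y => AddMonoidHom.ext fun z =>
      incl_injective 2 ?_
    refine (StructureMaps.ev_l3_010 _ x y z).symm.trans ?_
    change ev (tl3 A p i h) _ _ = _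
    simp [tl3, hl2, hret.ev_i_0 hD', hret.ev_i_1 hD', hret.ev_p_2 hD', hret.ev_h_0 hD',
      hret.ev_h_1 hD', hret.linp.ev_sub_one, hret.linp.ev_add_one, T010_apply, H2_apply, transfer]
    abel1
  · refine AddMonoidHom.ext fun x => AddMonoidHom.ext fun y => AddMonoidHom.ext fun z =>
      incl_injective 2 ?_
    refine (StructureMaps.ev_l3_001 _ x y z).symm.trans ?_
    change ev (tl3 A p i h) _ _ = _
    simp [tl3, hl2, hret.ev_i_0 hD', hret.ev_i_1 hD', hret.ev_p_2 hD', hret.ev_h_0 hD',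
      hret.ev_h_1 hD', hret.linp.ev_sub_one, T001_apply, H2_apply, transfer]
    abel1
  · refine AddMonoidHom.ext fun x => AddMonoidHom.ext fun y => AddMonoidHom.ext fun z =>
      AddMonoidHom.ext fun w => incl_injective 2 ?_
    exact (StructureMaps.ev_l4_0000 _ x y z w).symm.trans (hret.ev_tl4 hD' x y z w)
  · refine AddMonoidHom.ext fun x => AddMonoidHom.ext fun y => incl_injective 1 ?_
    refine (StructureMaps.ev_l21_00 _ x y).symm.trans ?_
    change ev (tl21 A p i) _ _ = _
    simp [tl21, hret.ev_i_0 hD', hret.ev_p_1 hD', transfer]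
  · refine AddMonoidHom.ext fun x => AddMonoidHom.ext fun y => incl_injective 2 ?_
    refine (StructureMaps.ev_l21_10 _ x y).symm.trans ?_
    change ev (tl21 A p i) _ _ = _
    simp [tl21, hret.ev_i_0 hD', hret.ev_i_1 hD', hret.ev_p_2 hD', transfer]
  · refine AddMonoidHom.ext fun x => AddMonoidHom.ext fun y => incl_injective 2 ?_
    refine (StructureMaps.ev_l21_01 _ x y).symm.trans ?_
    change ev (tl21 A p i) _ _ = _
    simp [tl21, hret.ev_i_0 hD', hret.ev_i_1 hD', hret.ev_p_2 hD', transfer]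
  · refine AddMonoidHom.ext fun x => AddMonoidHom.ext fun y => incl_injective 2 ?_
    refine (StructureMaps.ev_l211_00 _ x y).symm.trans ?_
    change ev (tl211 A p i) _ _ = _
    simp [tl211, hret.ev_i_0 hD', hret.ev_p_2 hD', transfer]
  · refine AddMonoidHom.ext fun x => AddMonoidHom.ext fun y => AddMonoidHom.ext fun z =>
      incl_injective 2 ?_
    refine (StructureMaps.ev_l31_000 _ x y z).symm.trans ?_
    change ev (tl31 A p i h) _ _ = _
    simp [tl31, hl21, hret.ev_i_0 hD', hret.ev_p_2 hD', hret.ev_h_1 hD', T31_apply, transfer]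
  · refine AddMonoidHom.ext fun x => AddMonoidHom.ext fun y => AddMonoidHom.ext fun z =>
      incl_injective 2 ?_
    refine (StructureMaps.ev_l32_000 _ x y z).symm.trans ?_
    change ev (tl32 A p i h) _ _ = _
    simp [tl32, hl2, hl21, hret.ev_i_0 hD', hret.ev_p_2 hD', hret.ev_h_0 hD', hret.ev_h_1 hD',
      hret.linp.ev_add_one, T32_apply, H2_apply, transfer]
    abel1

end IsDefRetract

end Transfer

/-- **The transferred structure is a weak Lie 3-algebra**: given a weak Lie 3-algebra
`(L, d, λ)` and a deformation retract `(p, i, h)` of `(L, d)` onto `(L', d')`, the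
transferred structure maps `λ2', λ3', λ4', λ21', λ211', λ31', λ32'` satisfy equations
(L1)–(L4) and (W1)–(W11), i.e. they form a weak Lie 3-algebra structure on `(L', d')`. -/
theorem transferred_structure_is_weak_Lie3
    (k : Type) [CommRing k] {L L' : ℤ → Type}
    [∀ i, AddCommGroup (L i)] [∀ i, Module k (L i)]
    [∀ i, AddCommGroup (L' i)] [∀ i, Module k (L' i)]
    (A : WeakLie3 k L)
    (D' : MMap L' L' 1 (-1)) (hlinD' : IsMultilinear k D') (hdd' : fc1 (-2) D' D' = 0)
    (hbound' : ∀ i : ℤ, (i < 0 ∨ 2 < i) → ∀ x : L' i, x = 0)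
    (p : MMap L L' 1 0) (i : MMap L' L 1 0) (h : MMap L L 1 1)
    (hret : IsDefRetract k A.D D' p i h) :
    ∃ B : WeakLie3 k L',
      B.D = D' ∧ B.l2 = tl2 A p i ∧ B.l3 = tl3 A p i h ∧ B.l4 = tl4 A p i h ∧
      B.l21 = tl21 A p i ∧ B.l211 = tl211 A p i ∧ B.l31 = tl31 A p i h ∧
      B.l32 = tl32 A p i h := by
  refine ⟨(hret.transferMaps hlinD' hbound').toWeakLie3 hdd' ?_,
    rfl, rfl, rfl, rfl, rfl, rfl, rfl, rfl⟩
  rw [hret.ops_transferMaps]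
  exact Ops.Retract.transfer_eqs _ A.ops_eqs

end WL3
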